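/- Let Ω be homogeneous of degree zero on ℝⁿ \ {0} with mean value zero on S^{n-1}, and suppose Ω satisfies the L¹-Dini condition. Let μ be an absolutely continuous signed measure on ℝⁿ with |μ|(ℝⁿ) < ∞, and for t > 0 let μ_t(E) = μ(E/t). Then for every fixed λ > 0, lim_{t→0⁺} λ · m({x ∈ ℝⁿ : |T_Ω μ_t(x)| > λ}) = (1/n) ‖Ω‖_{L¹(S^{n-1})} · |μ(ℝⁿ)|. -/

import Mathlib

open MeasureTheory Filter Set

noncomputable section

/-- The unit sphere `S^{n-1}` in `ℝⁿ`. -/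
abbrev unitSphere (n : ℕ) := Metric.sphere (0 : EuclideanSpace ℝ (Fin n)) 1

/-- The surface (area) measure `σ` on the unit sphere `S^{n-1}`. -/
def sphereMeasure (n : ℕ) : Measure (unitSphere n) :=
  (volume : Measure (EuclideanSpace ℝ (Fin n))).toSphere

/-- `Ω` is homogeneous of degree zero on `ℝⁿ \ {0}`. -/
def HomogeneousZero {n : ℕ} (Ω : EuclideanSpace ℝ (Fin n) → ℝ) : Prop :=
  ∀ c : ℝ, 0 < c → ∀ x : EuclideanSpace ℝ (Fin n), x ≠ 0 → Ω (c • x) = Ω x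

/-- The `L¹` integral modulus of continuity of `Ω`, defined via rotations:
`ω₁(δ) = sup_{‖ρ‖ ≤ δ} ∫_{S^{n-1}} |Ω(ρθ) - Ω(θ)| dσ(θ)`, where `ρ` ranges over
rotations of `ℝⁿ` (linear isometries of determinant `1`) and
`‖ρ‖ = sup{ |ρx' - x'| : x' ∈ S^{n-1} }`. -/
def omegaRot (n : ℕ) (Ω : EuclideanSpace ℝ (Fin n) → ℝ) (δ : ℝ) : ℝ :=
  sSup {I : ℝ | ∃ ρ : EuclideanSpace ℝ (Fin n) ≃ₗᵢ[ℝ] EuclideanSpace ℝ (Fin n),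
    LinearMap.det (ρ.toLinearEquiv : EuclideanSpace ℝ (Fin n) →ₗ[ℝ] EuclideanSpace ℝ (Fin n)) = 1 ∧
    (∀ x : EuclideanSpace ℝ (Fin n), ‖x‖ = 1 → ‖ρ x - x‖ ≤ δ) ∧
    I = ∫ θ : unitSphere n, |Ω (ρ (θ : EuclideanSpace ℝ (Fin n))) - Ω (θ : EuclideanSpace ℝ (Fin n))| ∂(sphereMeasure n)}

/-- The `L¹` integral modulus of continuity of `Ω`, defined via translations:
`ω̃₁(δ) = sup_{|h| ≤ δ} ∫_{S^{n-1}} |Ω(θ + h) - Ω(θ)| dσ(θ)`, where `Ω` is evaluated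
off the sphere via its degree-zero homogeneous extension. -/
def omegaTrans (n : ℕ) (Ω : EuclideanSpace ℝ (Fin n) → ℝ) (δ : ℝ) : ℝ :=
  sSup {I : ℝ | ∃ h : EuclideanSpace ℝ (Fin n), ‖h‖ ≤ δ ∧
    I = ∫ θ : unitSphere n, |Ω ((θ : EuclideanSpace ℝ (Fin n)) + h) - Ω (θ : EuclideanSpace ℝ (Fin n))| ∂(sphereMeasure n)}

/-- `Ω` satisfies the `L¹`-Dini condition. -/
def L1Dini (n : ℕ) (Ω : EuclideanSpace ℝ (Fin n) → ℝ) : Prop :=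
  Integrable (fun θ : unitSphere n => Ω (θ : EuclideanSpace ℝ (Fin n))) (sphereMeasure n) ∧
  ∫⁻ δ in Ioo (0 : ℝ) 1, ENNReal.ofReal (omegaRot n Ω δ / δ) < ⊤

/-- The truncated singular integral `∫_{|x-y| > ε} Ω(x-y)|x-y|^{-n} dμ(y)` of a signed
measure `μ`, where integration against `μ` is via its Jordan decomposition. -/
def truncT (n : ℕ) (Ω : EuclideanSpace ℝ (Fin n) → ℝ)
    (μ : SignedMeasure (EuclideanSpace ℝ (Fin n))) (x : EuclideanSpace ℝ (Fin n)) (ε : ℝ) : ℝ :=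
  (∫ y in {y | ε < ‖x - y‖}, Ω (x - y) / ‖x - y‖ ^ n ∂μ.toJordanDecomposition.posPart) -
  (∫ y in {y | ε < ‖x - y‖}, Ω (x - y) / ‖x - y‖ ^ n ∂μ.toJordanDecomposition.negPart)

/-- The principal-value singular integral `T_Ω μ(x) = p.v. ∫ Ω(x-y)|x-y|^{-n} dμ(y)`. -/
def TOmega (n : ℕ) (Ω : EuclideanSpace ℝ (Fin n) → ℝ)
    (μ : SignedMeasure (EuclideanSpace ℝ (Fin n))) (x : EuclideanSpace ℝ (Fin n)) : ℝ :=
  limUnder (nhdsWithin (0 : ℝ) (Ioi 0)) (truncT n Ω μ x)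

section CalderonZygmund

open Metric Module
open scoped ENNReal NNReal Topology

variable {E : Type*} [NormedAddCommGroup E] [InnerProductSpace ℝ E] [FiniteDimensional ℝ E]
  [MeasurableSpace E] [BorelSpace E]

lemma volume_closedBall_mul (x y : E) {a r : ℝ} (ha : 0 < a) (hr : 0 ≤ r) :
    volume (closedBall x (a * r)) = ENNReal.ofReal (a ^ finrank ℝ E) * volume (closedBall y r) := by
  rw [Measure.addHaar_closedBall _ _ (by positivity), Measure.addHaar_closedBall _ _ hr, mul_pow,
    ENNReal.ofReal_mul (by positivity), mul_assoc]

lemma radius_le_of_volume_closedBall_le [Nontrivial E] {x : E} {r : ℝ} {M : ℝ≥0∞} (hM : M ≠ ∞)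
    (h : volume (closedBall x r) ≤ M) :
    r ≤ max 1 (M / volume (ball (0 : E) 1)).toReal := by
  by_cases hr : r ≤ 1
  · exact hr.trans (le_max_left _ _)
  push Not at hr
  refine le_trans ?_ (le_max_right _ _)
  have hv : volume (ball (0 : E) 1) ≠ 0 := (measure_ball_pos _ _ one_pos).ne'
  rw [← ENNReal.ofReal_le_iff_le_toReal (ENNReal.div_ne_top hM hv),
    ENNReal.le_div_iff_mul_le (.inl hv) (.inl measure_ball_lt_top.ne)]
  refine le_trans ?_ h
  rw [Measure.addHaar_closedBall _ _ (by linarith)]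
  gcongr
  exact le_self_pow₀ hr.le finrank_pos.ne'

/-- The weak type `(1, 1)` bound for the union of the closed balls on which the average of `F`
exceeds `c`. -/
lemma volume_iUnion_closedBall_le [Nontrivial E] {F : E → ℝ≥0∞} (hF : ∫⁻ y, F y ≠ ∞) {c : ℝ≥0∞}
    (hc : c ≠ 0) (hc' : c ≠ ∞) :
    volume (⋃ p ∈ {p : E × ℝ | 0 < p.2 ∧
      c * volume (closedBall p.1 p.2) < ∫⁻ y in closedBall p.1 p.2, F y}, closedBall p.1 p.2) ≤
    ENNReal.ofReal (5 ^ finrank ℝ E) * (∫⁻ y, F y) / c := by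
  set T := {p : E × ℝ | 0 < p.2 ∧
      c * volume (closedBall p.1 p.2) < ∫⁻ y in closedBall p.1 p.2, F y}
  have hbd : ∀ p ∈ T, p.2 ≤ max 1 (((∫⁻ y, F y) / c) / volume (ball (0 : E) 1)).toReal := by
    intro p hp
    apply radius_le_of_volume_closedBall_le (x := p.1) (ENNReal.div_ne_top hF hc)
    rw [ENNReal.le_div_iff_mul_le (.inl hc) (.inl hc'), mul_comm]
    exact hp.2.le.trans (setLIntegral_le_lintegral _ _)
  obtain ⟨u, huT, hdisj, hcov⟩ := Vitali.exists_disjoint_subfamily_covering_enlargement_closedBall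
    T (fun p => p.1) (fun p => p.2) _ hbd 5 (by norm_num)
  have hcount : u.Countable := by
    apply hdisj.countable_of_nonempty_interior
    intro p hp
    refine ⟨p.1, ?_⟩
    apply ball_subset_interior_closedBall
    exact mem_ball_self (huT hp).1
  calc volume (⋃ p ∈ T, closedBall p.1 p.2)
      ≤ volume (⋃ p ∈ u, closedBall p.1 (5 * p.2)) := by
        apply measure_mono
        intro x hx
        simp only [mem_iUnion] at hx ⊢
        obtain ⟨p, hp, hxp⟩ := hx
        obtain ⟨q, hq, hpq⟩ := hcov p hp
        exact ⟨q, hq, hpq hxp⟩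
    _ ≤ ∑' p : u, volume (closedBall p.1.1 (5 * p.1.2)) := measure_biUnion_le _ hcount _
    _ ≤ ∑' p : u, ENNReal.ofReal (5 ^ finrank ℝ E) / c * ∫⁻ y in closedBall p.1.1 p.1.2, F y := by
        gcongr with p
        rw [volume_closedBall_mul _ p.1.1 (by norm_num) (huT p.2).1.le, div_eq_mul_inv, mul_assoc]
        gcongr
        rw [mul_comm, ← div_eq_mul_inv, ENNReal.le_div_iff_mul_le (.inl hc) (.inl hc'), mul_comm]
        exact (huT p.2).2.le
    _ = ENNReal.ofReal (5 ^ finrank ℝ E) / c *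
          ∫⁻ y in ⋃ p ∈ u, closedBall p.1 p.2, F y := by
        rw [ENNReal.tsum_mul_left, lintegral_biUnion hcount (fun _ _ => measurableSet_closedBall)
          hdisj]
    _ ≤ _ := by
        rw [ENNReal.mul_div_right_comm]
        gcongr
        exact Measure.restrict_le_self

/-- Weak type `(1, 1)` bound for the centered Hardy–Littlewood maximal function. -/
lemma volume_exists_average_gt_le [Nontrivial E] {F : E → ℝ≥0∞} (hF : ∫⁻ y, F y ≠ ∞) {c : ℝ≥0∞}
    (hc : c ≠ 0) (hc' : c ≠ ∞) :
    volume {x | ∃ r > 0, c * volume (closedBall x r) < ∫⁻ y in closedBall x r, F y} ≤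
      ENNReal.ofReal (5 ^ finrank ℝ E) * (∫⁻ y, F y) / c := by
  refine le_trans (measure_mono ?_) (volume_iUnion_closedBall_le hF hc hc')
  rintro x ⟨r, hr, h⟩
  simp only [mem_iUnion]
  exact ⟨(x, r), ⟨hr, h⟩, mem_closedBall_self hr.le⟩

/-- Disjoint sets `B i ⊆ A i` can be enlarged to disjoint sets between `B i` and `A i` which
still cover the union of the `A i`. -/
lemma exists_disjoint_between {α ι : Type*} [MeasurableSpace α] [Countable ι] {A B : ι → Set α}
    (hBA : ∀ i, B i ⊆ A i) (hA : ∀ i, MeasurableSet (A i)) (hB : ∀ i, MeasurableSet (B i))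
    (hd : Pairwise (Function.onFun Disjoint B)) :
    ∃ Q : ι → Set α, (∀ i, MeasurableSet (Q i)) ∧ (∀ i, B i ⊆ Q i) ∧ (∀ i, Q i ⊆ A i) ∧
      Pairwise (Function.onFun Disjoint Q) ∧ ⋃ i, Q i = ⋃ i, A i := by
  classical
  obtain ⟨e, he⟩ := exists_injective_nat ι
  let P : ι → Set α := fun i => (A i \ ⋃ j, B j) \ ⋃ j ∈ {j | e j < e i}, A j
  refine ⟨fun i => B i ∪ P i, fun i => ?_, fun i => subset_union_left, fun i => ?_, ?_, ?_⟩
  · refine (hB i).union (((hA i).diff (.iUnion hB)).diff ?_)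
    exact .biUnion (to_countable _) fun j _ => hA j
  · exact union_subset (hBA i) fun x hx => hx.1.1
  · intro i j hij
    rw [Function.onFun, Set.disjoint_left]
    rintro x (hx | hx) (hy | hy)
    · exact Set.disjoint_left.1 (hd hij) hx hy
    · exact hy.1.2 (mem_iUnion.2 ⟨i, hx⟩)
    · exact hx.1.2 (mem_iUnion.2 ⟨j, hy⟩)
    · rcases lt_or_gt_of_ne (he.ne hij) with h | h
      · exact hy.2 (mem_biUnion h hx.1.1)
      · exact hx.2 (mem_biUnion h hy.1.1)
  · apply subset_antisymm
    · exact iUnion_mono fun i => union_subset (hBA i) fun x hx => hx.1.1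
    · intro x hx
      by_cases hxB : x ∈ ⋃ j, B j
      · obtain ⟨j, hj⟩ := mem_iUnion.1 hxB
        exact mem_iUnion.2 ⟨j, .inl hj⟩
      · have hex : ∃ k, ∃ i, e i = k ∧ x ∈ A i := by
          obtain ⟨i, hi⟩ := mem_iUnion.1 hx
          exact ⟨e i, i, rfl, hi⟩
        obtain ⟨i, hik, hxi⟩ := Nat.find_spec hex
        refine mem_iUnion.2 ⟨i, .inr ⟨⟨hxi, hxB⟩, ?_⟩⟩
        intro hmem
        simp only [mem_iUnion, mem_ofPred_eq] at hmem
        obtain ⟨j, hj, hxj⟩ := hmem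
        exact Nat.find_min hex (hik ▸ hj) ⟨j, rfl, hxj⟩

/-- The Calderón–Zygmund covering of the set where the maximal function of `f` exceeds `s`. -/
lemma exists_calderonZygmund_cover [Nontrivial E] {f : E → ℝ} (hf : Integrable f) {s : ℝ}
    (hs : 0 < s) :
    ∃ (u : Set E) (Q : u → Set E) (r : u → ℝ), u.Countable ∧ (∀ i, 0 < r i) ∧
      (∀ i, MeasurableSet (Q i)) ∧ (∀ i, Q i ⊆ closedBall i.1 (r i)) ∧
      Pairwise (Function.onFun Disjoint Q) ∧ (∀ i, volume (Q i) ≠ 0) ∧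
      (∀ i, volume (closedBall i.1 (5 * r i)) ≤ ENNReal.ofReal (40 ^ finrank ℝ E) * volume (Q i)) ∧
      (∀ i, ∫⁻ y in Q i, ‖f y‖ₑ ≤
        ENNReal.ofReal (40 ^ finrank ℝ E) * ENNReal.ofReal s * volume (Q i)) ∧
      (∑' i, volume (Q i) ≤
        ENNReal.ofReal (5 ^ finrank ℝ E) * (∫⁻ y, ‖f y‖ₑ) / ENNReal.ofReal s) ∧
      ∀ᵐ x, x ∉ ⋃ i, Q i → |f x| ≤ s := by
  set T := {p : E × ℝ | 0 < p.2 ∧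
      ENNReal.ofReal s * volume (closedBall p.1 p.2) < ∫⁻ y in closedBall p.1 p.2, ‖f y‖ₑ}
  set U : Set E := ⋃ p ∈ T, ball p.1 p.2 with hU
  have hs0 : ENNReal.ofReal s ≠ 0 := by simpa using hs
  have hUvol : volume U ≤ ENNReal.ofReal (5 ^ finrank ℝ E) * (∫⁻ y, ‖f y‖ₑ) / ENNReal.ofReal s := by
    refine le_trans (measure_mono ?_)
      (volume_iUnion_closedBall_le hf.2.ne hs0 ENNReal.ofReal_ne_top)
    exact iUnion₂_mono fun p _ => ball_subset_closedBall
  have hUfin : volume U ≠ ∞ := by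
    refine ne_top_of_le_ne_top ?_ hUvol
    exact ENNReal.div_ne_top (ENNReal.mul_ne_top ENNReal.ofReal_ne_top hf.2.ne) hs0
  have hUo : IsOpen U := isOpen_biUnion fun _ _ => isOpen_ball
  have hne : Uᶜ.Nonempty := by
    rw [nonempty_compl]
    intro h
    apply hUfin
    rw [h]
    have := NormedSpace.noncompactSpace ℝ E
    exact measure_univ_of_isAddLeftInvariant _
  have hnotU : ∀ p ∉ U, ∀ z r, 0 < r → p ∈ ball z r →
      ∫⁻ y in closedBall z r, ‖f y‖ₑ ≤ ENNReal.ofReal s * volume (closedBall z r) := by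
    intro p hp z r hr hpz
    by_contra! h
    exact hp (mem_biUnion (show (z, r) ∈ T from ⟨hr, h⟩) hpz)
  set δ : E → ℝ := fun x => infDist x Uᶜ
  have hδ : ∀ x ∈ U, 0 < δ x := fun x hx =>
    (hUo.isClosed_compl.notMem_iff_infDist_pos hne).1 (by simpa using hx)
  have hsub : ∀ x, ∀ ρ < δ x, closedBall x ρ ⊆ U := by
    intro x ρ hρ y hy
    by_contra hyU
    have := infDist_le_dist_of_mem (x := x) (show y ∈ Uᶜ from hyU)
    rw [mem_closedBall, dist_comm] at hy
    linarith
  have hbd : ∀ x ∈ U, δ x / 20 ≤ max 1 (volume U / volume (ball (0 : E) 1)).toReal := by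
    intro x hx
    apply radius_le_of_volume_closedBall_le (x := x) hUfin
    exact measure_mono (hsub _ _ (by linarith [hδ x hx]))
  obtain ⟨u, huU, hdisj, hcov⟩ := Vitali.exists_disjoint_subfamily_covering_enlargement_closedBall
    U (fun x => x) (fun x => δ x / 20) _ hbd 5 (by norm_num)
  have hcount : u.Countable := by
    apply hdisj.countable_of_nonempty_interior
    intro p hp
    refine ⟨p, ?_⟩
    apply ball_subset_interior_closedBall
    exact mem_ball_self (by linarith [hδ p (huU hp)])
  have : Countable u := hcount
  obtain ⟨Q, hQm, hBQ, hQA, hQd, hQU⟩ := exists_disjoint_between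
    (A := fun i : u => closedBall i.1 (5 * (δ i.1 / 20)))
    (B := fun i : u => closedBall i.1 (δ i.1 / 20))
    (fun i => closedBall_subset_closedBall (by linarith [hδ i.1 (huU i.2)]))
    (fun i => measurableSet_closedBall) (fun i => measurableSet_closedBall)
    (fun i j hij => hdisj i.2 j.2 (by simpa using Subtype.coe_ne_coe.2 hij))
  have hQU' : ⋃ i, Q i = U := by
    rw [hQU]
    apply subset_antisymm
    · exact iUnion_subset fun i => hsub _ _ (by linarith [hδ i.1 (huU i.2)])
    · intro x hx
      obtain ⟨b, hb, hxb⟩ := hcov x hx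
      exact mem_iUnion.2 ⟨⟨b, hb⟩, hxb (mem_closedBall_self (by linarith [hδ x hx]))⟩
  have h40 : ∀ i : u, volume (closedBall i.1 (2 * δ i.1)) ≤
      ENNReal.ofReal (40 ^ finrank ℝ E) * volume (Q i) := by
    intro i
    rw [show 2 * δ i.1 = 40 * (δ i.1 / 20) by ring,
      volume_closedBall_mul _ i.1 (by norm_num) (by linarith [hδ i.1 (huU i.2)])]
    gcongr
    exact hBQ i
  refine ⟨u, Q, fun i => 5 * (δ i.1 / 20), hcount, fun i => by linarith [hδ i.1 (huU i.2)], hQm,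
    hQA, hQd, fun i h0 => ?_, fun i => ?_, fun i => ?_, ?_, ?_⟩
  · have h := measure_mono_null (hBQ i) h0
    exact (measure_closedBall_pos volume i.1 (by linarith [hδ i.1 (huU i.2)])).ne' h
  · refine le_trans (measure_mono (closedBall_subset_closedBall ?_)) (h40 i)
    linarith [hδ i.1 (huU i.2)]
  · have hpos := hδ i.1 (huU i.2)
    obtain ⟨p, hp, hdp⟩ := (infDist_lt_iff hne).1 (show infDist i.1 Uᶜ < 2 * δ i.1 by
      change δ i.1 < _; linarith)
    calc ∫⁻ y in Q i, ‖f y‖ₑ ≤ ∫⁻ y in closedBall i.1 (2 * δ i.1), ‖f y‖ₑ := by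
          apply lintegral_mono_set
          exact (hQA i).trans (closedBall_subset_closedBall (by linarith))
      _ ≤ ENNReal.ofReal s * volume (closedBall i.1 (2 * δ i.1)) :=
          hnotU p hp _ _ (by linarith) (by rwa [mem_ball, dist_comm])
      _ ≤ _ := by
          rw [mul_comm (ENNReal.ofReal (40 ^ _)), mul_assoc]
          gcongr
          exact h40 i
  · rw [← measure_iUnion hQd hQm, hQU']
    exact hUvol
  · rw [hQU']
    filter_upwards [IsUnifLocDoublingMeasure.ae_tendsto_average (μ := (volume : Measure E))
      hf.norm.locallyIntegrable 1] with x hx hxU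
    have hlim : Tendsto (fun k : ℕ => (1 : ℝ) / (k + 1)) atTop (𝓝[>] 0) := by
      rw [tendsto_nhdsWithin_iff]
      exact ⟨tendsto_one_div_add_atTop_nhds_zero_nat, .of_forall fun k => by
        simp only [mem_Ioi]; positivity⟩
    have h := hx (fun _ : ℕ => x) (fun k => (1 : ℝ) / (k + 1)) hlim
      (.of_forall fun k => mem_closedBall_self (by positivity))
    refine le_of_tendsto h (.of_forall fun k => ?_)
    have hk : (0 : ℝ) < 1 / (k + 1) := by positivity
    have hb := hnotU x hxU x _ hk (mem_ball_self hk)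
    rw [setAverage_eq, smul_eq_mul, inv_mul_le_iff₀ (by
      exact ENNReal.toReal_pos (measure_closedBall_pos _ _ hk).ne' measure_closedBall_lt_top.ne)]
    rw [integral_norm_eq_lintegral_enorm hf.aestronglyMeasurable.restrict, mul_comm]
    refine ENNReal.toReal_le_of_le_ofReal (by positivity) (hb.trans_eq ?_)
    rw [ENNReal.ofReal_mul hs.le, Measure.real, ENNReal.ofReal_toReal measure_closedBall_lt_top.ne]

end CalderonZygmund

section Plancherel

open Metric Module FourierTransform
open scoped ENNReal NNReal Topology ContDiff

variable {E : Type*} [NormedAddCommGroup E] [InnerProductSpace ℝ E] [FiniteDimensional ℝ E]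
  [MeasurableSpace E] [BorelSpace E]

/-- **Plancherel's theorem** for functions in `L¹ ∩ L²`. -/
lemma eLpNorm_fourier_eq_of_integrable {h : E → ℂ} (h1 : Integrable h) (h2 : MemLp h 2) :
    eLpNorm (𝓕 h) 2 = eLpNorm h 2 := by
  have hcont : Continuous (𝓕 h) :=
    VectorFourier.fourierIntegral_continuous Real.continuous_fourierChar
      (by exact continuous_inner) h1
  have key : (𝓕 (h2.toLp h) : Lp ℂ 2 (volume : Measure E)) =ᵐ[volume] 𝓕 h := by
    refine ae_eq_of_integral_contDiff_smul_eq ((Lp.memLp _).locallyIntegrable (by norm_num))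
      hcont.locallyIntegrable fun g g_smooth g_cpt => ?_
    have hg₁ : HasCompactSupport (Complex.ofRealCLM ∘ g) := g_cpt.comp_left rfl
    have hg₂ : ContDiff ℝ ∞ (Complex.ofRealCLM ∘ g) := by fun_prop
    set φ := hg₁.toSchwartzMap hg₂
    have hφ : ∀ x, φ x = (g x : ℂ) := fun x => rfl
    have e1 : ∫ x, φ x • (𝓕 (h2.toLp h) : Lp ℂ 2 (volume : Measure E)) x =
        ∫ x, (𝓕 φ) x • (h2.toLp h) x := by
      rw [← Lp.toTemperedDistribution_apply, ← Lp.fourier_toTemperedDistribution_eq,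
        TemperedDistribution.fourier_apply, Lp.toTemperedDistribution_apply]
    have e2 : ∫ x, (𝓕 φ) x • h x = ∫ x, φ x • 𝓕 h x := by
      rw [SchwartzMap.fourier_coe]
      simpa using! VectorFourier.integral_fourierIntegral_smul_eq_flip (L := innerₗ E)
        Real.continuous_fourierChar continuous_inner φ.integrable h1
    calc ∫ x, g x • (𝓕 (h2.toLp h) : Lp ℂ 2 (volume : Measure E)) x
        = ∫ x, φ x • (𝓕 (h2.toLp h) : Lp ℂ 2 (volume : Measure E)) x := by
          simp only [hφ, Complex.real_smul, smul_eq_mul]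
      _ = ∫ x, (𝓕 φ) x • h x := by
          rw [e1]
          apply integral_congr_ae
          filter_upwards [h2.coeFn_toLp] with x hx
          rw [hx]
      _ = ∫ x, g x • 𝓕 h x := by
          rw [e2]
          simp only [hφ, Complex.real_smul, smul_eq_mul]
  rw [← eLpNorm_congr_ae key, ← eLpNorm_congr_ae h2.coeFn_toLp]
  have := Lp.norm_fourier_eq (h2.toLp h)
  rw [Lp.norm_def, Lp.norm_def] at this
  exact (ENNReal.toReal_eq_toReal_iff' (Lp.eLpNorm_ne_top _) (Lp.eLpNorm_ne_top _)).1 this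

lemma memLp_two_of_integrable_of_bounded {α F : Type*} [MeasurableSpace α] {μ : Measure α}
    [NormedAddCommGroup F] {h : α → F} (h1 : Integrable h μ) {M : ℝ} (hM : ∀ᵐ x ∂μ, ‖h x‖ ≤ M) :
    MemLp h 2 μ := by
  rw [memLp_two_iff_integrable_sq_norm h1.aestronglyMeasurable]
  simp only [sq]
  refine h1.norm.bdd_mul (c := M) h1.aestronglyMeasurable.norm ?_
  filter_upwards [hM] with x hx
  rwa [norm_norm]

/-- Convolution with an integrable kernel whose Fourier transform is bounded by `A` has norm at
most `A` on `L²`. -/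
lemma lintegral_enorm_sq_convolution_le {k g : E → ℝ} (hk : Integrable k) (hg : Integrable g)
    {M : ℝ} (hM : ∀ x, |g x| ≤ M) {A : ℝ}
    (hA : ∀ ξ, ‖𝓕 (fun x => (k x : ℂ)) ξ‖ ≤ A) :
    ∫⁻ x, ‖∫ y, k (x - y) * g y‖ₑ ^ 2 ≤ ENNReal.ofReal A ^ 2 * ∫⁻ x, ‖g x‖ₑ ^ 2 := by
  have hA0 : 0 ≤ A := (norm_nonneg _).trans (hA 0)
  set kc : E → ℂ := fun x => k x
  set gc : E → ℂ := fun x => g x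
  have hkc : Integrable kc := hk.ofReal
  have hgc : Integrable gc := hg.ofReal
  set h : E → ℂ := convolution gc kc (ContinuousLinearMap.mul ℂ ℂ) volume
  have hh : ∀ x, h x = ((∫ y, k (x - y) * g y : ℝ) : ℂ) := by
    intro x
    rw [← integral_complex_ofReal]
    simp only [h, convolution, ContinuousLinearMap.mul_apply', kc, gc, Complex.ofReal_mul]
    congr 1 with y
    ring
  have h1 : Integrable h := hgc.integrable_convolution _ hkc
  have hb : ∀ x, ‖h x‖ ≤ M * ∫ y, |k y| := by
    intro x
    rw [hh, Complex.norm_real]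
    calc ‖∫ y, k (x - y) * g y‖ ≤ ∫ y, M * |k (x - y)| := by
          refine norm_integral_le_of_norm_le ((hk.comp_sub_left x).abs.const_mul M)
            (.of_forall fun y => ?_)
          rw [norm_mul, mul_comm]
          exact mul_le_mul_of_nonneg_right (hM y) (abs_nonneg _)
      _ = _ := by
          rw [integral_const_mul, integral_sub_left_eq_self (fun y => |k y|)]
  have h2 : MemLp h 2 := memLp_two_of_integrable_of_bounded h1 (.of_forall hb)
  have g2 : MemLp gc 2 := memLp_two_of_integrable_of_bounded hgc (M := M) (.of_forall fun x => by
    simpa [gc] using hM x)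
  have hsq : ∀ u : E → ℂ, ∫⁻ x, ‖u x‖ₑ ^ 2 = eLpNorm u 2 ^ 2 := by
    intro u
    have := eLpNorm_nnreal_pow_eq_lintegral (f := u) (μ := (volume : Measure E)) (p := 2)
      (by norm_num)
    simpa using this.symm
  have hfou : ∀ ξ, 𝓕 h ξ = 𝓕 gc ξ * 𝓕 kc ξ := fun ξ =>
    Real.fourier_mul_convolution_eq hgc hkc ξ
  calc ∫⁻ x, ‖∫ y, k (x - y) * g y‖ₑ ^ 2 = ∫⁻ x, ‖h x‖ₑ ^ 2 := by
        congr 1 with x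
        rw [hh, ← ofReal_norm, ← ofReal_norm, Complex.norm_real]
    _ = ∫⁻ ξ, ‖𝓕 h ξ‖ₑ ^ 2 := by
        rw [hsq, hsq, eLpNorm_fourier_eq_of_integrable h1 h2]
    _ ≤ ∫⁻ ξ, ENNReal.ofReal A ^ 2 * ‖𝓕 gc ξ‖ₑ ^ 2 := by
        gcongr with ξ
        rw [hfou, enorm_mul, mul_pow, mul_comm]
        gcongr
        rw [← ofReal_norm]
        exact ENNReal.ofReal_le_ofReal (hA ξ)
    _ = ENNReal.ofReal A ^ 2 * ∫⁻ x, ‖gc x‖ₑ ^ 2 := by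
        rw [lintegral_const_mul' _ _ (by simp), hsq, hsq, eLpNorm_fourier_eq_of_integrable hgc g2]
    _ = _ := by
        congr 2 with x
        rw [← ofReal_norm, ← ofReal_norm, Complex.norm_real]

end Plancherel

section Kernel

open Metric Module FourierTransform
open scoped ENNReal NNReal Topology

variable {E : Type*} [NormedAddCommGroup E] [InnerProductSpace ℝ E] [FiniteDimensional ℝ E]
  [MeasurableSpace E] [BorelSpace E]

/-- The annulus `{a < ‖x‖ ≤ b}`. -/
def annulus (E : Type*) [NormedAddCommGroup E] (a b : ℝ) : Set E := {x | a < ‖x‖ ∧ ‖x‖ ≤ b}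

omit [InnerProductSpace ℝ E] [FiniteDimensional ℝ E] in
@[measurability]
lemma measurableSet_annulus (a b : ℝ) : MeasurableSet (annulus E a b) :=
  (measurableSet_lt measurable_const measurable_norm).inter
    (measurableSet_le measurable_norm measurable_const)

/-- A singular kernel of Calderón–Zygmund type: bounded mass on dyadic annuli, cancellation on
annuli, and Hörmander's condition. -/
structure IsCZKernel (K : E → ℝ) (A : ℝ≥0) : Prop where
  measurable : Measurable K
  size : ∀ R > 0, ∫⁻ x in annulus E R (2 * R), ‖K x‖ₑ ≤ A
  cancel : ∀ a > 0, ∀ b, ∫ x in annulus E a b, K x = 0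
  hormander : ∀ h : E, ∫⁻ x in {x | 2 * ‖h‖ < ‖x‖}, ‖K (x - h) - K x‖ₑ ≤ A

namespace IsCZKernel

variable {K : E → ℝ} {A : ℝ≥0}

lemma lintegral_annulus_lt_top (hK : IsCZKernel K A) {a : ℝ} (ha : 0 < a) (b : ℝ) :
    ∫⁻ x in annulus E a b, ‖K x‖ₑ < ∞ := by
  have key : ∀ n : ℕ, ∫⁻ x in annulus E a (2 ^ n * a), ‖K x‖ₑ ≤ n * A := by
    intro n
    induction n with
    | zero =>
      have : annulus E a (2 ^ 0 * a) = ∅ := by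
        ext x; simp only [annulus, mem_ofPred_eq, mem_empty_iff_false, iff_false]; intro h
        linarith [h.1, h.2]
      rw [this]; simp
    | succ n ih =>
      have : annulus E a (2 ^ (n + 1) * a) ⊆
          annulus E a (2 ^ n * a) ∪ annulus E (2 ^ n * a) (2 * (2 ^ n * a)) := by
        rintro x ⟨h1, h2⟩
        rcases le_or_gt ‖x‖ (2 ^ n * a) with h | h
        · exact .inl ⟨h1, h⟩
        · exact .inr ⟨h, by rw [pow_succ] at h2; linarith⟩
      calc _ ≤ _ := lintegral_mono_set this
        _ ≤ _ := lintegral_union_le _ _ _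
        _ ≤ n * A + A := add_le_add ih (hK.size _ (by positivity))
        _ = _ := by push_cast; ring
  obtain ⟨n, hn⟩ := pow_unbounded_of_one_lt (b / a) one_lt_two
  rw [div_lt_iff₀ ha] at hn
  calc _ ≤ ∫⁻ x in annulus E a (2 ^ n * a), ‖K x‖ₑ :=
        lintegral_mono_set (fun x hx => ⟨hx.1, hx.2.trans hn.le⟩)
    _ ≤ _ := key n
    _ < ∞ := ENNReal.mul_lt_top (by simp) (by simp)

lemma integrableOn_annulus (hK : IsCZKernel K A) {a : ℝ} (ha : 0 < a) (b : ℝ) :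
    IntegrableOn K (annulus E a b) :=
  ⟨hK.measurable.aestronglyMeasurable, hK.lintegral_annulus_lt_top ha b⟩

lemma lintegral_norm_mul_le (hK : IsCZKernel K A) {r : ℝ} (hr : 0 < r) :
    ∫⁻ x in closedBall 0 r, ‖x‖ₑ * ‖K x‖ₑ ≤ ENNReal.ofReal (2 * r) * A := by
  have hsub : closedBall (0 : E) r ⊆ {0} ∪ ⋃ k : ℕ,
      annulus E (r / 2 * (1 / 2) ^ k) (2 * (r / 2 * (1 / 2) ^ k)) := by
    intro x hx
    rw [mem_closedBall_zero_iff] at hx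
    by_cases h0 : x = 0
    · exact .inl h0
    have hx0 : 0 < ‖x‖ := norm_pos_iff.2 h0
    obtain ⟨k, hk1, hk2⟩ := exists_nat_pow_near_of_lt_one (x := ‖x‖ / r) (y := (1 / 2 : ℝ))
      (by positivity) (by rwa [div_le_one hr]) (by norm_num) (by norm_num)
    rw [lt_div_iff₀ hr] at hk1
    rw [div_le_iff₀ hr] at hk2
    refine .inr (mem_iUnion.2 ⟨k, ?_, ?_⟩)
    · rw [pow_succ] at hk1; linarith
    · linarith
  have e0 : ∫⁻ x in ({0} : Set E), ‖x‖ₑ * ‖K x‖ₑ = 0 := by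
    rw [lintegral_eq_zero_iff' (by have := hK.measurable; fun_prop)]
    filter_upwards [self_mem_ae_restrict (measurableSet_singleton (0 : E))] with x hx
    simp [mem_singleton_iff.1 hx]
  calc _ ≤ _ := lintegral_mono_set hsub
    _ ≤ _ := lintegral_union_le _ _ _
    _ ≤ 0 + ∑' k : ℕ, ∫⁻ x in annulus E (r / 2 * (1 / 2) ^ k) (2 * (r / 2 * (1 / 2) ^ k)),
        ‖x‖ₑ * ‖K x‖ₑ :=
        add_le_add e0.le (lintegral_iUnion_le _ _)
    _ ≤ 0 + ∑' k : ℕ, ENNReal.ofReal (r * (1 / 2) ^ k) * A := by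
        gcongr with k
        calc _ ≤ ∫⁻ x in annulus E (r / 2 * (1 / 2) ^ k) (2 * (r / 2 * (1 / 2) ^ k)),
              ENNReal.ofReal (r * (1 / 2) ^ k) * ‖K x‖ₑ := by
              refine setLIntegral_mono' (measurableSet_annulus _ _) fun x hx => ?_
              gcongr
              rw [← ofReal_norm]
              exact ENNReal.ofReal_le_ofReal (by linarith [hx.2])
          _ = ENNReal.ofReal (r * (1 / 2) ^ k) * ∫⁻ x in annulus E (r / 2 * (1 / 2) ^ k) (2 * (r / 2 * (1 / 2) ^ k)), ‖K x‖ₑ :=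
              lintegral_const_mul _ hK.measurable.enorm
          _ ≤ _ := by gcongr; exact hK.size _ (by positivity)
    _ = _ := by
        rw [zero_add, ENNReal.tsum_mul_right,
          ← ENNReal.ofReal_tsum_of_nonneg (fun k => by positivity)
          (summable_geometric_two.mul_left r), tsum_mul_left, tsum_geometric_two, mul_comm r]

/-- The kernel cut off to an annulus is still `L¹`-regular under translations. -/
lemma lintegral_indicator_annulus_sub_le (hK : IsCZKernel K A) {a b : ℝ} {h : E}
    (ha : 2 * ‖h‖ ≤ a) :
    ∫⁻ x, ‖(annulus E a b).indicator K (x - h) - (annulus E a b).indicator K x‖ₑ ≤ 5 * A := by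
  rcases le_or_gt a 0 with ha0 | ha0
  · have : h = 0 := norm_eq_zero.1 (by linarith [norm_nonneg h])
    simp [this]
  rcases le_or_gt b 0 with hb0 | hb0
  · have : annulus E a b = ∅ := by
      ext x; simp only [annulus, mem_ofPred_eq, mem_empty_iff_false, iff_false]; intro h
      linarith [h.1, h.2]
    simp [this]
  set D : E → ℝ≥0∞ := {x | 2 * ‖h‖ < ‖x‖}.indicator fun x => ‖K (x - h) - K x‖ₑ
  set G : E → ℝ≥0∞ := fun x => (annulus E a (2 * a)).indicator (fun x => ‖K x‖ₑ) x +
    (annulus E (b / 2) (2 * (b / 2))).indicator (fun x => ‖K x‖ₑ) x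
  have mK := hK.measurable
  have mS : MeasurableSet {x : E | 2 * ‖h‖ < ‖x‖} :=
      measurableSet_lt measurable_const measurable_norm
  have hDm : Measurable D := Measurable.indicator (by fun_prop) mS
  have hGm : Measurable G := (mK.enorm.indicator (measurableSet_annulus _ _)).add
    (mK.enorm.indicator (measurableSet_annulus _ _))
  have hGi : ∫⁻ x, G x ≤ 2 * A := by
    rw [lintegral_add_left (mK.enorm.indicator (measurableSet_annulus _ _)),
      lintegral_indicator (measurableSet_annulus _ _),
          lintegral_indicator (measurableSet_annulus _ _)]
    exact (add_le_add (hK.size _ ha0) (hK.size _ (by positivity))).trans_eq (two_mul _).symm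
  have hGi' : ∫⁻ x, G (x - h) ≤ 2 * A := by rwa [lintegral_sub_right_eq_self G h]
  have hDi : ∫⁻ x, D x ≤ A := by
    rw [lintegral_indicator mS]; exact hK.hormander h
  have aux : ∀ x y : E, ‖x - y‖ ≤ ‖h‖ → x ∈ annulus E a b → y ∉ annulus E a b → ‖K x‖ₑ ≤ G x := by
    intro x y hxy hx hy
    have t1 : ‖x‖ ≤ ‖y‖ + ‖h‖ := by linarith [norm_le_norm_add_norm_sub' x y]
    have t2 : ‖y‖ ≤ ‖x‖ + ‖h‖ := by linarith [norm_le_norm_add_norm_sub x y]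
    rcases le_or_gt ‖y‖ a with h1 | h1
    · refine le_trans ?_ le_self_add
      rw [indicator_of_mem]
      exact ⟨hx.1, by linarith⟩
    · have h2 : b < ‖y‖ := by
        by_contra! h2
        exact hy ⟨h1, h2⟩
      refine le_trans ?_ le_add_self
      rw [indicator_of_mem]
      exact ⟨by linarith [hx.1, hx.2], by linarith [hx.2]⟩
  calc _ ≤ ∫⁻ x, (D x + G x + G (x - h)) := by
        refine lintegral_mono fun x => ?_
        by_cases h1 : x ∈ annulus E a b <;> by_cases h2 : x - h ∈ annulus E a b
        · have : x ∈ {x : E | 2 * ‖h‖ < ‖x‖} := lt_of_le_of_lt ha h1.1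
          simp only [indicator_of_mem h1, indicator_of_mem h2, D, indicator_of_mem this]
          rw [add_assoc]; exact le_self_add
        · simp only [indicator_of_mem h1, indicator_of_notMem h2, zero_sub, enorm_neg]
          calc _ ≤ G x := aux x (x - h) (by simp) h1 h2
            _ ≤ D x + G x := le_add_self
            _ ≤ _ := le_self_add
        · simp only [indicator_of_notMem h1, indicator_of_mem h2, sub_zero]
          calc _ ≤ G (x - h) := aux (x - h) x (by simp) h2 h1
            _ ≤ _ := le_add_self
        · simp [indicator_of_notMem h1, indicator_of_notMem h2]
    _ = (∫⁻ x, D x) + (∫⁻ x, G x) + ∫⁻ x, G (x - h) := by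
        rw [lintegral_add_left (f := fun x => D x + G x) (hDm.add hGm), lintegral_add_left hDm]
    _ ≤ A + 2 * A + 2 * A := by gcongr
    _ = 5 * A := by ring

end IsCZKernel

end Kernel

section KernelFourier

open Metric Module FourierTransform
open scoped ENNReal NNReal Topology RealInnerProductSpace

variable {E : Type*} [NormedAddCommGroup E] [InnerProductSpace ℝ E] [FiniteDimensional ℝ E]
  [MeasurableSpace E] [BorelSpace E]

namespace IsCZKernel

variable {K : E → ℝ} {A : ℝ≥0}

lemma integrable_indicator_annulus (hK : IsCZKernel K A) {a : ℝ} (ha : 0 < a) (b : ℝ) :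
    Integrable ((annulus E a b).indicator K) :=
  (hK.integrableOn_annulus ha b).integrable_indicator (measurableSet_annulus _ _)

lemma integral_indicator_annulus (hK : IsCZKernel K A) {a : ℝ} (ha : 0 < a) (b : ℝ) :
    ∫ x, (annulus E a b).indicator K x = 0 := by
  rw [integral_indicator (measurableSet_annulus _ _), hK.cancel a ha b]

lemma norm_fourier_annulus_le_of_inner (hK : IsCZKernel K A) {a m : ℝ} (ha : 0 < a) {ξ : E}
    (hm : m * ‖ξ‖ ≤ 1) :
    ‖𝓕 (fun x => (((annulus E a m).indicator K x : ℝ) : ℂ)) ξ‖ ≤ 13 * A := by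
  set k := (annulus E a m).indicator K with hkdef
  rcases le_or_gt m 0 with hm0 | hm0
  · have : k = 0 := by
      ext x
      refine indicator_of_notMem (fun h => ?_) _
      linarith [h.1, h.2]
    simp [this, Real.fourier_eq]
  have hk : Integrable k := hK.integrable_indicator_annulus ha m
  have hkc : Integrable fun x => (k x : ℂ) := hk.ofReal
  have e1 : 𝓕 (fun x => (k x : ℂ)) ξ = ∫ v, ((Real.fourierChar (-⟪v, ξ⟫) : ℂ) - 1) * (k v : ℂ) := by
    have h0 : ∫ v, (k v : ℂ) = 0 := by
      rw [integral_complex_ofReal, hK.integral_indicator_annulus ha m]; simp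
    have hi := (Real.fourierIntegral_convergent_iff (f := fun x => (k x : ℂ)) ξ).2 hkc
    rw [Real.fourier_eq]
    simp only [Circle.smul_def, smul_eq_mul, sub_mul, one_mul] at hi ⊢
    rw [integral_sub hi hkc, h0, sub_zero]
  have bd : ∀ v : E, ‖(Real.fourierChar (-⟪v, ξ⟫) : ℂ) - 1‖ₑ ≤
      ENNReal.ofReal (2 * Real.pi * ‖ξ‖) * ‖v‖ₑ := by
    intro v
    rw [Real.fourierChar_apply, mul_comm]
    refine Real.enorm_exp_I_mul_ofReal_sub_one_le.trans ?_
    rw [← ofReal_norm, ← ofReal_norm, ← ENNReal.ofReal_mul (by positivity)]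
    refine ENNReal.ofReal_le_ofReal ?_
    rw [norm_mul, norm_neg, Real.norm_of_nonneg (by positivity : 0 ≤ 2 * Real.pi)]
    have := norm_inner_le_norm (𝕜 := ℝ) v ξ
    have hp := Real.pi_pos
    calc 2 * Real.pi * ‖⟪v, ξ⟫‖ ≤ 2 * Real.pi * (‖v‖ * ‖ξ‖) := by gcongr
      _ = _ := by ring
  have key : ‖𝓕 (fun x => (k x : ℂ)) ξ‖ₑ ≤ ENNReal.ofReal (13 * A) := by
    rw [e1]
    calc _ ≤ ∫⁻ v, ‖((Real.fourierChar (-⟪v, ξ⟫) : ℂ) - 1) * (k v : ℂ)‖ₑ :=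
        enorm_integral_le_lintegral_enorm _
      _ ≤ ∫⁻ v, ENNReal.ofReal (2 * Real.pi * ‖ξ‖) * (closedBall (0 : E) m).indicator (fun v => ‖v‖ₑ * ‖K v‖ₑ) v := by
          refine lintegral_mono fun v => ?_
          by_cases hv : v ∈ annulus E a m
          · have hv' : v ∈ closedBall (0 : E) m := mem_closedBall_zero_iff.2 hv.2
            rw [indicator_of_mem hv', hkdef, indicator_of_mem hv, enorm_mul, ← mul_assoc]
            gcongr
            · exact bd v
            · simp [← ofReal_norm]
          · simp [hkdef, indicator_of_notMem hv]
      _ = ENNReal.ofReal (2 * Real.pi * ‖ξ‖) * ∫⁻ v in closedBall (0 : E) m, ‖v‖ₑ * ‖K v‖ₑ := by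
          rw [lintegral_const_mul' _ _ (by simp), lintegral_indicator measurableSet_closedBall]
      _ ≤ ENNReal.ofReal (2 * Real.pi * ‖ξ‖) * (ENNReal.ofReal (2 * m) * A) := by
          gcongr; exact hK.lintegral_norm_mul_le hm0
      _ ≤ _ := by
          rw [← ENNReal.ofReal_coe_nnreal (p := A), ← ENNReal.ofReal_mul (by positivity),
            ← ENNReal.ofReal_mul (by positivity)]
          refine ENNReal.ofReal_le_ofReal ?_
          have hp := Real.pi_lt_d2
          have hp0 := Real.pi_pos
          calc 2 * Real.pi * ‖ξ‖ * (2 * m * A) = 4 * Real.pi * (m * ‖ξ‖) * A := by ring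
            _ ≤ 4 * Real.pi * 1 * A := by gcongr
            _ ≤ 13 * A := by gcongr; linarith
  rwa [← ofReal_norm, ENNReal.ofReal_le_ofReal_iff (by positivity)] at key

lemma norm_fourier_annulus_le_of_outer (hK : IsCZKernel K A) {m N : ℝ} {ξ : E}
    (hm : 1 ≤ m * ‖ξ‖) :
    ‖𝓕 (fun x => (((annulus E m N).indicator K x : ℝ) : ℂ)) ξ‖ ≤ 3 * A := by
  set k := (annulus E m N).indicator K with hkdef
  have hξ : ξ ≠ 0 := by rintro rfl; simp at hm; linarith
  have hξ0 : 0 < ‖ξ‖ := norm_pos_iff.2 hξ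
  have hm0 : 0 < m := by by_contra! h; nlinarith
  have hk : Integrable k := hK.integrable_indicator_annulus hm0 N
  have hkc : Integrable fun x => (k x : ℂ) := hk.ofReal
  set h : E := (1 / (2 * ‖ξ‖ ^ 2)) • ξ with hh
  have hhn : 2 * ‖h‖ ≤ m := by
    rw [hh, norm_smul, Real.norm_of_nonneg (by positivity)]
    rw [show 2 * (1 / (2 * ‖ξ‖ ^ 2) * ‖ξ‖) = 1 / ‖ξ‖ by field_simp, div_le_iff₀ hξ0]
    exact hm
  have hhi : ⟪h, ξ⟫ = 1 / 2 := by
    rw [hh, inner_smul_left, real_inner_self_eq_norm_sq]; simp; field_simp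
  have e2 : 𝓕 (fun x => (k (x - h) : ℂ)) ξ = - 𝓕 (fun x => (k x : ℂ)) ξ := by
    rw [Real.fourier_eq, Real.fourier_eq, ← integral_add_right_eq_self _ h, ← integral_neg]
    congr 1; ext v
    rw [add_sub_cancel_right, inner_add_left, hhi, neg_add, AddChar.map_add_eq_mul,
      Circle.smul_def, Circle.smul_def,
      Circle.coe_mul]
    have : ((Real.fourierChar (-(1/2)) : Circle) : ℂ) = -1 := by
      rw [Real.fourierChar_apply,
        show ((2 * Real.pi * -(1/2) : ℝ) : ℂ) * Complex.I =
        - (Real.pi * Complex.I) by push_cast; ring,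
        Complex.exp_neg, Complex.exp_pi_mul_I]; norm_num
    rw [this]; simp
  have e3 : (2 : ℂ) * 𝓕 (fun x => (k x : ℂ)) ξ =
      - ∫ v, Real.fourierChar (-⟪v, ξ⟫) • ((k (v - h) - k v : ℝ) : ℂ) := by
    have hi1 := (Real.fourierIntegral_convergent_iff (f := fun x => (k x : ℂ)) ξ).2 hkc
    have hi2 := (Real.fourierIntegral_convergent_iff (f := fun x => (k (x - h) : ℂ)) ξ).2 (hkc.comp_sub_right h)
    simp only [Complex.ofReal_sub, smul_sub]
    rw [integral_sub hi2 hi1, ← Real.fourier_eq, ← Real.fourier_eq, e2]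
    ring
  have key : ‖(2 : ℂ) * 𝓕 (fun x => (k x : ℂ)) ξ‖ₑ ≤ ENNReal.ofReal (5 * A) := by
    rw [e3, enorm_neg]
    calc _ ≤ _ := enorm_integral_le_lintegral_enorm _
      _ = ∫⁻ x, ‖k (x - h) - k x‖ₑ := by
        congr 1; ext x
        rw [Circle.smul_def, smul_eq_mul, enorm_mul]
        simp only [← ofReal_norm, Complex.norm_real, Circle.norm_coe, ENNReal.ofReal_one, one_mul]
      _ ≤ 5 * A := hK.lintegral_indicator_annulus_sub_le hhn
      _ = _ := by
        rw [ENNReal.ofReal_mul (by norm_num)]; simp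
  rw [← ofReal_norm, ENNReal.ofReal_le_ofReal_iff (by positivity), norm_mul] at key
  simp at key
  linarith [A.2, norm_nonneg (𝓕 (fun x => (k x : ℂ)) ξ)]

/-- The Fourier transforms of the truncations of a Calderón–Zygmund kernel are uniformly bounded. -/
lemma norm_fourier_annulus_le (hK : IsCZKernel K A) {a N : ℝ} (ha : 0 < a) (ξ : E) :
    ‖𝓕 (fun x => (((annulus E a N).indicator K x : ℝ) : ℂ)) ξ‖ ≤ 16 * A := by
  rcases le_or_gt (N * ‖ξ‖) 1 with h1 | h1
  · refine (hK.norm_fourier_annulus_le_of_inner ha h1).trans ?_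
    gcongr; norm_num
  rcases le_or_gt 1 (a * ‖ξ‖) with h2 | h2
  · refine (hK.norm_fourier_annulus_le_of_outer h2).trans ?_
    gcongr; norm_num
  have hξ0 : 0 < ‖ξ‖ := by
    by_contra! h
    have : ‖ξ‖ = 0 := le_antisymm h (norm_nonneg _)
    rw [this] at h1; linarith
  set m := 1 / ‖ξ‖
  have hmξ : m * ‖ξ‖ = 1 := by simp only [m]; field_simp
  have ham : a < m := by rwa [lt_div_iff₀ hξ0]
  have hmN : m < N := by rwa [div_lt_iff₀ hξ0]
  have e : (fun x => (((annulus E a N).indicator K x : ℝ) : ℂ)) =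
      (fun x => (((annulus E a m).indicator K x : ℝ) : ℂ)) + fun x => (((annulus E m N).indicator K x : ℝ) : ℂ) := by
    ext x
    rw [Pi.add_apply, ← Complex.ofReal_add]
    congr 1
    have : annulus E a N = annulus E a m ∪ annulus E m N := by
      ext x
      simp only [annulus, mem_union, mem_ofPred_eq]
      constructor
      · rintro ⟨h1, h2⟩
        rcases le_or_gt ‖x‖ m with h | h
        · exact .inl ⟨h1, h⟩
        · exact .inr ⟨h, h2⟩
      · rintro (⟨h1, h2⟩ | ⟨h1, h2⟩)
        · exact ⟨h1, h2.trans hmN.le⟩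
        · exact ⟨ham.trans h1, h2⟩
    rw [this, indicator_union_of_disjoint]
    rw [Set.disjoint_left]
    rintro x ⟨h1, h2⟩ ⟨h3, h4⟩
    linarith
  have hf1 := (hK.integrable_indicator_annulus ha m).ofReal (𝕜 := ℂ)
  have hf2 := (hK.integrable_indicator_annulus (ha.trans ham) N).ofReal (𝕜 := ℂ)
  have e' : 𝓕 (fun x => (((annulus E a N).indicator K x : ℝ) : ℂ)) ξ =
      𝓕 (fun x => (((annulus E a m).indicator K x : ℝ) : ℂ)) ξ +
       𝓕 (fun x => (((annulus E m N).indicator K x : ℝ) : ℂ)) ξ := by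
    rw [e, Real.fourier_eq, Real.fourier_eq, Real.fourier_eq]
    refine Eq.trans ?_ (integral_add ((Real.fourierIntegral_convergent_iff ξ).2 hf1)
      ((Real.fourierIntegral_convergent_iff ξ).2 hf2))
    simp
  rw [e']
  calc _ ≤ _ := norm_add_le _ _
    _ ≤ 13 * A + 3 * A := add_le_add (hK.norm_fourier_annulus_le_of_inner ha hmξ.le)
        (hK.norm_fourier_annulus_le_of_outer hmξ.ge)
    _ = _ := by ring

end IsCZKernel

end KernelFourier

section Truncation

open Metric Module FourierTransform
open scoped ENNReal NNReal Topology

variable {E : Type*} [NormedAddCommGroup E] [InnerProductSpace ℝ E] [FiniteDimensional ℝ E]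
  [MeasurableSpace E] [BorelSpace E]

/-- The truncated convolution `∫_{|x - y| > ε} K(x - y) f(y) dy`. -/
def truncConv (K : E → ℝ) (ε : ℝ) (f : E → ℝ) (x : E) : ℝ :=
  ∫ y in {y | ε < ‖x - y‖}, K (x - y) * f y

omit [InnerProductSpace ℝ E] [FiniteDimensional ℝ E] in
lemma measurableSet_lt_norm_sub (ε : ℝ) (x : E) : MeasurableSet {y : E | ε < ‖x - y‖} :=
  measurableSet_lt measurable_const (by fun_prop)

namespace IsCZKernel

variable {K : E → ℝ} {A : ℝ≥0}

/-- Away from the origin, a Calderón–Zygmund kernel is the sum of an integrable and a bounded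
function. -/
lemma exists_majorant [Nontrivial E] (hK : IsCZKernel K A) {ε : ℝ} (hε : 0 < ε) :
    ∃ u : E → ℝ≥0∞, ∃ c : ℝ≥0∞, Measurable u ∧ c ≠ ∞ ∧ ∫⁻ x, u x ≤ A ∧
      ∀ x, ε < ‖x‖ → ‖K x‖ₑ ≤ u x + c := by
  have mK := hK.measurable
  set B := ball (0 : E) (ε / 3)
  set v := volume B
  have hv0 : v ≠ 0 := (measure_ball_pos _ _ (by positivity)).ne'
  have hvt : v ≠ ∞ := measure_ball_lt_top.ne
  set F : E → E → ℝ≥0∞ := fun x y => {p : E × E | 2 * ‖p.2‖ < ‖p.1‖}.indicator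
    (fun p => ‖K (p.1 - p.2) - K p.1‖ₑ) (x, y)
  have hFm : Measurable (Function.uncurry F) := by
    refine Measurable.indicator ?_ (measurableSet_lt (by fun_prop) (by fun_prop))
    fun_prop
  refine ⟨fun x => v⁻¹ * ∫⁻ y in B, F x y, v⁻¹ * A, ?_, ?_, ?_, ?_⟩
  · exact (hFm.lintegral_prod_right' (ν := volume.restrict B)).const_mul _
  · exact ENNReal.mul_ne_top (by simpa using hv0) (by simp)
  · beta_reduce
    rw [lintegral_const_mul' _ _ (by simpa using hv0),
      lintegral_lintegral_swap hFm.aemeasurable]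
    calc _ ≤ v⁻¹ * ∫⁻ y in B, (A : ℝ≥0∞) := by
          gcongr with y
          refine le_trans (le_of_eq ?_) (hK.hormander y)
          rw [← lintegral_indicator (measurableSet_lt measurable_const measurable_norm)]
          rfl
      _ = _ := by
        rw [setLIntegral_const, mul_comm (A : ℝ≥0∞), ← mul_assoc, ENNReal.inv_mul_cancel hv0 hvt,
          one_mul]
  · intro x hx
    have e1 : ‖K x‖ₑ = v⁻¹ * ∫⁻ y in B, ‖K x‖ₑ := by
      rw [setLIntegral_const, mul_comm ‖K x‖ₑ, ← mul_assoc, ENNReal.inv_mul_cancel hv0 hvt, one_mul]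
    have e2 : ∫⁻ y in B, ‖K x‖ₑ ≤ ∫⁻ y in B, (F x y + ‖K (x - y)‖ₑ) := by
      refine setLIntegral_mono' measurableSet_ball fun y hy => ?_
      have hy' : ‖y‖ < ε / 3 := by simpa [B] using hy
      have : F x y = ‖K (x - y) - K x‖ₑ := indicator_of_mem
        (show (x, y) ∈ {p : E × E | 2 * ‖p.2‖ < ‖p.1‖} from (by linarith : 2 * ‖y‖ < ‖x‖)) _
      rw [this, add_comm]
      calc ‖K x‖ₑ = ‖K (x - y) - (K (x - y) - K x)‖ₑ := by congr 1; ring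
        _ ≤ _ := enorm_sub_le
    have e3 : ∫⁻ y in B, ‖K (x - y)‖ₑ ≤ A := by
      calc ∫⁻ y in B, ‖K (x - y)‖ₑ = ∫⁻ y, B.indicator (fun y => ‖K (x - y)‖ₑ) y :=
            (lintegral_indicator measurableSet_ball _).symm
        _ = ∫⁻ y, B.indicator (fun y => ‖K (x - y)‖ₑ) (x - y) :=
            (lintegral_sub_left_eq_self _ x).symm
        _ ≤ ∫⁻ y, (annulus E (‖x‖ - ε / 3) (2 * (‖x‖ - ε / 3))).indicator (fun y => ‖K y‖ₑ) y := by
            refine lintegral_mono fun y => ?_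
            by_cases hy : x - y ∈ B
            · have hy' : ‖x - y‖ < ε / 3 := by simpa [B] using hy
              rw [indicator_of_mem hy, indicator_of_mem, sub_sub_cancel]
              have t1 := norm_le_norm_add_norm_sub' x y
              have t2 := norm_le_norm_add_norm_sub x y
              exact ⟨by linarith, by linarith⟩
            · rw [indicator_of_notMem hy]; exact zero_le
        _ ≤ A := by
          rw [lintegral_indicator (measurableSet_annulus _ _)]
          exact hK.size _ (by linarith)
    calc _ ≤ v⁻¹ * ((∫⁻ y in B, F x y) + A) := by
          rw [e1]
          gcongr
          refine e2.trans ?_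
          rw [lintegral_add_left (f := fun y => F x y) (hFm.comp measurable_prodMk_left)]
          gcongr
      _ = _ := mul_add _ _ _

lemma ae_integrableOn_truncation [Nontrivial E] (hK : IsCZKernel K A) {f : E → ℝ}
    (hf : Integrable f) :
    ∀ᵐ x, ∀ ε > 0, IntegrableOn (fun y => K (x - y) * f y) {y | ε < ‖x - y‖} := by
  have mK := hK.measurable
  have key : ∀ k : ℕ, ∀ᵐ x,
      IntegrableOn (fun y => K (x - y) * f y) {y | 1 / ((k : ℝ) + 1) < ‖x - y‖} := by
    intro k
    obtain ⟨u, c, hu, hc, hui, huc⟩ := hK.exists_majorant (ε := 1 / ((k : ℝ) + 1)) (by positivity)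
    have hfm := hf.aestronglyMeasurable.aemeasurable.enorm
    have hconv : ∫⁻ x, ∫⁻ y, u (x - y) * ‖f y‖ₑ ≠ ∞ := by
      rw [lintegral_lintegral_swap ((hu.comp (measurable_fst.sub measurable_snd)).aemeasurable.mul hfm.comp_snd)]
      have : ∀ y, ∫⁻ x, u (x - y) * ‖f y‖ₑ = (∫⁻ x, u x) * ‖f y‖ₑ := by
        intro y
        rw [lintegral_mul_const' _ _ (by simp), lintegral_sub_right_eq_self u]
      simp only [this]
      rw [lintegral_const_mul' _ _ (hui.trans_lt (by simp)).ne]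
      exact ENNReal.mul_ne_top (hui.trans_lt (by simp)).ne hf.2.ne
    have hm : AEMeasurable fun x => ∫⁻ y, u (x - y) * ‖f y‖ₑ :=
      ((hu.comp (measurable_fst.sub measurable_snd)).aemeasurable.mul hfm.comp_snd).lintegral_prod_right'
    filter_upwards [ae_lt_top' hm hconv] with x hx
    refine ⟨((mK.comp (measurable_const.sub measurable_id)).aestronglyMeasurable.mul
      hf.aestronglyMeasurable).restrict, ?_⟩
    calc ∫⁻ y in {y | 1 / ((k : ℝ) + 1) < ‖x - y‖}, ‖K (x - y) * f y‖ₑ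
        ≤ ∫⁻ y in {y | 1 / ((k : ℝ) + 1) < ‖x - y‖}, (u (x - y) * ‖f y‖ₑ + c * ‖f y‖ₑ) := by
          refine setLIntegral_mono' (measurableSet_lt_norm_sub _ _) fun y hy => ?_
          rw [enorm_mul, ← add_mul]
          gcongr
          exact huc _ hy
      _ ≤ ∫⁻ y, (u (x - y) * ‖f y‖ₑ + c * ‖f y‖ₑ) := lintegral_mono' Measure.restrict_le_self le_rfl
      _ = (∫⁻ y, u (x - y) * ‖f y‖ₑ) + c * ∫⁻ y, ‖f y‖ₑ := by
          rw [lintegral_add_right' _ (hfm.const_mul _), lintegral_const_mul' _ _ hc]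
      _ < ∞ := ENNReal.add_lt_top.2 ⟨hx, ENNReal.mul_lt_top hc.lt_top hf.2⟩
  filter_upwards [ae_all_iff.2 key] with x hx ε hε
  obtain ⟨k, hk⟩ := exists_nat_one_div_lt hε
  exact (hx k).mono_set fun y hy => hk.trans hy

lemma integrableOn_truncation_of_bounded [Nontrivial E] (hK : IsCZKernel K A) {f : E → ℝ}
    (hf : Integrable f) {M : ℝ} (hM : ∀ x, |f x| ≤ M) {ε : ℝ} (hε : 0 < ε) (x : E) :
    IntegrableOn (fun y => K (x - y) * f y) {y | ε < ‖x - y‖} := by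
  have mK := hK.measurable
  obtain ⟨u, c, hu, hc, hui, huc⟩ := hK.exists_majorant hε
  have hfm := hf.aestronglyMeasurable.aemeasurable.enorm
  refine ⟨((mK.comp (measurable_const.sub measurable_id)).aestronglyMeasurable.mul
    hf.aestronglyMeasurable).restrict, ?_⟩
  calc ∫⁻ y in {y | ε < ‖x - y‖}, ‖K (x - y) * f y‖ₑ
      ≤ ∫⁻ y in {y | ε < ‖x - y‖}, (u (x - y) * ENNReal.ofReal M + c * ‖f y‖ₑ) := by
        refine setLIntegral_mono' (measurableSet_lt_norm_sub _ _) fun y hy => ?_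
        rw [enorm_mul]
        calc _ ≤ (u (x - y) + c) * ‖f y‖ₑ := by gcongr; exact huc _ hy
          _ = u (x - y) * ‖f y‖ₑ + c * ‖f y‖ₑ := add_mul _ _ _
          _ ≤ _ := by
            gcongr
            rw [← ofReal_norm]
            exact ENNReal.ofReal_le_ofReal (hM y)
    _ ≤ ∫⁻ y, (u (x - y) * ENNReal.ofReal M + c * ‖f y‖ₑ) :=
        lintegral_mono' Measure.restrict_le_self le_rfl
    _ = (∫⁻ y, u y) * ENNReal.ofReal M + c * ∫⁻ y, ‖f y‖ₑ := by
        rw [lintegral_add_right' _ (hfm.const_mul _), lintegral_const_mul' _ _ hc,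
          lintegral_mul_const' _ _ (by simp), lintegral_sub_left_eq_self u]
    _ < ∞ := ENNReal.add_lt_top.2 ⟨ENNReal.mul_lt_top (hui.trans_lt (by simp)) (by simp),
        ENNReal.mul_lt_top hc.lt_top hf.2⟩

/-- The truncations are bounded on `L²`, uniformly in the truncation parameter. -/
lemma lintegral_enorm_sq_truncConv_le [Nontrivial E] (hK : IsCZKernel K A) {g : E → ℝ}
    (hg : Integrable g) {M : ℝ} (hM : ∀ x, |g x| ≤ M) {ε : ℝ} (hε : 0 < ε) :
    ∫⁻ x, ‖truncConv K ε g x‖ₑ ^ 2 ≤ ENNReal.ofReal (16 * A) ^ 2 * ∫⁻ x, ‖g x‖ₑ ^ 2 := by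
  have mK := hK.measurable
  have hlim : ∀ x, Tendsto (fun N : ℕ => ∫ y, (annulus E ε N).indicator K (x - y) * g y) atTop
      (𝓝 (truncConv K ε g x)) := by
    intro x
    unfold truncConv
    rw [← integral_indicator (measurableSet_lt_norm_sub _ _)]
    have hi := (integrable_indicator_iff (measurableSet_lt_norm_sub ε x)).2
      (hK.integrableOn_truncation_of_bounded hg hM hε x)
    refine tendsto_integral_of_dominated_convergence _ (fun N => ?_) hi.norm (fun N => ?_) ?_
    · exact ((mK.indicator (measurableSet_annulus ε N)).comp
        (measurable_const.sub measurable_id)).aestronglyMeasurable.mul hg.aestronglyMeasurable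
    · refine Eventually.of_forall fun y => ?_
      by_cases hy : x - y ∈ annulus E ε N
      · rw [indicator_of_mem hy, indicator_of_mem (show y ∈ {y | ε < ‖x - y‖} from hy.1)]
      · rw [indicator_of_notMem hy, zero_mul, norm_zero]; exact norm_nonneg _
    · refine Eventually.of_forall fun y => ?_
      obtain ⟨N₀, hN₀⟩ := exists_nat_ge ‖x - y‖
      refine tendsto_const_nhds.congr' ?_
      filter_upwards [eventually_ge_atTop N₀] with N hN
      by_cases hy : ε < ‖x - y‖
      · rw [indicator_of_mem (show x - y ∈ annulus E ε N from ⟨hy,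
          hN₀.trans (by exact_mod_cast hN)⟩),
          indicator_of_mem (show y ∈ {y | ε < ‖x - y‖} from hy)]
      · rw [indicator_of_notMem (fun h : x - y ∈ annulus E ε N => hy h.1),
          indicator_of_notMem (show y ∉ {y | ε < ‖x - y‖} from hy), zero_mul]
  calc ∫⁻ x, ‖truncConv K ε g x‖ₑ ^ 2
      = ∫⁻ x, liminf (fun N : ℕ => ‖∫ y,
          (annulus E ε N).indicator K (x - y) * g y‖ₑ ^ 2) atTop := by
        congr 1; ext x
        exact (((ENNReal.continuous_pow 2).tendsto _).comp (hlim x).enorm).liminf_eq.symm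
    _ ≤ liminf (fun N : ℕ => ∫⁻ x, ‖∫ y,
        (annulus E ε N).indicator K (x - y) * g y‖ₑ ^ 2) atTop := by
        refine lintegral_liminf_le' fun N => ?_
        have : AEStronglyMeasurable (fun p : E × E => (annulus E ε N).indicator K (p.1 - p.2) * g p.2)
            (volume.prod volume) :=
          ((mK.indicator (measurableSet_annulus ε N)).comp
            (measurable_fst.sub measurable_snd)).aestronglyMeasurable.mul hg.aestronglyMeasurable.comp_snd
        exact this.integral_prod_right'.aemeasurable.enorm.pow_const 2
    _ ≤ _ := by
        refine liminf_le_of_le (by isBoundedDefault) fun b hb => ?_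
        obtain ⟨N, hN⟩ := hb.exists
        refine hN.trans ?_
        exact lintegral_enorm_sq_convolution_le (hK.integrable_indicator_annulus hε N) hg hM
          fun ξ => hK.norm_fourier_annulus_le hε ξ

end IsCZKernel

end Truncation

section Cotlar

open Metric Module
open scoped ENNReal NNReal Topology

variable {E : Type*} [NormedAddCommGroup E] [InnerProductSpace ℝ E] [FiniteDimensional ℝ E]
  [MeasurableSpace E] [BorelSpace E]

namespace IsCZKernel

variable {K : E → ℝ} {A : ℝ≥0}

lemma abs_truncConv_le_of_mem_closedBall [Nontrivial E] (hK : IsCZKernel K A) {g : E → ℝ}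
    (hg : Integrable g) {M : ℝ} (hM : ∀ x, |g x| ≤ M) {ε η : ℝ} (hη : 0 < η) (hε : 2 * η ≤ ε)
    {x x' : E} (hx : x' ∈ closedBall x (ε / 2)) :
    |truncConv K ε g x| ≤
      |truncConv K η g x'| + |truncConv K η ((closedBall x ε).indicator g) x'| + A * M := by
  have mK := hK.measurable
  have hM0 : 0 ≤ M := (abs_nonneg _).trans (hM x)
  have hε0 : 0 < ε := by linarith
  rw [mem_closedBall, dist_eq_norm'] at hx
  set S : Set E := {y | ε < ‖x - y‖}
  set S' : Set E := {y | η < ‖x' - y‖}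
  have mS : MeasurableSet S := measurableSet_lt_norm_sub _ _
  have mS' : MeasurableSet S' := measurableSet_lt_norm_sub _ _
  have i1 := hK.integrableOn_truncation_of_bounded hg hM hε0 x
  have i2 := hK.integrableOn_truncation_of_bounded hg hM hη x'
  have hSS : S ⊆ S' := fun y hy => by
    have hy' : ε < ‖x - y‖ := hy
    have : ‖x - y‖ ≤ ‖x - x'‖ + ‖x' - y‖ := norm_sub_le_norm_sub_add_norm_sub _ _ _
    show η < ‖x' - y‖
    linarith
  have e1 : truncConv K η g x' - truncConv K η ((closedBall x ε).indicator g) x' =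
      ∫ y in S, K (x' - y) * g y := by
    have h1 : truncConv K η ((closedBall x ε).indicator g) x' =
        ∫ y in S' \ S, K (x' - y) * g y := by
      unfold truncConv
      rw [← integral_indicator mS', ← integral_indicator (mS'.diff mS)]
      congr 1; ext y
      by_cases hy : y ∈ S'
      · by_cases hy2 : y ∈ S
        · have : y ∉ closedBall x ε := by
            rw [mem_closedBall, dist_eq_norm', not_le]; exact hy2
          rw [indicator_of_mem (show y ∈ {y | η < ‖x' - y‖} from hy), indicator_of_notMem this,
            indicator_of_notMem (fun h => h.2 hy2)]
          simp
        · have : y ∈ closedBall x ε := by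
            rw [mem_closedBall, dist_eq_norm']; exact not_lt.1 hy2
          rw [indicator_of_mem (show y ∈ {y | η < ‖x' - y‖} from hy), indicator_of_mem this,
            indicator_of_mem (show y ∈ S' \ S from ⟨hy, hy2⟩)]
      · rw [indicator_of_notMem (show y ∉ {y | η < ‖x' - y‖} from hy),
          indicator_of_notMem (fun h => hy h.1)]
    rw [h1, setIntegral_sdiff mS i2 hSS]
    simp only [truncConv]
    ring
  have e2 : truncConv K ε g x - ∫ y in S, K (x' - y) * g y =
      ∫ y in S, (K (x - y) - K (x' - y)) * g y := by
    rw [truncConv, ← integral_sub i1 (i2.mono_set hSS)]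
    simp only [sub_mul]
    rfl
  have e3 : ‖∫ y in S, (K (x - y) - K (x' - y)) * g y‖ₑ ≤ ENNReal.ofReal (A * M) := by
    calc _ ≤ ∫⁻ y in S, ‖(K (x - y) - K (x' - y)) * g y‖ₑ := enorm_integral_le_lintegral_enorm _
      _ ≤ ∫⁻ y in S, ‖K (x - y - (x - x')) - K (x - y)‖ₑ * ENNReal.ofReal M := by
          refine lintegral_mono fun y => ?_
          rw [enorm_mul, show x - y - (x - x') = x' - y by abel, ← enorm_neg, neg_sub]
          gcongr
          rw [← ofReal_norm]
          exact ENNReal.ofReal_le_ofReal (hM y)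
      _ = (∫⁻ y in S, ‖K (x - y - (x - x')) - K (x - y)‖ₑ) * ENNReal.ofReal M :=
          lintegral_mul_const' _ _ (by simp)
      _ ≤ A * ENNReal.ofReal M := by
          gcongr
          refine le_trans ?_ (hK.hormander (x - x'))
          rw [← lintegral_indicator mS,
            ← lintegral_indicator (measurableSet_lt measurable_const measurable_norm),
            ← lintegral_sub_left_eq_self _ x]
          refine lintegral_mono fun y => ?_
          by_cases hy : x - y ∈ S
          · have hy' : ε < ‖y‖ := by simpa [S] using hy
            rw [indicator_of_mem hy, indicator_of_mem (show y ∈ {y : E | 2 * ‖x - x'‖ < ‖y‖} from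
              (by linarith : 2 * ‖x - x'‖ < ‖y‖))]
            simp
          · rw [indicator_of_notMem hy]; exact zero_le
      _ = _ := by rw [ENNReal.ofReal_mul A.coe_nonneg]; simp
  rw [← ofReal_norm, ENNReal.ofReal_le_ofReal_iff (by positivity), ← e2, ← e1,
    Real.norm_eq_abs] at e3
  have t1 := abs_sub_abs_le_abs_sub (truncConv K ε g x)
    (truncConv K η g x' - truncConv K η ((closedBall x ε).indicator g) x')
  have t2 := abs_sub (truncConv K η g x') (truncConv K η ((closedBall x ε).indicator g) x')
  linarith

/-- Weak type estimate for the maximal truncation of a bounded function. -/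
lemma volume_exists_truncConv_gt_le_of_bounded [Nontrivial E] (hK : IsCZKernel K A) {g : E → ℝ}
    (hg : Integrable g) {M : ℝ} (hM : ∀ x, |g x| ≤ M) {s : ℝ} (hs : 0 < s)
    (hMs : 6 * (16 * A) ^ 2 * (2 ^ finrank ℝ E + 1) * M ^ 2 ≤ s ^ 2) :
    volume {x | ∃ ε > 0, s < |truncConv K ε g x|} ≤
      ENNReal.ofReal (5 ^ finrank ℝ E) * (ENNReal.ofReal ((16 * A) ^ 2 * M) * ∫⁻ x, ‖g x‖ₑ) /
        ENNReal.ofReal (s ^ 2 / 7) := by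
  have mK := hK.measurable
  have hM0 : 0 ≤ M := (abs_nonneg _).trans (hM 0)
  have hgM : ∀ x, ‖g x‖ₑ ≤ ENNReal.ofReal M := fun x => by
    rw [← ofReal_norm]; exact ENNReal.ofReal_le_ofReal (hM x)
  have hg2 : ∫⁻ x, ‖g x‖ₑ ^ 2 ≤ ENNReal.ofReal M * ∫⁻ x, ‖g x‖ₑ := by
    rw [← lintegral_const_mul' _ _ (by simp)]
    refine lintegral_mono fun x => ?_
    rw [sq]
    gcongr
    exact hgM x
  have key : ∀ k : ℕ, volume {x | ∃ ε ≥ 2 * (1 / ((k : ℝ) + 1)), s < |truncConv K ε g x|} ≤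
      ENNReal.ofReal (5 ^ finrank ℝ E) * (ENNReal.ofReal ((16 * A) ^ 2 * M) * ∫⁻ x, ‖g x‖ₑ) /
        ENNReal.ofReal (s ^ 2 / 7) := by
    intro k
    set η := 1 / ((k : ℝ) + 1)
    have hη : 0 < η := by positivity
    set F : E → ℝ≥0∞ := fun x => ‖truncConv K η g x‖ₑ ^ 2
    have hFi : ∫⁻ x, F x ≤ ENNReal.ofReal ((16 * A) ^ 2 * M) * ∫⁻ x, ‖g x‖ₑ := by
      refine (hK.lintegral_enorm_sq_truncConv_le hg hM hη).trans ?_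
      rw [ENNReal.ofReal_mul (q := M) (by positivity), mul_assoc,
        ENNReal.ofReal_pow (by positivity)]
      gcongr
    have hFt : ∫⁻ x, F x ≠ ∞ := (hFi.trans_lt (ENNReal.mul_lt_top (by simp) hg.2)).ne
    have hc : ENNReal.ofReal (s ^ 2 / 7) ≠ 0 := by
      rw [Ne, ENNReal.ofReal_eq_zero, not_le]; positivity
    refine le_trans (measure_mono ?_) ((volume_exists_average_gt_le hFt hc (by simp)).trans (by gcongr))
    rintro x ⟨ε, hε, hx⟩
    have hε0 : 0 < ε := by linarith
    refine ⟨ε / 2, by positivity, ?_⟩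
    set B := closedBall x (ε / 2)
    have hV0 : volume B ≠ 0 := (measure_closedBall_pos _ _ (by positivity)).ne'
    have hVt : volume B ≠ ∞ := measure_closedBall_lt_top.ne
    set g2 := (closedBall x ε).indicator g
    have hg2i : Integrable g2 := hg.indicator measurableSet_closedBall
    have hg2M : ∀ y, |g2 y| ≤ M := fun y => by
      by_cases hy : y ∈ closedBall x ε
      · simpa [g2, indicator_of_mem hy] using hM y
      · simpa [g2, indicator_of_notMem hy] using hM0
    have hg2n : ∫⁻ y, ‖g2 y‖ₑ ^ 2 ≤ ENNReal.ofReal (M ^ 2 * 2 ^ finrank ℝ E) * volume B := by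
      calc ∫⁻ y, ‖g2 y‖ₑ ^ 2 ≤
          ∫⁻ y, (closedBall x ε).indicator (fun _ => ENNReal.ofReal (M ^ 2)) y := by
            refine lintegral_mono fun y => ?_
            by_cases hy : y ∈ closedBall x ε
            · simp only [g2, indicator_of_mem hy]
              rw [ENNReal.ofReal_pow hM0]
              gcongr; exact hgM y
            · simp [g2, indicator_of_notMem hy]
        _ = ENNReal.ofReal (M ^ 2) * volume (closedBall x (2 * (ε / 2))) := by
            rw [lintegral_indicator measurableSet_closedBall, setLIntegral_const]; congr 3; ring
        _ = _ := by
            rw [volume_closedBall_mul x x two_pos (by positivity),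
              ENNReal.ofReal_mul (by positivity), mul_assoc]
    have hpt : ∀ x' ∈ B, ENNReal.ofReal (s ^ 2) ≤
        3 * F x' + 3 * ‖truncConv K η g2 x'‖ₑ ^ 2 + ENNReal.ofReal (3 * (A * M) ^ 2) := by
      intro x' hx'
      have := hK.abs_truncConv_le_of_mem_closedBall hg hM hη hε hx'
      set a := truncConv K η g x'
      set b := truncConv K η g2 x'
      have h1 : s ≤ |a| + |b| + A * M := hx.le.trans this
      have h2 : s ^ 2 ≤ 3 * a ^ 2 + 3 * b ^ 2 + 3 * (A * M) ^ 2 := by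
        have := pow_le_pow_left₀ hs.le h1 2
        rw [← sq_abs a, ← sq_abs b]
        nlinarith [sq_nonneg (|a| - |b|), sq_nonneg (|a| - A * M), sq_nonneg (|b| - A * M)]
      refine (ENNReal.ofReal_le_ofReal h2).trans_eq ?_
      have hsq : ∀ c : ℝ, ENNReal.ofReal (3 * c ^ 2) = 3 * ‖c‖ₑ ^ 2 := fun c => by
        rw [ENNReal.ofReal_mul (by norm_num), ← sq_abs, ENNReal.ofReal_pow (abs_nonneg _),
          ← Real.norm_eq_abs, ofReal_norm]
        simp
      rw [ENNReal.ofReal_add (by positivity) (by positivity),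
        ENNReal.ofReal_add (by positivity) (by positivity),
        hsq, hsq]
    have h_int : ENNReal.ofReal (s ^ 2) * volume B ≤
        3 * (∫⁻ y in B, F y) + ENNReal.ofReal (s ^ 2 / 2) * volume B := by
      have hFm : AEMeasurable (fun y => 3 * F y) (volume.restrict B) := by
        have : AEStronglyMeasurable (fun x => truncConv K η g x) volume := by
          have : AEStronglyMeasurable (fun p : E × E => ({p : E × E | η < ‖p.1 - p.2‖}.indicator (fun p => K (p.1 - p.2)) p) * g p.2)
              (volume.prod volume) :=
            (((mK.comp (measurable_fst.sub measurable_snd)).indicator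
              (measurableSet_lt measurable_const (by fun_prop)))).aestronglyMeasurable.mul hg.aestronglyMeasurable.comp_snd
          refine this.integral_prod_right'.congr (Eventually.of_forall fun x => ?_)
          simp only [truncConv]
          rw [← integral_indicator (measurableSet_lt_norm_sub _ _)]
          congr 1; ext y
          by_cases h : η < ‖x - y‖
          · rw [indicator_of_mem (show (x, y) ∈ {p : E × E | η < ‖p.1 - p.2‖} from h),
              indicator_of_mem (show y ∈ {y | η < ‖x - y‖} from h)]
          · rw [indicator_of_notMem (show (x, y) ∉ {p : E × E | η < ‖p.1 - p.2‖} from h),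
              indicator_of_notMem (show y ∉ {y | η < ‖x - y‖} from h), zero_mul]
        exact (this.aemeasurable.enorm.pow_const 2).const_mul 3 |>.restrict
      calc _ = ∫⁻ y in B, ENNReal.ofReal (s ^ 2) := (setLIntegral_const _ _).symm
        _ ≤ ∫⁻ y in B, (3 * F y + 3 * ‖truncConv K η g2 y‖ₑ ^ 2 + ENNReal.ofReal (3 * (A * M) ^ 2)) :=
            setLIntegral_mono' measurableSet_closedBall hpt
        _ = 3 * (∫⁻ y in B, F y) + 3 * (∫⁻ y in B, ‖truncConv K η g2 y‖ₑ ^ 2) +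
              ENNReal.ofReal (3 * (A * M) ^ 2) * volume B := by
            rw [lintegral_add_right _ measurable_const, lintegral_add_left' hFm,
              lintegral_const_mul' _ _ (by simp), lintegral_const_mul' _ _ (by simp),
                  setLIntegral_const]
        _ ≤ 3 * (∫⁻ y in B, F y) + 3 * (ENNReal.ofReal (16 * A) ^ 2 * (ENNReal.ofReal (M ^ 2 * 2 ^ finrank ℝ E) * volume B)) +
              ENNReal.ofReal (3 * (A * M) ^ 2) * volume B := by
            gcongr
            calc ∫⁻ y in B, ‖truncConv K η g2 y‖ₑ ^ 2 ≤ ∫⁻ y, ‖truncConv K η g2 y‖ₑ ^ 2 :=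
                  lintegral_mono' Measure.restrict_le_self le_rfl
              _ ≤ _ := hK.lintegral_enorm_sq_truncConv_le hg2i hg2M hη
              _ ≤ _ := by gcongr
        _ = 3 * (∫⁻ y in B, F y) + ENNReal.ofReal (3 * (16 * A) ^ 2 * (M ^ 2 * 2 ^ finrank ℝ E) + 3 * (A * M) ^ 2) * volume B := by
            rw [ENNReal.ofReal_add (by positivity) (by positivity),
              ENNReal.ofReal_mul (p := 3 * (16 * (A : ℝ)) ^ 2) (by positivity),
              ENNReal.ofReal_mul (p := 3) (q := (16 * (A : ℝ)) ^ 2) (by positivity),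
              ENNReal.ofReal_pow (p := 16 * (A : ℝ)) (by positivity)]
            simp only [ENNReal.ofReal_ofNat]
            ring
        _ ≤ _ := by
            gcongr
            nlinarith [sq_nonneg (A * M : ℝ)]
    have hfin : ENNReal.ofReal (s ^ 2 / 2) * volume B ≤ 3 * ∫⁻ y in B, F y := by
      have : ENNReal.ofReal (s ^ 2) * volume B =
          ENNReal.ofReal (s ^ 2 / 2) * volume B + ENNReal.ofReal (s ^ 2 / 2) * volume B := by
        rw [← add_mul, ← ENNReal.ofReal_add (by positivity) (by positivity)]; congr 2; ring
      rw [this] at h_int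
      exact (ENNReal.add_le_add_iff_right (ENNReal.mul_ne_top (by simp) hVt)).1 h_int
    have h3 : (3 : ℝ≥0∞) * (ENNReal.ofReal (s ^ 2 / 7) * volume B) < 3 * ∫⁻ y in B, F y := by
      refine lt_of_lt_of_le ?_ hfin
      rw [← mul_assoc, show (3 : ℝ≥0∞) = ENNReal.ofReal 3 by simp, ← ENNReal.ofReal_mul (by norm_num)]
      refine ENNReal.mul_lt_mul_left hV0 hVt ?_
      rw [ENNReal.ofReal_lt_ofReal_iff (by positivity)]
      nlinarith [pow_pos hs 2]
    exact (ENNReal.mul_lt_mul_iff_right (by simp) (by simp)).1 h3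
  have hU : {x | ∃ ε > 0, s < |truncConv K ε g x|} =
      ⋃ k : ℕ, {x | ∃ ε ≥ 2 * (1 / ((k : ℝ) + 1)), s < |truncConv K ε g x|} := by
    ext x
    simp only [mem_ofPred_eq, mem_iUnion]
    constructor
    · rintro ⟨ε, hε, h⟩
      obtain ⟨k, hk⟩ := exists_nat_one_div_lt (half_pos hε)
      exact ⟨k, ε, by linarith, h⟩
    · rintro ⟨k, ε, hε, h⟩
      exact ⟨ε, lt_of_lt_of_le (by positivity) hε, h⟩
  rw [hU, Monotone.measure_iUnion]
  · exact iSup_le key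
  · intro k l hkl x
    rintro ⟨ε, hε, h⟩
    refine ⟨ε, le_trans ?_ hε, h⟩
    gcongr

end IsCZKernel

end Cotlar

section Decomposition

open Metric Module
open scoped ENNReal NNReal Topology

variable {E : Type*} [NormedAddCommGroup E] [InnerProductSpace ℝ E] [FiniteDimensional ℝ E]
  [MeasurableSpace E] [BorelSpace E]

/-- The **Calderón–Zygmund decomposition** of an integrable function into a bounded function `g`
and a function with mean zero on each member of a family of small sets. -/
lemma exists_calderonZygmund_decomposition [Nontrivial E] {f : E → ℝ} (hf : Integrable f) {s : ℝ}
    (hs : 0 < s) :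
    ∃ (u : Set E) (Q : u → Set E) (r : u → ℝ) (g : E → ℝ), u.Countable ∧ (∀ i, 0 < r i) ∧
      (∀ i, MeasurableSet (Q i)) ∧ (∀ i, Q i ⊆ closedBall i.1 (r i)) ∧
      Pairwise (Function.onFun Disjoint Q) ∧
      Integrable g ∧ (∀ x, |g x| ≤ 40 ^ finrank ℝ E * s) ∧
      ∫⁻ x, ‖g x‖ₑ ≤ ∫⁻ x, ‖f x‖ₑ ∧
      (∀ i, ∫ x in Q i, (f x - g x) = 0) ∧
      (∀ i, ∫⁻ x in Q i, ‖f x - g x‖ₑ ≤ ENNReal.ofReal (2 * 40 ^ finrank ℝ E * s) * volume (Q i)) ∧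
      (∀ᵐ x, x ∉ ⋃ i, Q i → f x = g x) ∧
      volume (⋃ i : u, closedBall i.1 (5 * r i)) ≤
        ENNReal.ofReal (40 ^ finrank ℝ E * 5 ^ finrank ℝ E) * (∫⁻ x, ‖f x‖ₑ) / ENNReal.ofReal s ∧
      ∑' i, volume (Q i) ≤ ENNReal.ofReal (5 ^ finrank ℝ E) * (∫⁻ x,
          ‖f x‖ₑ) / ENNReal.ofReal s := by
  obtain ⟨u, Q, r, hu, hr, hQm, hQs, hQd, hQ0, hQ5, hQf, hQv, hfs⟩ :=
      exists_calderonZygmund_cover hf hs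
  have : Countable u := hu.to_subtype
  set C := (40 : ℝ) ^ finrank ℝ E
  have hC1 : 1 ≤ C := one_le_pow₀ (by norm_num)
  have hQt : ∀ i, volume (Q i) ≠ ∞ := fun i =>
    ((measure_mono (hQs i)).trans_lt measure_closedBall_lt_top).ne
  set avg : u → ℝ := fun i => (∫ x in Q i, f x) / (volume (Q i)).toReal
  classical
  set g : E → ℝ := fun x => if h : ∃ i, x ∈ Q i then avg h.choose else if |f x| ≤ s then f x else 0
  have hgQ : ∀ i, ∀ x ∈ Q i, g x = avg i := by
    intro i x hx
    have h : ∃ i, x ∈ Q i := ⟨i, hx⟩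
    have : h.choose = i := by
      by_contra hne
      exact Set.disjoint_left.1 (hQd hne) h.choose_spec hx
    simp only [g, dif_pos h, this]
  have hgc : ∀ x, x ∉ ⋃ i, Q i → g x = if |f x| ≤ s then f x else 0 := by
    intro x hx
    rw [mem_iUnion] at hx
    simp only [g, dif_neg hx]
  have hfg : ∀ᵐ x, x ∉ ⋃ i, Q i → f x = g x := by
    filter_upwards [hfs] with x hx hxQ
    rw [hgc x hxQ, if_pos (hx hxQ)]
  have hUm : MeasurableSet (⋃ i, Q i) := MeasurableSet.iUnion hQm
  have hpos : ∀ i, 0 < (volume (Q i)).toReal := fun i => ENNReal.toReal_pos (hQ0 i) (hQt i)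
  have havg : ∀ i, ‖avg i‖ₑ * volume (Q i) ≤ ∫⁻ x in Q i, ‖f x‖ₑ := by
    intro i
    have h1 : ‖avg i‖ₑ * volume (Q i) = ‖∫ x in Q i, f x‖ₑ := by
      conv_lhs => rw [← ENNReal.ofReal_toReal (hQt i)]
      rw [← ofReal_norm, ← ofReal_norm, ← ENNReal.ofReal_mul (norm_nonneg _)]
      simp only [avg]
      rw [norm_div, Real.norm_of_nonneg (hpos i).le, div_mul_cancel₀ _ (hpos i).ne']
    rw [h1]
    exact enorm_integral_le_lintegral_enorm _
  have havg' : ∀ i, ‖avg i‖ₑ ≤ ENNReal.ofReal (C * s) := by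
    intro i
    have h1 := (havg i).trans (hQf i)
    rw [← ENNReal.ofReal_mul (by positivity)] at h1
    exact (ENNReal.mul_le_mul_iff_left (hQ0 i) (hQt i)).1 h1
  have hgm : AEStronglyMeasurable g volume := by
    have h1 : AEStronglyMeasurable g (volume.restrict (⋃ i, Q i)) := by
      rw [aestronglyMeasurable_iUnion_iff]
      intro i
      refine (aestronglyMeasurable_const (b := avg i)).congr ?_
      filter_upwards [self_mem_ae_restrict (hQm i)] with x hx
      exact (hgQ i x hx).symm
    have h2 : AEStronglyMeasurable g (volume.restrict (⋃ i, Q i)ᶜ) := by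
      refine hf.aestronglyMeasurable.restrict.congr ?_
      filter_upwards [self_mem_ae_restrict hUm.compl, ae_restrict_of_ae hfg] with x hx hx2
      exact hx2 hx
    have := aestronglyMeasurable_union_iff.2 ⟨h1, h2⟩
    rwa [union_compl_self, Measure.restrict_univ] at this
  have hgn : ∫⁻ x, ‖g x‖ₑ ≤ ∫⁻ x, ‖f x‖ₑ := by
    rw [← lintegral_add_compl (fun x => ‖g x‖ₑ) hUm, ← lintegral_add_compl (fun x => ‖f x‖ₑ) hUm]
    refine add_le_add ?_ ?_
    · rw [lintegral_iUnion hQm hQd, lintegral_iUnion hQm hQd]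
      refine ENNReal.tsum_le_tsum fun i => ?_
      rw [setLIntegral_congr_fun (g := fun _ => ‖avg i‖ₑ) (hQm i) (fun x hx => by simp only [hgQ i x hx]), setLIntegral_const]
      exact havg i
    · refine lintegral_mono_ae ?_
      filter_upwards [self_mem_ae_restrict hUm.compl, ae_restrict_of_ae hfg] with x hx hx2
      rw [hx2 hx]
  refine ⟨u, Q, r, g, hu, hr, hQm, hQs, hQd, ⟨hgm, hgn.trans_lt hf.2⟩, ?_, hgn, ?_, ?_, hfg, ?_,
    hQv⟩
  · intro x
    by_cases hx : x ∈ ⋃ i, Q i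
    · obtain ⟨i, hi⟩ := mem_iUnion.1 hx
      rw [hgQ i x hi]
      have := havg' i
      rwa [← ofReal_norm, ENNReal.ofReal_le_ofReal_iff (by positivity)] at this
    · rw [hgc x hx]
      split_ifs with h
      · exact h.trans (le_mul_of_one_le_left hs.le hC1)
      · rw [abs_zero]; positivity
  · intro i
    rw [setIntegral_congr_fun (g := fun x => f x - avg i) (hQm i) (fun x hx => by simp only [hgQ i x hx]),
      integral_sub hf.integrableOn (integrableOn_const (hQt i)), setIntegral_const]
    simp only [avg, Measure.real, smul_eq_mul]
    rw [mul_div_cancel₀ _ (hpos i).ne', sub_self]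
  · intro i
    rw [setLIntegral_congr_fun (g := fun x => ‖f x - avg i‖ₑ) (hQm i) (fun x hx => by simp only [hgQ i x hx])]
    calc _ ≤ ∫⁻ x in Q i, (‖f x‖ₑ + ‖avg i‖ₑ) := lintegral_mono fun x => enorm_sub_le
      _ = (∫⁻ x in Q i, ‖f x‖ₑ) + ‖avg i‖ₑ * volume (Q i) := by
        rw [lintegral_add_right _ measurable_const, setLIntegral_const]
      _ ≤ ENNReal.ofReal (C * s) * volume (Q i) + ENNReal.ofReal (C * s) * volume (Q i) := by
        gcongr
        · rw [ENNReal.ofReal_mul (by positivity)]; exact hQf i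
        · exact havg' i
      _ = _ := by
        rw [← add_mul, ← ENNReal.ofReal_add (by positivity) (by positivity)]; congr 2; ring
  · calc _ ≤ ∑' i : u, volume (closedBall i.1 (5 * r i)) := measure_iUnion_le _
      _ ≤ ∑' i : u, ENNReal.ofReal C * volume (Q i) := by gcongr with i; exact hQ5 i
      _ = ENNReal.ofReal C * ∑' i, volume (Q i) := ENNReal.tsum_mul_left
      _ ≤ ENNReal.ofReal C * (ENNReal.ofReal (5 ^ finrank ℝ E) * (∫⁻ x,
          ‖f x‖ₑ) / ENNReal.ofReal s) := by gcongr
      _ = _ := by rw [ENNReal.ofReal_mul (by positivity), mul_div_assoc, mul_div_assoc, mul_assoc]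

end Decomposition

section WeakType

open Metric Module
open scoped ENNReal NNReal Topology

variable {E : Type*} [NormedAddCommGroup E] [InnerProductSpace ℝ E] [FiniteDimensional ℝ E]
  [MeasurableSpace E] [BorelSpace E]

namespace IsCZKernel

variable {K : E → ℝ} {A : ℝ≥0}

lemma lintegral_sub_left_annulus_le (hK : IsCZKernel K A) (x : E) {ε : ℝ} (hε : 0 < ε) :
    ∫⁻ y in {y | ε / 2 < ‖x - y‖ ∧ ‖x - y‖ ≤ 2 * ε}, ‖K (x - y)‖ₑ ≤ 2 * A := by
  have hm : MeasurableSet {y : E | ε / 2 < ‖x - y‖ ∧ ‖x - y‖ ≤ 2 * ε} :=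
    (measurableSet_lt_norm_sub _ x).inter
      (measurableSet_le (f := fun y => ‖x - y‖) (by fun_prop) measurable_const)
  have e : ∫⁻ y in {y | ε / 2 < ‖x - y‖ ∧ ‖x - y‖ ≤ 2 * ε}, ‖K (x - y)‖ₑ =
      ∫⁻ y in annulus E (ε / 2) (2 * ε), ‖K y‖ₑ := by
    rw [← lintegral_indicator hm, ← lintegral_indicator (measurableSet_annulus _ _),
      ← lintegral_sub_left_eq_self ((annulus E (ε / 2) (2 * ε)).indicator _) x]
    rfl
  rw [e]
  have : annulus E (ε / 2) (2 * ε) ⊆ annulus E (ε / 2) (2 * (ε / 2)) ∪ annulus E ε (2 * ε) := by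
    rintro y ⟨h1, h2⟩
    rcases le_or_gt ‖y‖ ε with h | h
    · exact .inl ⟨h1, by linarith⟩
    · exact .inr ⟨h, h2⟩
  calc _ ≤ _ := lintegral_mono_set this
    _ ≤ _ := lintegral_union_le _ _ _
    _ ≤ A + A := add_le_add (hK.size _ (by positivity)) (hK.size _ hε)
    _ = _ := (two_mul _).symm

lemma enorm_setIntegral_le_of_integral_eq_zero (hK : IsCZKernel K A) {Q : Set E}
    {c : E} {r : ℝ} (hr : 0 < r) (hQs : Q ⊆ closedBall c r) {b : E → ℝ} (hb : IntegrableOn b Q)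
    (hb0 : ∫ y in Q, b y = 0) {L : ℝ≥0∞} (hbL : ∫⁻ y in Q, ‖b y‖ₑ ≤ L * volume Q)
    {x : E} (hx : 5 * r < ‖x - c‖) {ε : ℝ}
    (hi : IntegrableOn (fun y => K (x - y) * b y) (Q ∩ {y | ε < ‖x - y‖})) :
    ‖∫ y in Q ∩ {y | ε < ‖x - y‖}, K (x - y) * b y‖ₑ ≤
      (∫⁻ y in Q, ‖K (x - y) - K (x - c)‖ₑ * (‖b y‖ₑ + L)) +
        L * ∫⁻ y in Q ∩ {y | ε / 2 < ‖x - y‖ ∧ ‖x - y‖ ≤ 2 * ε}, ‖K (x - y)‖ₑ := by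
  have mK := hK.measurable
  set S : Set E := {y | ε < ‖x - y‖}
  have hdist : ∀ y ∈ Q, ‖y - c‖ ≤ r := fun y hy => by
    have := hQs hy; rwa [mem_closedBall, dist_eq_norm] at this
  have hfar : ∀ y ∈ Q, 4 * r < ‖x - y‖ := fun y hy => by
    have h1 := norm_sub_le_norm_sub_add_norm_sub x y c
    linarith [hdist y hy]
  have hvar : ∀ y ∈ Q, ∀ z ∈ Q, ‖x - y‖ ≤ ‖x - z‖ + 2 * r := fun y hy z hz => by
    have h1 := norm_sub_le_norm_sub_add_norm_sub x z y
    have h2 := norm_sub_le_norm_sub_add_norm_sub z c y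
    rw [norm_sub_rev c y] at h2
    linarith [hdist y hy, hdist z hz]
  have hDm : Measurable fun y => ‖K (x - y) - K (x - c)‖ₑ := by fun_prop
  by_cases hfull : Q ⊆ S
  · rw [inter_eq_left.2 hfull] at hi ⊢
    refine le_trans ?_ le_self_add
    have e : ∫ y in Q, K (x - y) * b y = ∫ y in Q, (K (x - y) - K (x - c)) * b y := by
      simp only [sub_mul]
      rw [integral_sub hi (hb.const_mul _), integral_const_mul, hb0, mul_zero, sub_zero]
    rw [e]
    refine (enorm_integral_le_lintegral_enorm _).trans (lintegral_mono fun y => ?_)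
    rw [enorm_mul]
    gcongr
    exact le_self_add
  by_cases hemp : Q ∩ S = ∅
  · rw [hemp]; simp
  obtain ⟨y0, hy0, hy0S⟩ := not_subset.1 hfull
  obtain ⟨y1, hy1, hy1S⟩ := nonempty_iff_ne_empty.2 hemp
  have h0 : ‖x - y0‖ ≤ ε := not_lt.1 hy0S
  have h1 : ε < ‖x - y1‖ := hy1S
  have hQT : Q ∩ {y | ε / 2 < ‖x - y‖ ∧ ‖x - y‖ ≤ 2 * ε} = Q := by
    refine inter_eq_left.2 fun y hy => ⟨?_, ?_⟩
    · linarith [hvar y1 hy1 y hy, hfar y hy]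
    · linarith [hvar y hy y0 hy0, hfar y hy]
  rw [hQT]
  calc _ ≤ ∫⁻ y in Q ∩ S, ‖K (x - y) * b y‖ₑ := enorm_integral_le_lintegral_enorm _
    _ ≤ ∫⁻ y in Q, ‖K (x - y) * b y‖ₑ := lintegral_mono_set inter_subset_left
    _ ≤ ∫⁻ y in Q, (‖K (x - y) - K (x - c)‖ₑ * ‖b y‖ₑ + ‖K (x - c)‖ₑ * ‖b y‖ₑ) := by
        refine lintegral_mono fun y => ?_
        rw [enorm_mul, ← add_mul]
        gcongr
        calc ‖K (x - y)‖ₑ = ‖(K (x - y) - K (x - c)) + K (x - c)‖ₑ := by congr 1; ring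
          _ ≤ _ := enorm_add_le _ _
    _ = (∫⁻ y in Q, ‖K (x - y) - K (x - c)‖ₑ * ‖b y‖ₑ) + ‖K (x - c)‖ₑ * ∫⁻ y in Q, ‖b y‖ₑ := by
        rw [lintegral_add_right' _ (hb.aestronglyMeasurable.enorm.const_mul _),
          lintegral_const_mul' _ _ (by simp)]
    _ ≤ (∫⁻ y in Q, ‖K (x - y) - K (x - c)‖ₑ * ‖b y‖ₑ) + L * ∫⁻ y in Q, ‖K (x - c)‖ₑ := by
        rw [setLIntegral_const]
        refine add_le_add le_rfl ?_
        calc _ ≤ ‖K (x - c)‖ₑ * (L * volume Q) := by gcongr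
          _ = _ := by ring
    _ ≤ (∫⁻ y in Q, ‖K (x - y) - K (x - c)‖ₑ * ‖b y‖ₑ) +
          L * ((∫⁻ y in Q, ‖K (x - y) - K (x - c)‖ₑ) + ∫⁻ y in Q, ‖K (x - y)‖ₑ) := by
        gcongr
        rw [← lintegral_add_left hDm]
        refine lintegral_mono fun y => ?_
        rw [add_comm]
        calc ‖K (x - c)‖ₑ = ‖K (x - y) - (K (x - y) - K (x - c))‖ₑ := by congr 1; ring
          _ ≤ _ := enorm_sub_le
    _ = _ := by
        simp only [mul_add]
        rw [lintegral_add_right _ (hDm.mul_const _), lintegral_mul_const _ hDm]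
        ring

/-- **Weak type (1,1)** of the maximal truncation of a singular integral. -/
theorem exists_volume_exists_truncConv_gt_le [Nontrivial E] (hK : IsCZKernel K A) :
    ∃ C : ℝ≥0, ∀ f : E → ℝ, Integrable f → ∀ s > 0,
      volume {x | ∃ ε > 0, s < |truncConv K ε f x|} ≤ C * (∫⁻ x, ‖f x‖ₑ) / ENNReal.ofReal s := by
  have mK := hK.measurable
  set d := finrank ℝ E
  set β : ℝ := 1 / (200 * (A + 1) * 2 ^ d) with hβ
  have hA0 : (0 : ℝ) ≤ A := A.coe_nonneg
  have hβ0 : 0 < β := by positivity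
  have h2d : (1 : ℝ) ≤ 2 ^ d := one_le_pow₀ (by norm_num)
  have hβe : 200 * (A + 1) * 2 ^ d * β = 1 := by rw [hβ]; field_simp
  have hβA : 200 * (A * β) ≤ 1 := by
    have : 200 * (A * β) * 1 ≤ 200 * ((A + 1) * β) * 2 ^ d := by gcongr; linarith
    nlinarith
  have hβA2 : 6 * (16 * A) ^ 2 * (2 ^ d + 1) * β ^ 2 ≤ (1 / 2) ^ 2 := by
    have h1 : (200 * (A * β) * 2 ^ d) ≤ 1 := by
      rw [← hβe]
      have : 200 * (A * β) * 2 ^ d ≤ 200 * ((A + 1) * β) * 2 ^ d := by gcongr; linarith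
      linarith
    have h2 : (200 * (A * β) * 2 ^ d) ^ 2 ≤ 1 := pow_le_one₀ (by positivity) h1
    have h3 : (2 : ℝ) ^ d + 1 ≤ 2 * (2 ^ d) ^ 2 := by nlinarith
    calc 6 * (16 * A) ^ 2 * (2 ^ d + 1) * β ^ 2 ≤
        6 * (16 * A) ^ 2 * (2 * (2 ^ d) ^ 2) * β ^ 2 := by gcongr
      _ = 3072 / 40000 * (200 * (A * β) * 2 ^ d) ^ 2 := by ring
      _ ≤ 3072 / 40000 * 1 := by gcongr
      _ ≤ _ := by norm_num
  set X1 : ℝ := 5 ^ d * ((16 * A) ^ 2 * β) * 28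
  set X2 : ℝ := 40 ^ d * 5 ^ d * 40 ^ d / β
  set X3 : ℝ := 16 * A * 5 ^ d * 40 ^ d
  refine ⟨(X1 + X2 + X3).toNNReal, fun f hf s hs => ?_⟩
  set G := ∫⁻ x, ‖f x‖ₑ
  have hGt : G ≠ ∞ := hf.2.ne
  have conv : ∀ a q : ℝ, 0 < q → ENNReal.ofReal a * G / ENNReal.ofReal q =
      ENNReal.ofReal (a / q) * G := by
    intro a q hq
    rw [ENNReal.ofReal_div_of_pos hq, ENNReal.mul_div_right_comm]
  set τ : ℝ := β * s / 40 ^ d with hτ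
  have hτ0 : 0 < τ := by positivity
  obtain ⟨u, Q, r, g, hu, hr, hQm, hQs, hQd, hg, hgM, hgG, hb0, hbL, hfg, hU5, hQv⟩ :=
    exists_calderonZygmund_decomposition hf hτ0
  have : Countable u := hu.to_subtype
  have hτM : 40 ^ d * τ = β * s := by rw [hτ]; field_simp
  have hgM' : ∀ x, |g x| ≤ β * s := fun x => hτM ▸ hgM x
  set L : ℝ≥0∞ := ENNReal.ofReal (2 * 40 ^ d * τ)
  have hL : L = ENNReal.ofReal (2 * (β * s)) := by rw [← hτM, ← mul_assoc]
  set b : E → ℝ := fun x => f x - g x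
  have hb : Integrable b := hf.sub hg
  set Us : Set E := ⋃ i : u, closedBall i.1 (5 * r i)
  have hUsm : MeasurableSet Us := MeasurableSet.iUnion fun i => measurableSet_closedBall
  set φ : u → E → ℝ≥0∞ := fun i x => ∫⁻ y in Q i, ‖K (x - y) - K (x - i.1)‖ₑ * (‖b y‖ₑ + L)
  have hφm0 : ∀ i, AEMeasurable (fun p : E × E => ‖K (p.1 - p.2) - K (p.1 - i.1)‖ₑ * (‖b p.2‖ₑ + L))
      (volume.prod (volume.restrict (Q i))) := fun i =>
    AEMeasurable.mul (by fun_prop)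
      ((hb.aestronglyMeasurable.restrict.aemeasurable.enorm.add_const L).comp_snd)
  have hφm : ∀ i, AEMeasurable (φ i) := fun i => (hφm0 i).lintegral_prod_right'
  have hφi : ∀ i, ∫⁻ x in Usᶜ, φ i x ≤ 2 * A * L * volume (Q i) := by
    intro i
    have mS : MeasurableSet {x : E | 5 * r i < ‖x - i.1‖} :=
        measurableSet_lt measurable_const (by fun_prop)
    have hsub : Usᶜ ⊆ {x : E | 5 * r i < ‖x - i.1‖} := fun x hx => by
      have : x ∉ closedBall i.1 (5 * r i) := fun h => hx (mem_iUnion.2 ⟨i, h⟩)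
      rwa [mem_closedBall, dist_eq_norm, not_le] at this
    calc _ ≤ ∫⁻ x in {x : E | 5 * r i < ‖x - i.1‖}, φ i x := lintegral_mono_set hsub
      _ = ∫⁻ y in Q i, ∫⁻ x in {x : E | 5 * r i < ‖x - i.1‖},
          ‖K (x - y) - K (x - i.1)‖ₑ * (‖b y‖ₑ + L) := by
          refine lintegral_lintegral_swap ?_
          refine AEMeasurable.mul (by fun_prop)
            ((hb.aestronglyMeasurable.restrict.aemeasurable.enorm.add_const L).comp_snd)
      _ ≤ ∫⁻ y in Q i, A * (‖b y‖ₑ + L) := by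
          refine setLIntegral_mono' (hQm i) fun y hy => ?_
          rw [lintegral_mul_const _ (by fun_prop)]
          gcongr
          have hy' : ‖y - i.1‖ ≤ r i := by
            have := hQs i hy; rwa [mem_closedBall, dist_eq_norm] at this
          refine le_trans ?_ (hK.hormander (y - i.1))
          rw [← lintegral_indicator mS,
            ← lintegral_indicator (measurableSet_lt measurable_const measurable_norm),
            ← lintegral_add_right_eq_self _ i.1]
          refine lintegral_mono fun x => ?_
          by_cases hx : 5 * r i < ‖x‖
          · rw [indicator_of_mem (show x + i.1 ∈ {x : E | 5 * r i < ‖x - i.1‖} by simpa using hx),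
              indicator_of_mem (show x ∈ {x : E | 2 * ‖y - i.1‖ < ‖x‖} from
                (by linarith [hr i] : 2 * ‖y - i.1‖ < ‖x‖))]
            rw [add_sub_cancel_right, show x + i.1 - y = x - (y - i.1) by abel]
          · rw [indicator_of_notMem (show x + i.1 ∉ {x : E | 5 * r i < ‖x - i.1‖} by simpa using hx)]
            exact zero_le
      _ = A * ((∫⁻ y in Q i, ‖b y‖ₑ) + L * volume (Q i)) := by
          rw [lintegral_const_mul' _ _ (by simp), lintegral_add_right _ measurable_const,
            setLIntegral_const]
      _ ≤ A * (L * volume (Q i) + L * volume (Q i)) := by gcongr; exact hbL i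
      _ = _ := by ring
  set Φ : E → ℝ≥0∞ := fun x => ∑' i, φ i x
  have hΦm : AEMeasurable Φ := AEMeasurable.tsum hφm
  have hΦi : ∫⁻ x in Usᶜ, Φ x ≤ ENNReal.ofReal (4 * A * 5 ^ d * 40 ^ d) * G := by
    calc ∫⁻ x in Usᶜ, Φ x = ∑' i, ∫⁻ x in Usᶜ, φ i x := lintegral_tsum fun i => (hφm i).restrict
      _ ≤ ∑' i, 2 * A * L * volume (Q i) := ENNReal.tsum_le_tsum hφi
      _ = 2 * A * L * ∑' i, volume (Q i) := ENNReal.tsum_mul_left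
      _ ≤ 2 * A * L * (ENNReal.ofReal (5 ^ d) * G / ENNReal.ofReal τ) := by gcongr
      _ = ENNReal.ofReal (2 * A * (2 * (β * s)) * (5 ^ d / τ)) * G := by
          rw [conv _ _ hτ0, hL, ENNReal.ofReal_mul (p := 2 * A * (2 * (β * s))) (by positivity),
            ENNReal.ofReal_mul (p := 2 * A) (by positivity),
            ENNReal.ofReal_mul (p := 2) (q := A) (by positivity),
            ENNReal.ofReal_ofNat, ENNReal.ofReal_coe_nnreal]
          simp only [mul_assoc]
      _ = _ := by
          congr 2
          rw [hτ]; field_simp; ring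
  have hsub : {x | ∃ ε > 0, s < |truncConv K ε f x|} ⊆
      ({x | ∃ ε > 0, s / 2 < |truncConv K ε g x|} ∪ Us) ∪ (Usᶜ ∩ {x | ENNReal.ofReal (s / 4) ≤ Φ x}) := by
    rintro x ⟨ε, hε, hx⟩
    by_cases hxU : x ∈ Us
    · exact .inl (.inr hxU)
    by_cases hxg : s / 2 < |truncConv K ε g x|
    · exact .inl (.inl ⟨ε, hε, hxg⟩)
    refine .inr ⟨hxU, ?_⟩
    set S : Set E := {y | ε < ‖x - y‖}
    have mS : MeasurableSet S := measurableSet_lt_norm_sub _ _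
    have hfi : IntegrableOn (fun y => K (x - y) * f y) S := by
      by_contra h
      rw [truncConv, integral_undef h, abs_zero] at hx
      linarith
    have hgi : IntegrableOn (fun y => K (x - y) * g y) S :=
        hK.integrableOn_truncation_of_bounded hg hgM' hε x
    have hbi : IntegrableOn (fun y => K (x - y) * b y) S := by
      refine (hfi.sub hgi).congr (Eventually.of_forall fun y => ?_)
      simp only [b, Pi.sub_apply]; ring
    have hbe : truncConv K ε f x - truncConv K ε g x = ∫ y in ⋃ i, Q i ∩ S, K (x - y) * b y := by
      rw [truncConv, truncConv, ← integral_sub hfi hgi, ← iUnion_inter]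
      have e1 : ∫ y in S, (K (x - y) * f y - K (x - y) * g y) = ∫ y in S, K (x - y) * b y := by
        congr 1; ext y; simp only [b]; ring
      refine e1.trans (setIntegral_eq_of_subset_of_ae_sdiff_eq_zero mS.nullMeasurableSet inter_subset_right ?_)
      filter_upwards [hfg] with y hy hyS
      have : y ∉ ⋃ i, Q i := fun h => hyS.2 ⟨h, hyS.1⟩
      simp only [b, hy this, sub_self, mul_zero]
    have hsum := hasSum_integral_iUnion (fun i => (hQm i).inter mS)
      (fun i j hij => (hQd hij).mono inter_subset_left inter_subset_left)
      (hbi.mono_set (iUnion_subset fun i => inter_subset_right))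
    set T : Set E := {y | ε / 2 < ‖x - y‖ ∧ ‖x - y‖ ≤ 2 * ε}
    have mT : MeasurableSet T := (measurableSet_lt_norm_sub _ x).inter
      (measurableSet_le (f := fun y => ‖x - y‖) (by fun_prop) measurable_const)
    have hbd : ‖truncConv K ε f x - truncConv K ε g x‖ₑ ≤ Φ x + L * (2 * A) := by
      rw [hbe, ← hsum.tsum_eq]
      calc _ ≤ ∑' i, ‖∫ y in Q i ∩ S, K (x - y) * b y‖ₑ := enorm_tsum_le_tsum_enorm
        _ ≤ ∑' i, (φ i x + L * ∫⁻ y in Q i ∩ T, ‖K (x - y)‖ₑ) := by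
            refine ENNReal.tsum_le_tsum fun i => ?_
            refine hK.enorm_setIntegral_le_of_integral_eq_zero (hr i) (hQs i) hb.integrableOn
              (hb0 i) (hbL i) ?_ (hbi.mono_set inter_subset_right)
            have : x ∉ closedBall i.1 (5 * r i) := fun h => hxU (mem_iUnion.2 ⟨i, h⟩)
            rwa [mem_closedBall, dist_eq_norm, not_le] at this
        _ = Φ x + L * ∫⁻ y in ⋃ i, Q i ∩ T, ‖K (x - y)‖ₑ := by
            rw [ENNReal.tsum_add, ENNReal.tsum_mul_left,
              lintegral_iUnion (fun i => (hQm i).inter mT)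
              (fun i j hij => (hQd hij).mono inter_subset_left inter_subset_left)]
        _ ≤ Φ x + L * (2 * A) := by
            gcongr
            exact (lintegral_mono_set (iUnion_subset fun i => inter_subset_right)).trans
              (hK.lintegral_sub_left_annulus_le x hε)
    have h1 : s / 2 < |truncConv K ε f x - truncConv K ε g x| := by
      have := abs_sub_abs_le_abs_sub (truncConv K ε f x) (truncConv K ε g x)
      linarith
    have h2 : ENNReal.ofReal (s / 4) + ENNReal.ofReal (s / 4) ≤ Φ x + ENNReal.ofReal (s / 4) := by
      rw [← ENNReal.ofReal_add (by positivity) (by positivity)]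
      calc ENNReal.ofReal (s / 4 + s / 4) ≤
          ENNReal.ofReal |truncConv K ε f x - truncConv K ε g x| :=
            ENNReal.ofReal_le_ofReal (by linarith)
        _ = ‖truncConv K ε f x - truncConv K ε g x‖ₑ := by rw [← Real.norm_eq_abs, ofReal_norm]
        _ ≤ _ := hbd
        _ ≤ _ := by
          gcongr
          rw [hL, ← ENNReal.ofReal_coe_nnreal (p := A), show (2 : ℝ≥0∞) = ENNReal.ofReal 2 by simp,
            ← ENNReal.ofReal_mul (by norm_num), ← ENNReal.ofReal_mul (by positivity)]
          refine ENNReal.ofReal_le_ofReal ?_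
          nlinarith
    exact (ENNReal.add_le_add_iff_right (by simp)).1 h2
  have hgood : volume {x | ∃ ε > 0, s / 2 < |truncConv K ε g x|} ≤ ENNReal.ofReal (X1 / s) * G := by
    refine (hK.volume_exists_truncConv_gt_le_of_bounded hg hgM' (half_pos hs) ?_).trans ?_
    · calc 6 * (16 * (A : ℝ)) ^ 2 * (2 ^ d + 1) * (β * s) ^ 2 =
        (6 * (16 * A) ^ 2 * (2 ^ d + 1) * β ^ 2) * s ^ 2 := by ring
        _ ≤ (1 / 2) ^ 2 * s ^ 2 := by gcongr
        _ = _ := by ring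
    · rw [← mul_assoc, ← ENNReal.ofReal_mul (by positivity)]
      calc _ ≤ ENNReal.ofReal (5 ^ finrank ℝ E * ((16 * A) ^ 2 * (β * s))) * G / ENNReal.ofReal ((s / 2) ^ 2 / 7) := by gcongr
        _ = _ := by
          rw [conv _ _ (by positivity)]
          congr 2
          simp only [X1]; field_simp; ring
  have hUs : volume Us ≤ ENNReal.ofReal (X2 / s) * G := by
    refine hU5.trans_eq ?_
    rw [conv _ _ hτ0]
    congr 2
    simp only [X2, hτ]; field_simp; rfl
  have hbad : volume (Usᶜ ∩ {x | ENNReal.ofReal (s / 4) ≤ Φ x}) ≤ ENNReal.ofReal (X3 / s) * G := by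
    have h4 : ENNReal.ofReal (s / 4) ≠ 0 := by rw [Ne, ENNReal.ofReal_eq_zero, not_le]; positivity
    calc _ = (volume.restrict Usᶜ) {x | ENNReal.ofReal (s / 4) ≤ Φ x} := by
          rw [Measure.restrict_apply' hUsm.compl, inter_comm]
      _ ≤ (∫⁻ x in Usᶜ, Φ x) / ENNReal.ofReal (s / 4) :=
          meas_ge_le_lintegral_div hΦm.restrict h4 (by simp)
      _ ≤ ENNReal.ofReal (4 * A * 5 ^ d * 40 ^ d) * G / ENNReal.ofReal (s / 4) := by gcongr
      _ = _ := by
        rw [conv _ _ (by positivity)]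
        congr 2
        simp only [X3]; field_simp; ring
  calc _ ≤ _ := measure_mono hsub
    _ ≤ _ := (measure_union_le _ _).trans (add_le_add_left (measure_union_le _ _) _)
    _ ≤ ENNReal.ofReal (X1 / s) * G + ENNReal.ofReal (X2 / s) * G + ENNReal.ofReal (X3 / s) * G := by gcongr
    _ = ENNReal.ofReal ((X1 + X2 + X3) / s) * G := by
        rw [← add_mul, ← add_mul, ← ENNReal.ofReal_add (by positivity) (by positivity),
          ← ENNReal.ofReal_add (by positivity) (by positivity)]
        congr 2; ring
    _ = _ := (conv _ _ hs).symm

end IsCZKernel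

end WeakType

section PrincipalValue

open Metric Module
open scoped ENNReal NNReal Topology

variable {E : Type*} [NormedAddCommGroup E] [InnerProductSpace ℝ E] [FiniteDimensional ℝ E]
  [MeasurableSpace E] [BorelSpace E]

lemma truncConv_eq_integral_sub (K : E → ℝ) (ε : ℝ) (f : E → ℝ) (x : E) :
    truncConv K ε f x = ∫ z in {z | ε < ‖z‖}, K z * f (x - z) := by
  rw [truncConv, ← integral_indicator (measurableSet_lt_norm_sub _ _),
    ← integral_indicator (measurableSet_lt measurable_const measurable_norm),
    ← integral_sub_left_eq_self ({z | ε < ‖z‖}.indicator fun z => K z * f (x - z)) volume x]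
  congr 1; ext y
  by_cases h : ε < ‖x - y‖
  · rw [indicator_of_mem (show y ∈ {y | ε < ‖x - y‖} from h),
      indicator_of_mem (show x - y ∈ {z | ε < ‖z‖} from h), sub_sub_cancel]
  · rw [indicator_of_notMem (show y ∉ {y | ε < ‖x - y‖} from h),
      indicator_of_notMem (show x - y ∉ {z | ε < ‖z‖} from h)]

namespace IsCZKernel

variable {K : E → ℝ} {A : ℝ≥0}

lemma exists_tendsto_truncConv_of_lipschitz [Nontrivial E] (hK : IsCZKernel K A) {f : E → ℝ}
    (hf : Integrable f) {M : ℝ} (hM : ∀ x, |f x| ≤ M) {L : ℝ≥0} (hL : LipschitzWith L f) (x : E) :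
    ∃ l, Tendsto (fun ε => truncConv K ε f x) (𝓝[>] 0) (𝓝 l) := by
  have mK := hK.measurable
  have mf := hL.continuous.measurable
  set S : Set E := {z | (1 : ℝ) < ‖z‖}
  have h_int : ∀ ε > 0, IntegrableOn (fun z => K z * f (x - z)) {z | ε < ‖z‖} := by
    intro ε hε
    have h := hK.integrableOn_truncation_of_bounded hf hM hε x
    rw [← integrable_indicator_iff (measurableSet_lt_norm_sub _ _)] at h
    rw [← integrable_indicator_iff (measurableSet_lt measurable_const measurable_norm)]
    refine (h.comp_sub_left x).congr (Eventually.of_forall fun z => ?_)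
    dsimp only
    by_cases hz : ε < ‖z‖
    · rw [indicator_of_mem (show z ∈ {z | ε < ‖z‖} from hz),
        indicator_of_mem (show x - z ∈ {y | ε < ‖x - y‖} by simpa using hz), sub_sub_cancel]
    · rw [indicator_of_notMem (show z ∉ {z | ε < ‖z‖} from hz),
        indicator_of_notMem (show x - z ∉ {y | ε < ‖x - y‖} by simpa using hz)]
  have hsplit : ∀ ε ∈ Ioo (0 : ℝ) 1, truncConv K ε f x = truncConv K 1 f x +
      ∫ z, (annulus E ε 1).indicator (fun z => K z * (f (x - z) - f x)) z := by
    rintro ε ⟨h0, h1⟩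
    have hA : {z : E | ε < ‖z‖} = S ∪ annulus E ε 1 := by
      ext z
      simp only [S, annulus, mem_union, mem_ofPred_eq]
      constructor
      · intro h
        rcases lt_or_ge 1 ‖z‖ with h' | h'
        · exact .inl h'
        · exact .inr ⟨h, h'⟩
      · rintro (h | h)
        · exact h1.trans h
        · exact h.1
    have hd : Disjoint S (annulus E ε 1) := disjoint_left.2 fun z hz hz' => not_lt.2 hz'.2 hz
    have hiA : IntegrableOn (fun z => K z * f (x - z)) (annulus E ε 1) :=
        (h_int ε h0).mono_set fun z hz => hz.1
    rw [truncConv_eq_integral_sub, truncConv_eq_integral_sub, hA,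
      setIntegral_union hd (measurableSet_annulus _ _) (h_int 1 one_pos) hiA,
      integral_indicator (measurableSet_annulus _ _)]
    congr 1
    simp only [mul_sub]
    rw [integral_sub hiA ((hK.integrableOn_annulus h0 1).mul_const _), integral_mul_const,
      hK.cancel ε h0 1, zero_mul, sub_zero]
  set F : E → ℝ := {z : E | 0 < ‖z‖ ∧ ‖z‖ ≤ 1}.indicator fun z => K z * (f (x - z) - f x)
  have hlim : Tendsto (fun ε => ∫ z, (annulus E ε 1).indicator (fun z => K z * (f (x - z) - f x)) z)
      (𝓝[>] 0) (𝓝 (∫ z, F z)) := by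
    refine tendsto_integral_filter_of_dominated_convergence
      ((closedBall 0 1).indicator fun z => L * (‖z‖ * ‖K z‖)) ?_ ?_ ?_ ?_
    · refine Eventually.of_forall fun ε => Measurable.aestronglyMeasurable ?_
      exact Measurable.indicator (by fun_prop) (measurableSet_annulus _ _)
    · filter_upwards [self_mem_nhdsWithin] with ε hε
      refine Eventually.of_forall fun z => ?_
      by_cases hz : z ∈ annulus E ε 1
      · rw [indicator_of_mem hz, indicator_of_mem (by simpa using hz.2), norm_mul]
        have := hL.dist_le_mul (x - z) x
        rw [dist_eq_norm, dist_eq_norm, sub_sub_cancel_left, norm_neg] at this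
        calc _ ≤ ‖K z‖ * (L * ‖z‖) := by gcongr
          _ = _ := by ring
      · rw [indicator_of_notMem hz, norm_zero]
        exact indicator_nonneg (fun z _ => by positivity) z
    · rw [integrable_indicator_iff measurableSet_closedBall]
      refine Integrable.const_mul ⟨by fun_prop, ?_⟩ _
      rw [HasFiniteIntegral]
      simp only [enorm_mul, enorm_norm]
      exact (hK.lintegral_norm_mul_le one_pos).trans_lt (ENNReal.mul_lt_top (by simp) (by simp))
    · refine Eventually.of_forall fun z => ?_
      rcases eq_or_ne z 0 with rfl | hz
      · refine tendsto_const_nhds.congr' ?_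
        filter_upwards [self_mem_nhdsWithin] with ε hε
        simp only [F]
        rw [indicator_of_notMem, indicator_of_notMem]
        · rintro ⟨h, _⟩
          simp only [norm_zero] at h
          exact absurd h (not_lt.2 (le_of_lt hε))
        · rintro ⟨h, _⟩; simp at h
      · refine tendsto_const_nhds.congr' ?_
        have : Iio ‖z‖ ∈ 𝓝[>] (0 : ℝ) :=
            mem_nhdsWithin_of_mem_nhds (Iio_mem_nhds (norm_pos_iff.2 hz))
        filter_upwards [this] with ε hε
        have e : z ∈ annulus E ε 1 ↔ z ∈ {z : E | 0 < ‖z‖ ∧ ‖z‖ ≤ 1} :=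
          ⟨fun h => ⟨norm_pos_iff.2 hz, h.2⟩, fun h => ⟨hε, h.2⟩⟩
        by_cases h : z ∈ annulus E ε 1
        · simp only [F]
          rw [indicator_of_mem h, indicator_of_mem (e.1 h)]
        · simp only [F]
          rw [indicator_of_notMem h, indicator_of_notMem (fun h' => h (e.2 h'))]
  refine ⟨truncConv K 1 f x + ∫ z, F z, (hlim.const_add _).congr' ?_⟩
  filter_upwards [Ioo_mem_nhdsGT one_pos] with ε hε using (hsplit ε hε).symm

/-- The truncations of a singular integral of an integrable function converge almost everywhere. -/
theorem ae_exists_tendsto_truncConv [Nontrivial E] (hK : IsCZKernel K A) {f : E → ℝ}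
    (hf : Integrable f) :
    ∀ᵐ x, ∃ l, Tendsto (fun ε => truncConv K ε f x) (𝓝[>] 0) (𝓝 l) := by
  obtain ⟨C, hC⟩ := hK.exists_volume_exists_truncConv_gt_le
  have hD : ∀ s > 0, ∀ᵐ x, ∃ η > 0, ∀ ε ∈ Ioo 0 η, ∀ ε' ∈ Ioo 0 η,
      |truncConv K ε f x - truncConv K ε' f x| ≤ 3 * s := by
    intro s hs
    rw [ae_iff]
    refine le_antisymm (ENNReal.le_of_forall_pos_le_add fun κ hκ _ => ?_) zero_le
    rw [zero_add]
    have hκ' : 0 < κ * s / (C + 1) := by positivity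
    obtain ⟨h, hhc, hh, hhn⟩ :=
        (memLp_one_iff_integrable.2 hf).exist_eLpNorm_sub_le (by simp) le_rfl hκ'
    have hhi : Integrable h := hh.continuous.integrable_of_hasCompactSupport hhc
    obtain ⟨L, hL⟩ := ContDiff.lipschitzWith_of_hasCompactSupport hhc hh (by simp)
    obtain ⟨M, hM⟩ := hhc.exists_bound_of_continuous hh.continuous
    have hg : Integrable (f - h) := hf.sub hhi
    have hnull := (ae_iff.1 ((hK.ae_integrableOn_truncation hf).and (hK.ae_integrableOn_truncation hhi)))
    have hsub : {x | ¬ ∃ η > 0, ∀ ε ∈ Ioo 0 η, ∀ ε' ∈ Ioo 0 η,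
        |truncConv K ε f x - truncConv K ε' f x| ≤ 3 * s} ⊆
        {x | ∃ ε > 0, s < |truncConv K ε (f - h) x|} ∪
        {x | ¬ ((∀ ε > 0, IntegrableOn (fun y => K (x - y) * f y) {y | ε < ‖x - y‖}) ∧
          ∀ ε > 0, IntegrableOn (fun y => K (x - y) * h y) {y | ε < ‖x - y‖})} := by
      intro x hx
      by_contra hcon
      simp only [mem_union, mem_ofPred_eq, not_or, not_not] at hcon
      obtain ⟨h1, h2, h3⟩ := hcon
      push Not at h1
      apply hx
      obtain ⟨l, hl⟩ := hK.exists_tendsto_truncConv_of_lipschitz hhi hM hL x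
      have hl' := (Metric.tendsto_nhds.1 hl (s / 2) (by positivity))
      obtain ⟨η, hη, hηs⟩ := (mem_nhdsGT_iff_exists_Ioo_subset).1 hl'
      refine ⟨η, hη, fun ε hε ε' hε' => ?_⟩
      have hlin : ∀ ε > 0, truncConv K ε (f - h) x = truncConv K ε f x - truncConv K ε h x := by
        intro ε hε
        rw [truncConv, truncConv, truncConv, ← integral_sub (h2 ε hε) (h3 ε hε)]
        simp only [Pi.sub_apply, mul_sub]
      have a1 := h1 ε hε.1
      have a2 := h1 ε' hε'.1
      rw [hlin ε hε.1] at a1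
      rw [hlin ε' hε'.1] at a2
      have b1 := hηs hε
      have b2 := hηs hε'
      simp only [mem_ofPred_eq, Real.dist_eq] at b1 b2
      rw [abs_le] at a1 a2 ⊢
      rw [abs_lt] at b1 b2
      constructor <;> linarith
    have hn1 : ∫⁻ x, ‖(f - h) x‖ₑ ≤ ENNReal.ofReal (κ * s / (C + 1)) := by
      rwa [eLpNorm_one_eq_lintegral_enorm] at hhn
    calc _ ≤ _ := measure_mono hsub
      _ ≤ _ := measure_union_le _ _
      _ ≤ C * ENNReal.ofReal (κ * s / (C + 1)) / ENNReal.ofReal s + 0 := by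
        refine add_le_add ((hC _ hg s hs).trans (by gcongr)) hnull.le
      _ ≤ κ := by
        rw [add_zero, ← ENNReal.ofReal_coe_nnreal (p := C), ← ENNReal.ofReal_mul (by positivity),
          ← ENNReal.ofReal_div_of_pos hs, ← ENNReal.ofReal_coe_nnreal (p := κ)]
        refine ENNReal.ofReal_le_ofReal ?_
        rw [div_le_iff₀ hs, mul_div_assoc', div_le_iff₀ (by positivity)]
        nlinarith [mul_pos (NNReal.coe_pos.2 hκ) hs]
  have hall : ∀ᵐ x, ∀ k : ℕ, ∃ η > 0, ∀ ε ∈ Ioo 0 η, ∀ ε' ∈ Ioo 0 η,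
      |truncConv K ε f x - truncConv K ε' f x| ≤ 3 * (1 / ((k : ℝ) + 1)) :=
    ae_all_iff.2 fun k => hD _ (by positivity)
  filter_upwards [hall] with x hx
  refine cauchy_map_iff_exists_tendsto.1 (Metric.cauchy_iff.2 ⟨inferInstance, fun e he => ?_⟩)
  obtain ⟨k, hk⟩ := exists_nat_one_div_lt (show 0 < e / 3 by positivity)
  obtain ⟨η, hη, h⟩ := hx k
  refine ⟨_, image_mem_map (Ioo_mem_nhdsGT hη), ?_⟩
  rintro _ ⟨ε, hε, rfl⟩ _ ⟨ε', hε', rfl⟩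
  rw [Real.dist_eq]
  linarith [h ε hε ε' hε']

end IsCZKernel

end PrincipalValue

section LimitingBehaviour

open Metric Module
open scoped ENNReal NNReal Topology

variable {E : Type*} [NormedAddCommGroup E] [InnerProductSpace ℝ E] [FiniteDimensional ℝ E]
  [MeasurableSpace E] [BorelSpace E]

/-- The principal value of the convolution of `f` with `K`. -/
def pvConv (K f : E → ℝ) (x : E) : ℝ := limUnder (𝓝[>] 0) fun ε => truncConv K ε f x

omit [NormedAddCommGroup E] [InnerProductSpace ℝ E] [FiniteDimensional ℝ E] [BorelSpace E] in
lemma tendsto_mul_measure_gt_zero {μ : Measure E} {e : E → ℝ≥0∞} (he : Measurable e)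
    (hi : ∫⁻ x, e x ∂μ ≠ ∞)
    {δ : ℝ} (hδ : 0 < δ) :
    Tendsto (fun s : ℝ => ENNReal.ofReal s * μ {x | ENNReal.ofReal (δ * s) < e x}) (𝓝[>] 0) (𝓝 0) := by
  have hδ' : ENNReal.ofReal δ ≠ 0 := by simpa using hδ
  have h0 : Tendsto (fun s : ℝ => ENNReal.ofReal s) (𝓝[>] 0) (𝓝 0) := by
    have : Tendsto (fun s : ℝ => ENNReal.ofReal s) (𝓝 0) (𝓝 (ENNReal.ofReal 0)) :=
      ENNReal.continuous_ofReal.tendsto 0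
    rw [ENNReal.ofReal_zero] at this
    exact this.mono_left nhdsWithin_le_nhds
  have hnm : ∀ s : ℝ, MeasurableSet {x | ENNReal.ofReal (δ * s) < e x} := fun s =>
    measurableSet_lt measurable_const he
  have key : Tendsto (fun s : ℝ => ∫⁻ x, {x | ENNReal.ofReal (δ * s) < e x}.indicator
      (fun _ => ENNReal.ofReal s) x ∂μ) (𝓝[>] 0) (𝓝 (∫⁻ _, 0 ∂μ)) := by
    refine tendsto_lintegral_filter_of_dominated_convergence (fun x => e x / ENNReal.ofReal δ) ?_ ?_ ?_ ?_
    · exact Eventually.of_forall fun s => measurable_const.indicator (hnm s)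
    · filter_upwards [self_mem_nhdsWithin] with s hs
      refine Eventually.of_forall fun x => ?_
      by_cases hx : x ∈ {x | ENNReal.ofReal (δ * s) < e x}
      swap
      · rw [indicator_of_notMem hx]; exact zero_le
      rw [indicator_of_mem hx]
      rw [ENNReal.le_div_iff_mul_le (.inl hδ') (.inl (by simp)), mul_comm,
        ← ENNReal.ofReal_mul hδ.le]
      exact le_of_lt hx
    · simp only [div_eq_mul_inv]
      rw [lintegral_mul_const' _ _ (by simpa using hδ')]
      exact ENNReal.mul_ne_top hi (by simpa using hδ')
    · refine Eventually.of_forall fun x => ?_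
      refine tendsto_of_tendsto_of_tendsto_of_le_of_le tendsto_const_nhds h0 (fun _ => zero_le) fun s => ?_
      exact indicator_le_self' (fun _ _ => zero_le) x
  rw [lintegral_zero] at key
  refine key.congr fun s => ?_
  rw [lintegral_indicator_const (hnm s)]

omit [InnerProductSpace ℝ E] [FiniteDimensional ℝ E] in
lemma _root_.MeasureTheory.Integrable.exists_lintegral_enorm_indicator_lt_norm_le {f : E → ℝ}
    {μ : Measure E}
    (hf : Integrable f μ) {κ : ℝ} (hκ : 0 < κ) :
    ∃ R > 0, ∫⁻ x, ‖({x | R < ‖x‖}.indicator f) x‖ₑ ∂μ ≤ ENNReal.ofReal κ := by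
  have mR : ∀ n : ℕ, MeasurableSet {x : E | (n : ℝ) < ‖x‖} := fun n =>
    measurableSet_lt measurable_const measurable_norm
  set ν := μ.withDensity fun x => ‖f x‖ₑ
  have : IsFiniteMeasure ν := isFiniteMeasure_withDensity hf.2.ne
  have h := tendsto_measure_iInter_atTop (μ := ν) (s := fun n : ℕ => {x : E | (n : ℝ) < ‖x‖})
    (fun n => (mR n).nullMeasurableSet) (fun m n hmn x (hx : (n : ℝ) < ‖x‖) =>
      show (m : ℝ) < ‖x‖ from lt_of_le_of_lt (by exact_mod_cast hmn) hx) ⟨0, measure_ne_top _ _⟩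
  have he : ⋂ n : ℕ, {x : E | (n : ℝ) < ‖x‖} = ∅ := by
    refine eq_empty_of_forall_notMem fun x hx => ?_
    obtain ⟨n, hn⟩ := exists_nat_ge ‖x‖
    exact not_lt.2 hn (mem_iInter.1 hx n)
  rw [he, measure_empty] at h
  obtain ⟨n, h1, h2⟩ := ((h.eventually_lt_const (show 0 < ENNReal.ofReal κ by simpa using hκ)).and
    (eventually_gt_atTop 0)).exists
  refine ⟨n, by exact_mod_cast h2, ?_⟩
  rw [Function.comp_apply, withDensity_apply _ (mR n)] at h1
  simp only [enorm_indicator_eq_indicator_enorm]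
  rw [lintegral_indicator (mR n)]
  exact h1.le

namespace IsCZKernel

variable {K : E → ℝ} {A : ℝ≥0}

lemma tendsto_pvConv [Nontrivial E] (hK : IsCZKernel K A) {f : E → ℝ} (hf : Integrable f) :
    ∀ᵐ x, Tendsto (fun ε => truncConv K ε f x) (𝓝[>] 0) (𝓝 (pvConv K f x)) := by
  filter_upwards [hK.ae_exists_tendsto_truncConv hf] with x hx using tendsto_nhds_limUnder hx

lemma pvConv_add [Nontrivial E] (hK : IsCZKernel K A) {f g : E → ℝ} (hf : Integrable f)
    (hg : Integrable g) :
    ∀ᵐ x, pvConv K (f + g) x = pvConv K f x + pvConv K g x := by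
  filter_upwards [hK.tendsto_pvConv hf, hK.tendsto_pvConv hg, hK.tendsto_pvConv (hf.add hg),
    hK.ae_integrableOn_truncation hf, hK.ae_integrableOn_truncation hg] with x h1 h2 h3 h4 h5
  refine tendsto_nhds_unique h3 ((h1.add h2).congr' ?_)
  filter_upwards [self_mem_nhdsWithin] with ε hε
  rw [truncConv, truncConv, truncConv, ← integral_add (h4 ε hε) (h5 ε hε)]
  simp only [Pi.add_apply, mul_add]

lemma exists_volume_pvConv_gt_le [Nontrivial E] (hK : IsCZKernel K A) :
    ∃ C : ℝ≥0, ∀ f : E → ℝ, Integrable f → ∀ s > 0,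
      volume {x | s < |pvConv K f x|} ≤ C * (∫⁻ x, ‖f x‖ₑ) / ENNReal.ofReal s := by
  obtain ⟨C, hC⟩ := hK.exists_volume_exists_truncConv_gt_le
  refine ⟨C, fun f hf s hs => (measure_mono_ae ?_).trans (hC f hf s hs)⟩
  filter_upwards [hK.tendsto_pvConv hf] with x hx h
  have h1 := (hx.abs.eventually_const_lt h).and self_mem_nhdsWithin
  obtain ⟨ε, h2, h3⟩ := h1.exists
  exact ⟨ε, h3, h2⟩

/-- Away from the support of `f`, the singular integral of `f` is `K` times the integral of `f`
up to an integrable error. -/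
lemma exists_enorm_pvConv_sub_le [Nontrivial E] (hK : IsCZKernel K A) {f : E → ℝ}
    (hf : Integrable f) {R : ℝ}
    (hR : 0 < R) (hfR : ∀ x, R < ‖x‖ → f x = 0) :
    ∃ e : E → ℝ≥0∞, Measurable e ∧ ∫⁻ x, e x ≠ ∞ ∧
      ∀ᵐ x, 2 * R < ‖x‖ → ‖pvConv K f x - K x * ∫ y, f y‖ₑ ≤ e x := by
  have mK := hK.measurable
  have hfm := hf.aestronglyMeasurable.aemeasurable.enorm
  have mS : MeasurableSet {x : E | 2 * R < ‖x‖} := measurableSet_lt measurable_const measurable_norm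
  have hpm : AEMeasurable (fun p : E × E => ‖K (p.1 - p.2) - K p.1‖ₑ * ‖f p.2‖ₑ) (volume.prod volume) :=
    AEMeasurable.mul (by fun_prop) hfm.comp_snd
  suffices h : ∃ e : E → ℝ≥0∞, AEMeasurable e ∧ ∫⁻ x, e x ≠ ∞ ∧
      ∀ᵐ x, 2 * R < ‖x‖ → ‖pvConv K f x - K x * ∫ y, f y‖ₑ ≤ e x by
    obtain ⟨e, h1, h2, h3⟩ := h
    refine ⟨h1.mk e, h1.measurable_mk, by rwa [← lintegral_congr_ae h1.ae_eq_mk], ?_⟩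
    filter_upwards [h3, h1.ae_eq_mk] with x hx he
    rwa [← he]
  refine ⟨{x : E | 2 * R < ‖x‖}.indicator fun x => ∫⁻ y, ‖K (x - y) - K x‖ₑ * ‖f y‖ₑ, ?_, ?_, ?_⟩
  · exact hpm.lintegral_prod_right'.indicator mS
  · rw [lintegral_indicator mS]
    refine ne_top_of_le_ne_top (b := A * ∫⁻ y, ‖f y‖ₑ) (ENNReal.mul_ne_top (by simp) hf.2.ne) ?_
    calc _ = ∫⁻ y, ∫⁻ x in {x : E | 2 * R < ‖x‖}, ‖K (x - y) - K x‖ₑ * ‖f y‖ₑ := by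
          refine lintegral_lintegral_swap ?_
          exact AEMeasurable.mul (by fun_prop) hfm.comp_snd
      _ ≤ ∫⁻ y, A * ‖f y‖ₑ := by
          refine lintegral_mono fun y => ?_
          rcases lt_or_ge R ‖y‖ with h | h
          · simp [hfR y h]
          · rw [lintegral_mul_const' _ _ (by simp)]
            gcongr
            refine (lintegral_mono_set ?_).trans (hK.hormander y)
            exact fun x (hx : 2 * R < ‖x‖) => (by linarith : 2 * ‖y‖ < ‖x‖)
      _ = _ := lintegral_const_mul' _ _ (by simp)
  · filter_upwards [hK.tendsto_pvConv hf, hK.ae_integrableOn_truncation hf] with x h1 h2 hx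
    rw [indicator_of_mem (show x ∈ {x : E | 2 * R < ‖x‖} from hx)]
    have hsupp : ∀ ε < R, ∀ y, y ∉ {y | ε < ‖x - y‖} → f y = 0 := by
      intro ε hε y hy
      refine hfR y ?_
      simp only [mem_ofPred_eq, not_lt] at hy
      have := norm_sub_norm_le x y
      linarith
    have hi : Integrable fun y => K (x - y) * f y := by
      refine (integrableOn_iff_integrable_of_support_subset ?_).1 (h2 (R / 2) (by positivity))
      intro y hy
      by_contra hc
      exact hy (by simp [hsupp _ (by linarith) y hc])
    have hpv : pvConv K f x = ∫ y, K (x - y) * f y := by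
      refine tendsto_nhds_unique h1 (tendsto_const_nhds.congr' ?_)
      filter_upwards [Ioo_mem_nhdsGT hR] with ε hε
      refine (setIntegral_eq_integral_of_forall_compl_eq_zero fun y hy => ?_).symm
      rw [hsupp _ hε.2 y hy, mul_zero]
    rw [hpv, ← integral_const_mul, ← integral_sub hi (hf.const_mul _)]
    refine (enorm_integral_le_lintegral_enorm _).trans_eq ?_
    congr 1; ext y
    rw [← sub_mul, enorm_mul]

/-- The limiting weak-type behaviour of a singular integral at small heights. -/
theorem tendsto_mul_volume_pvConv_gt [Nontrivial E] (hK : IsCZKernel K A) {W : ℝ≥0∞} (hW : W ≠ ∞)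
    (hKW : ∀ a > 0, volume {x | a < |K x|} = W / ENNReal.ofReal a) {f : E → ℝ} (hf : Integrable f) :
    Tendsto (fun s : ℝ => ENNReal.ofReal s * volume {x | s < |pvConv K f x|}) (𝓝[>] 0)
      (𝓝 (W * ENNReal.ofReal |∫ x, f x|)) := by
  obtain ⟨C, hC⟩ := hK.exists_volume_pvConv_gt_le
  set m := ∫ x, f x
  have hKm : ∀ m' c s : ℝ, 0 < c → 0 < s → ENNReal.ofReal s * volume {x | c * s < |K x * m'|} =
      W * ENNReal.ofReal (|m'| / c) := by
    intro m' c s hc hs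
    rcases eq_or_ne m' 0 with rfl | hm
    · have : {x : E | c * s < |K x * 0|} = ∅ := by
        ext x; simp only [mul_zero, abs_zero, mem_ofPred_eq, mem_empty_iff_false, iff_false,
            not_lt]; positivity
      rw [this]; simp
    · have hm' : 0 < |m'| := abs_pos.2 hm
      have : {x : E | c * s < |K x * m'|} = {x | c * s / |m'| < |K x|} := by
        ext x; simp only [abs_mul, mem_ofPred_eq, div_lt_iff₀ hm']
      rw [this, hKW _ (by positivity), div_eq_mul_inv, ← ENNReal.ofReal_inv_of_pos (by positivity),
        mul_left_comm, ← ENNReal.ofReal_mul hs.le]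
      congr 2
      field_simp
  have key : ∀ δ ∈ Ioo (0 : ℝ) (1 / 2),
      (∀ᶠ s in 𝓝[>] (0 : ℝ), ENNReal.ofReal s * volume {x | s < |pvConv K f x|} ≤
        W * ENNReal.ofReal ((|m| + δ ^ 2) / (1 - 2 * δ)) + (2 + C) * ENNReal.ofReal δ) ∧
      ∀ᶠ s in 𝓝[>] (0 : ℝ), W * ENNReal.ofReal ((|m| - δ ^ 2) / (1 + 2 * δ)) ≤
        ENNReal.ofReal s * volume {x | s < |pvConv K f x|} + (2 + C) * ENNReal.ofReal δ := by
    rintro δ ⟨hδ, hδ2⟩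
    obtain ⟨R, hR, hRf⟩ : ∃ R > 0, ∫⁻ x, ‖({x | R < ‖x‖}.indicator f) x‖ₑ ≤
        ENNReal.ofReal (δ ^ 2) :=
      hf.exists_lintegral_enorm_indicator_lt_norm_le (by positivity)
    have mR : MeasurableSet {x : E | R < ‖x‖} := measurableSet_lt measurable_const measurable_norm
    set f2 := {x | R < ‖x‖}.indicator f
    set f1 := {x | R < ‖x‖}ᶜ.indicator f
    have hf2 : Integrable f2 := hf.indicator mR
    have hf1 : Integrable f1 := hf.indicator mR.compl
    have hf12 : f1 + f2 = f := indicator_compl_add_self _ _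
    set m1 := ∫ x, f1 x
    have hm1 : |m1 - m| ≤ δ ^ 2 := by
      have : m = m1 + ∫ x, f2 x := by
        rw [← integral_add hf1 hf2]
        exact congrArg (fun g : E → ℝ => ∫ x, g x) hf12.symm
      rw [this, sub_add_cancel_left, abs_neg]
      have h := enorm_integral_le_lintegral_enorm (μ := volume) f2
      rw [← ofReal_norm] at h
      exact (ENNReal.ofReal_le_ofReal_iff (by positivity)).1 (h.trans hRf)
    have hm1u : |m1| ≤ |m| + δ ^ 2 := by have := abs_sub_abs_le_abs_sub m1 m; linarith
    have hm1l : |m| - δ ^ 2 ≤ |m1| := by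
      have := abs_sub_abs_le_abs_sub m m1; rw [abs_sub_comm] at this; linarith
    obtain ⟨e, hem, hei, hee⟩ := hK.exists_enorm_pvConv_sub_le hf1 hR fun x hx =>
      indicator_of_notMem (show x ∉ {x | R < ‖x‖}ᶜ from fun h => h hx) f
    have hadd := hK.pvConv_add hf1 hf2
    rw [hf12] at hadd
    have t1 : ∀ᶠ s in 𝓝[>] (0 : ℝ), ENNReal.ofReal s * volume {x | ENNReal.ofReal (δ * s) < e x} ≤
        ENNReal.ofReal δ :=
      ((tendsto_mul_measure_gt_zero hem hei hδ).eventually_lt_const (by simpa using hδ)).mono fun _ h => h.le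
    have t2 : ∀ᶠ s in 𝓝[>] (0 : ℝ), ENNReal.ofReal s * volume (closedBall (0 : E) (2 * R)) ≤
        ENNReal.ofReal δ := by
      have : Tendsto (fun s : ℝ => ENNReal.ofReal s * volume (closedBall (0 : E) (2 * R))) (𝓝[>] 0) (𝓝 0) := by
        have h : Tendsto (fun s : ℝ => ENNReal.ofReal s) (𝓝 0) (𝓝 (ENNReal.ofReal 0)) :=
          ENNReal.continuous_ofReal.tendsto 0
        have h' := ENNReal.Tendsto.mul_const (h.mono_left (nhdsWithin_le_nhds (s := Ioi 0)))
          (.inr (measure_closedBall_lt_top (μ := volume) (x := (0 : E)) (r := 2 * R)).ne)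
        simpa using h'
      exact (this.eventually_lt_const (by simpa using hδ)).mono fun _ h => h.le
    have t3 : ∀ s > 0, ENNReal.ofReal s * volume {x | δ * s < |pvConv K f2 x|} ≤
        C * ENNReal.ofReal δ := by
      intro s hs
      calc _ ≤ ENNReal.ofReal s * (C * ENNReal.ofReal (δ ^ 2) / ENNReal.ofReal (δ * s)) := by
            gcongr
            exact (hC f2 hf2 _ (by positivity)).trans (by gcongr)
        _ = _ := by
          rw [mul_div_assoc, ← ENNReal.ofReal_div_of_pos (by positivity), mul_left_comm,
            ← ENNReal.ofReal_mul hs.le]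
          congr 2; field_simp
    set B : ℝ → Set E := fun s => (closedBall (0 : E) (2 * R) ∪ {x | ENNReal.ofReal (δ * s) < e x}) ∪
      {x | δ * s < |pvConv K f2 x|}
    have tB : ∀ᶠ s in 𝓝[>] (0 : ℝ), ENNReal.ofReal s * volume (B s) ≤
        (2 + C) * ENNReal.ofReal δ := by
      filter_upwards [t1, t2, self_mem_nhdsWithin] with s h1 h2 h3
      calc _ ≤ ENNReal.ofReal s * ((volume (closedBall (0 : E) (2 * R)) + volume {x | ENNReal.ofReal (δ * s) < e x}) +
            volume {x | δ * s < |pvConv K f2 x|}) := by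
              gcongr
              exact (measure_union_le _ _).trans (add_le_add (measure_union_le _ _) le_rfl)
        _ ≤ (ENNReal.ofReal δ + ENNReal.ofReal δ) + C * ENNReal.ofReal δ := by
            rw [mul_add, mul_add]; exact add_le_add (add_le_add h2 h1) (t3 s h3)
        _ = _ := by ring
    have hclose : ∀ s > 0, ∀ᵐ x, x ∉ B s → |pvConv K f x - K x * m1| ≤ 2 * δ * s := by
      intro s hs
      filter_upwards [hadd, hee] with x h1 h2 hx
      simp only [B, mem_union, mem_ofPred_eq, not_or, not_lt, mem_closedBall, dist_zero_right,
        not_le] at hx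
      have h3 := (h2 hx.1.1).trans hx.1.2
      rw [← ofReal_norm, ENNReal.ofReal_le_ofReal_iff (by positivity), Real.norm_eq_abs] at h3
      rw [h1]
      calc _ = |(pvConv K f1 x - K x * m1) + pvConv K f2 x| := by congr 1; ring
        _ ≤ _ := abs_add_le _ _
        _ ≤ δ * s + δ * s := add_le_add h3 hx.2
        _ = _ := by ring
    constructor
    · filter_upwards [tB, self_mem_nhdsWithin] with s hB hs
      have hs' : 0 < s := hs
      have hsub : volume {x | s < |pvConv K f x|} ≤
          volume ({x | (1 - 2 * δ) * s < |K x * m1|} ∪ B s) := by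
        refine measure_mono_ae ?_
        filter_upwards [hclose s hs] with x hx h
        by_cases hxB : x ∈ B s
        · exact .inr hxB
        · left
          have h' : s < |pvConv K f x| := h
          have := hx hxB
          have h2 := abs_sub_abs_le_abs_sub (pvConv K f x) (K x * m1)
          show (1 - 2 * δ) * s < |K x * m1|
          linarith
      calc _ ≤ ENNReal.ofReal s * (volume {x | (1 - 2 * δ) * s < |K x * m1|} + volume (B s)) := by
            gcongr; exact hsub.trans (measure_union_le _ _)
        _ ≤ W * ENNReal.ofReal (|m1| / (1 - 2 * δ)) + (2 + C) * ENNReal.ofReal δ := by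
            rw [mul_add, hKm _ _ _ (by linarith) hs']; exact add_le_add le_rfl hB
        _ ≤ _ := by
          have : 0 < 1 - 2 * δ := by linarith
          gcongr
    · filter_upwards [tB, self_mem_nhdsWithin] with s hB hs
      have hs' : 0 < s := hs
      have hsub : volume {x | (1 + 2 * δ) * s < |K x * m1|} ≤
          volume ({x | s < |pvConv K f x|} ∪ B s) := by
        refine measure_mono_ae ?_
        filter_upwards [hclose s hs] with x hx h
        by_cases hxB : x ∈ B s
        · exact .inr hxB
        · left
          have h' : (1 + 2 * δ) * s < |K x * m1| := h
          have := hx hxB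
          rw [abs_sub_comm] at this
          have h2 := abs_sub_abs_le_abs_sub (K x * m1) (pvConv K f x)
          show s < |pvConv K f x|
          linarith
      calc _ ≤ W * ENNReal.ofReal (|m1| / (1 + 2 * δ)) := by gcongr
        _ = ENNReal.ofReal s * volume {x | (1 + 2 * δ) * s < |K x * m1|} :=
            (hKm _ _ _ (by linarith) hs').symm
        _ ≤ ENNReal.ofReal s * (volume {x | s < |pvConv K f x|} + volume (B s)) := by
            gcongr; exact hsub.trans (measure_union_le _ _)
        _ ≤ _ := by rw [mul_add]; exact add_le_add le_rfl hB
  have hd0 : Ioo (0 : ℝ) (1 / 2) ∈ 𝓝[>] (0 : ℝ) := Ioo_mem_nhdsGT (by norm_num)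
  have l0 : Tendsto (fun δ : ℝ => (2 + C) * ENNReal.ofReal δ) (𝓝[>] 0) (𝓝 0) := by
    have h : Tendsto (fun s : ℝ => ENNReal.ofReal s) (𝓝 0) (𝓝 (ENNReal.ofReal 0)) :=
      ENNReal.continuous_ofReal.tendsto 0
    have h' := ENNReal.Tendsto.const_mul (a := 2 + C) (h.mono_left (nhdsWithin_le_nhds (s := Ioi 0)))
      (.inr (by finiteness))
    simpa using h'
  have l1 : ∀ g : ℝ → ℝ, ContinuousAt g 0 → g 0 = |m| →
      Tendsto (fun δ : ℝ => W * ENNReal.ofReal (g δ)) (𝓝[>] 0) (𝓝 (W * ENNReal.ofReal |m|)) := by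
    intro g hg h0
    refine ENNReal.Tendsto.const_mul (ENNReal.tendsto_ofReal ?_) (.inr hW)
    rw [← h0]
    exact hg.tendsto.mono_left nhdsWithin_le_nhds
  have lu := l1 (fun δ => (|m| + δ ^ 2) / (1 - 2 * δ)) (by
    refine ContinuousAt.div (by fun_prop) (by fun_prop) (by norm_num)) (by norm_num)
  have ll := l1 (fun δ => (|m| - δ ^ 2) / (1 + 2 * δ)) (by
    refine ContinuousAt.div (by fun_prop) (by fun_prop) (by norm_num)) (by norm_num)
  refine tendsto_order.2 ⟨fun a ha => ?_, fun a ha => ?_⟩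
  · have la := l0.const_add a
    rw [add_zero] at la
    obtain ⟨δ, h1, h2⟩ := ((la.eventually_lt ll ha).and hd0).exists
    filter_upwards [(key δ h2).2] with s hs
    exact lt_of_add_lt_add_right (h1.trans_le hs)
  · have lu' := lu.add l0
    rw [add_zero] at lu'
    obtain ⟨δ, h1, h2⟩ := ((lu'.eventually_lt_const ha).and hd0).exists
    filter_upwards [(key δ h2).1] with s hs using hs.trans_lt h1

end IsCZKernel

end LimitingBehaviour

section Polar

open Metric Module
open scoped ENNReal NNReal Topology

variable {E : Type*} [NormedAddCommGroup E] [InnerProductSpace ℝ E] [FiniteDimensional ℝ E]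
  [MeasurableSpace E] [BorelSpace E]

/-- Integration in polar coordinates. -/
lemma lintegral_eq_lintegral_toSphere_prod [Nontrivial E] (F : E → ℝ≥0∞) :
    ∫⁻ x, F x = ∫⁻ p : sphere (0 : E) 1 × Ioi (0 : ℝ), F (p.2.1 • p.1.1)
      ∂((volume : Measure E).toSphere.prod (Measure.volumeIoiPow (finrank ℝ E - 1))) := by
  have h := (volume : Measure E).measurePreserving_homeomorphUnitSphereProd.lintegral_comp_emb
    (Homeomorph.measurableEmbedding _) (fun p => F (p.2.1 • p.1.1))
  rw [← h, ← setLIntegral_univ, ← setLIntegral_congr (s := ({0}ᶜ : Set E)) (t := univ)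
    (by rw [ae_eq_univ, compl_compl]; exact measure_singleton _)]
  rw [← lintegral_subtype_comap (measurableSet_singleton _).compl]
  refine lintegral_congr fun x => ?_
  congr 1
  have hx : ‖(x : E)‖ ≠ 0 := norm_ne_zero_iff.2 x.2
  simp [smul_smul, hx]

/-- The radial factor of a shell in polar coordinates. -/
lemma lintegral_homogeneous_mul_norm [Nontrivial E] {G : E → ℝ≥0∞} (hG : Measurable G)
    (hh : ∀ c : ℝ, 0 < c → ∀ x : E, x ≠ 0 → G (c • x) = G x) {φ : ℝ → ℝ≥0∞} (hφ : Measurable φ) :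
    ∫⁻ x, G x * φ ‖x‖ = (∫⁻ θ : sphere (0 : E) 1, G θ ∂(volume : Measure E).toSphere) *
      ∫⁻ r : Ioi (0 : ℝ), φ r ∂(Measure.volumeIoiPow (finrank ℝ E - 1)) := by
  rw [lintegral_eq_lintegral_toSphere_prod, ← lintegral_prod_mul (by fun_prop) (by fun_prop)]
  refine lintegral_congr fun p => ?_
  have h1 : ‖p.1.1‖ = 1 := by simp
  have h2 : (0 : ℝ) < p.2.1 := p.2.2
  rw [hh _ h2 _ (norm_ne_zero_iff.1 (by rw [h1]; norm_num)), norm_smul, h1, mul_one,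
    Real.norm_of_nonneg h2.le]

/-- The integral of a homogeneous function over a shell is a multiple of its integral over the
unit sphere. -/
lemma exists_lintegral_annulus_homogeneous [Nontrivial E] {a b : ℝ} (ha : 0 < a) (hab : a < b) :
    ∃ c : ℝ≥0∞, c ≠ ∞ ∧ c ≠ 0 ∧ ∀ G : E → ℝ≥0∞, Measurable G →
      (∀ c : ℝ, 0 < c → ∀ x : E, x ≠ 0 → G (c • x) = G x) →
      ∫⁻ x in annulus E a b, G x =
          c * ∫⁻ θ : sphere (0 : E) 1, G θ ∂(volume : Measure E).toSphere := by
  set ν := Measure.volumeIoiPow (finrank ℝ E - 1)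
  have mφ : Measurable ((Ioc a b).indicator (1 : ℝ → ℝ≥0∞)) :=
      measurable_one.indicator measurableSet_Ioc
  have e1 : ∫⁻ r : Ioi (0 : ℝ), (Ioc a b).indicator (1 : ℝ → ℝ≥0∞) r ∂ν =
      ν {r | r.1 ∈ Ioc a b} := by
    have mS : MeasurableSet {r : Ioi (0 : ℝ) | r.1 ∈ Ioc a b} :=
        measurable_subtype_coe measurableSet_Ioc
    rw [← lintegral_indicator_one mS]
    rfl
  refine ⟨∫⁻ r : Ioi (0 : ℝ), (Ioc a b).indicator (1 : ℝ → ℝ≥0∞) r ∂ν, ?_, ?_, fun G hG hh => ?_⟩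
  · rw [e1]
    refine ne_top_of_le_ne_top ?_ (measure_mono (t := Iio ⟨b + 1, by simp; linarith⟩) ?_)
    · rw [Measure.volumeIoiPow_apply_Iio]; simp
    · rintro ⟨r, hr⟩ h
      have h' : r ≤ b := h.2
      exact show r < b + 1 by linarith
  · rw [e1]
    intro h0
    have h1 : ν (Iio ⟨b, ha.trans hab⟩) ≤ ν (Iio ⟨(a + b) / 2, by simp; linarith⟩) := by
      rw [← add_zero (ν (Iio ⟨(a + b) / 2, _⟩)), ← h0]
      refine (measure_mono ?_).trans (measure_union_le _ _)
      rintro ⟨r, hr⟩ h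
      have h' : r < b := h
      rcases lt_or_ge r ((a + b) / 2) with h2 | h2
      · exact .inl h2
      · exact .inr ⟨by show a < r; linarith, h'.le⟩
    rw [Measure.volumeIoiPow_apply_Iio, Measure.volumeIoiPow_apply_Iio,
      ENNReal.ofReal_le_ofReal_iff (by have := ha.trans hab; positivity)] at h1
    have h2 : ((a + b) / 2) ^ (finrank ℝ E - 1 + 1) < b ^ (finrank ℝ E - 1 + 1) :=
      pow_lt_pow_left₀ (by linarith) (by linarith) (by simp)
    have h3 := div_lt_div_of_pos_right h2 (show (0 : ℝ) < ((finrank ℝ E - 1 : ℕ) : ℝ) + 1 by positivity)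
    exact absurd h3 (not_lt.2 h1)
  · rw [mul_comm, ← lintegral_homogeneous_mul_norm hG hh mφ,
      ← lintegral_indicator (measurableSet_annulus _ _)]
    refine lintegral_congr fun x => ?_
    by_cases hx : x ∈ annulus E a b
    · rw [indicator_of_mem hx, indicator_of_mem (show ‖x‖ ∈ Ioc a b from hx)]; simp
    · rw [indicator_of_notMem hx, indicator_of_notMem (show ‖x‖ ∉ Ioc a b from hx)]; simp

lemma lintegral_annulus_homogeneous_div [Nontrivial E] (a b : ℝ) {G : E → ℝ≥0∞} (hG : Measurable G)
    (hh : ∀ c : ℝ, 0 < c → ∀ x : E, x ≠ 0 → G (c • x) = G x) :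
    ∫⁻ x in annulus E a b, G x * ENNReal.ofReal (1 / ‖x‖ ^ finrank ℝ E) =
      (∫⁻ θ : sphere (0 : E) 1, G θ ∂(volume : Measure E).toSphere) *
        ∫⁻ r : Ioi (0 : ℝ), (Ioc a b).indicator (fun r => ENNReal.ofReal (1 / r ^ finrank ℝ E)) r
          ∂(Measure.volumeIoiPow (finrank ℝ E - 1)) := by
  rw [← lintegral_homogeneous_mul_norm hG hh
      (φ := (Ioc a b).indicator (fun r => ENNReal.ofReal (1 / r ^ finrank ℝ E)))
      (Measurable.indicator (by fun_prop) measurableSet_Ioc),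
          ← lintegral_indicator (measurableSet_annulus _ _)]
  refine lintegral_congr fun x => ?_
  by_cases hx : x ∈ annulus E a b
  · rw [indicator_of_mem hx, indicator_of_mem (show ‖x‖ ∈ Ioc a b from hx)]
  · rw [indicator_of_notMem hx, indicator_of_notMem (show ‖x‖ ∉ Ioc a b from hx), mul_zero]

lemma lintegral_indicator_div_volumeIoiPow_le {a : ℝ} (ha : 0 < a) {b : ℝ} (hab : a < b) (d : ℕ)
    (hd : 0 < d) :
    ∫⁻ r : Ioi (0 : ℝ), (Ioc a b).indicator (fun r => ENNReal.ofReal (1 / r ^ d)) r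
      ∂(Measure.volumeIoiPow (d - 1)) ≤ ENNReal.ofReal ((2 * b / a) ^ d) := by
  have hb : 0 < 2 * b := by linarith
  calc _ ≤ ∫⁻ r : Ioi (0 : ℝ),
      (Iio (⟨2 * b, hb⟩ : Ioi (0 : ℝ))).indicator (fun _ => ENNReal.ofReal (1 / a ^ d)) r
      ∂(Measure.volumeIoiPow (d - 1)) := by
        refine lintegral_mono fun r => ?_
        by_cases hr : r.1 ∈ Ioc a b
        · rw [indicator_of_mem hr, indicator_of_mem (show r ∈ Iio (⟨2 * b, hb⟩ : Ioi (0 : ℝ)) from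
            Subtype.coe_lt_coe.1 (lt_of_le_of_lt hr.2 (by linarith)))]
          have := hr.1
          exact ENNReal.ofReal_le_ofReal (by gcongr)
        · rw [indicator_of_notMem hr]; exact zero_le
    _ = ENNReal.ofReal (1 / a ^ d * ((2 * b) ^ d / d)) := by
        rw [lintegral_indicator_const measurableSet_Iio, Measure.volumeIoiPow_apply_Iio,
          ← ENNReal.ofReal_mul (by positivity)]
        obtain ⟨k, rfl⟩ := Nat.exists_eq_succ_of_ne_zero hd.ne'
        simp
    _ ≤ _ := by
        refine ENNReal.ofReal_le_ofReal ?_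
        have : (1 : ℝ) ≤ d := by exact_mod_cast hd
        rw [div_pow, one_div_mul_eq_div]
        gcongr
        exact div_le_self (by positivity) this

/-- The distribution function of a homogeneous kernel of critical degree. -/
lemma volume_lt_abs_homogeneous_div [Nontrivial E] {Ω : E → ℝ} (hΩ : Measurable Ω)
    (hh : ∀ c : ℝ, 0 < c → ∀ x : E, x ≠ 0 → Ω (c • x) = Ω x) {a : ℝ} (ha : 0 < a) :
    volume {x : E | a < |Ω x / ‖x‖ ^ finrank ℝ E|} =
      (∫⁻ θ : sphere (0 : E) 1,
          ‖Ω θ‖ₑ ∂(volume : Measure E).toSphere) / finrank ℝ E / ENNReal.ofReal a := by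
  set d := finrank ℝ E
  have hd : 0 < d := finrank_pos
  have mS : MeasurableSet {x : E | a < |Ω x / ‖x‖ ^ d|} :=
      measurableSet_lt measurable_const (by fun_prop)
  rw [← lintegral_indicator_one mS, lintegral_eq_lintegral_toSphere_prod, lintegral_prod _
    (Measurable.aemeasurable (by
      exact (measurable_one.indicator mS).comp (by fun_prop)))]
  have hd0 : (d : ℝ≥0∞) ≠ 0 := by exact_mod_cast hd.ne'
  have ha0 : ENNReal.ofReal a ≠ 0 := by simpa using ha
  rw [div_eq_mul_inv, div_eq_mul_inv, mul_assoc, ← lintegral_mul_const' _ _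
    (ENNReal.mul_ne_top (by simpa using hd.ne') (by simpa using ha0))]
  refine lintegral_congr fun θ => ?_
  have h1 : ‖θ.1‖ = 1 := by simp
  have hθ0 : θ.1 ≠ 0 := norm_ne_zero_iff.1 (by rw [h1]; norm_num)
  have hmem : ∀ r : Ioi (0 : ℝ), r.1 • θ.1 ∈ {x : E | a < |Ω x / ‖x‖ ^ d|} ↔ r.1 ^ d <
      |Ω θ| / a := by
    intro r
    have hr : 0 < r.1 := r.2
    rw [mem_ofPred_eq, hh _ hr _ hθ0, norm_smul, h1, mul_one, Real.norm_of_nonneg hr.le, abs_div,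
      abs_of_pos (pow_pos hr d), lt_div_iff₀ (pow_pos hr d), lt_div_iff₀ ha, mul_comm]
  rcases eq_or_ne (Ω θ) 0 with h0 | h0
  · rw [h0, enorm_zero, zero_mul]
    refine (lintegral_congr fun r => ?_).trans lintegral_zero
    refine indicator_of_notMem ?_ _
    rw [hmem, h0, abs_zero, zero_div, not_lt]
    exact pow_nonneg (le_of_lt r.2) d
  · have hq : 0 < |Ω θ| / a := div_pos (abs_pos.2 h0) ha
    set ρ : ℝ := (|Ω θ| / a) ^ (1 / (d : ℝ))
    have hρ : 0 < ρ := Real.rpow_pos_of_pos hq _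
    have hρd : ρ ^ d = |Ω θ| / a := by
      rw [← Real.rpow_natCast, ← Real.rpow_mul hq.le, one_div_mul_cancel (by positivity),
        Real.rpow_one]
    have hset : ∀ r : Ioi (0 : ℝ),
        {x : E | a < |Ω x / ‖x‖ ^ d|}.indicator (1 : E → ℝ≥0∞) (r.1 • θ.1) =
        (Iio (⟨ρ, hρ⟩ : Ioi (0 : ℝ))).indicator 1 r := by
      intro r
      have : r.1 • θ.1 ∈ {x : E | a < |Ω x / ‖x‖ ^ d|} ↔ r ∈ Iio (⟨ρ, hρ⟩ : Ioi (0 : ℝ)) := by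
        rw [hmem, ← hρd, pow_lt_pow_iff_left₀ (le_of_lt r.2) hρ.le hd.ne']
        rfl
      by_cases hr : r ∈ Iio (⟨ρ, hρ⟩ : Ioi (0 : ℝ))
      · rw [indicator_of_mem hr, indicator_of_mem (this.2 hr)]; rfl
      · rw [indicator_of_notMem hr, indicator_of_notMem (fun h => hr (this.1 h))]
    calc _ = ∫⁻ r : Ioi (0 : ℝ),
        (Iio (⟨ρ, hρ⟩ : Ioi (0 : ℝ))).indicator 1 r ∂(Measure.volumeIoiPow (d - 1)) :=
          lintegral_congr hset
      _ = ENNReal.ofReal (ρ ^ d / d) := by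
          rw [lintegral_indicator_one measurableSet_Iio, Measure.volumeIoiPow_apply_Iio]
          have e : d - 1 + 1 = d := by omega
          have e' : ((d - 1 : ℕ) : ℝ) + 1 = d := by exact_mod_cast e
          rw [e, e']
      _ = _ := by
          rw [hρd, ENNReal.ofReal_div_of_pos (by positivity), ENNReal.ofReal_div_of_pos ha,
            ← Real.norm_eq_abs,
            ofReal_norm, ENNReal.ofReal_natCast, div_eq_mul_inv, div_eq_mul_inv]
          ring

end Polar

section HalfTurn

open Metric Module
open scoped ENNReal NNReal Topology RealInnerProductSpace

variable {E : Type*} [NormedAddCommGroup E] [InnerProductSpace ℝ E]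

/-- The half-turn about the line through `u`. -/
def halfTurn (u w : E) : E := (2 * ⟪u, w⟫ / ‖u‖ ^ 2) • u - w

lemma halfTurn_eq_reflection (u w : E) : halfTurn u w = (ℝ ∙ u).reflection w := by
  rw [halfTurn, Submodule.reflection_singleton_apply]
  simp [mul_div_assoc, mul_smul, two_smul]

/-- The half-turn about the bisector of `w` and `z` takes the direction of `w` to that of `z`. -/
lemma halfTurn_bisector {w z : E} (hw : w ≠ 0) (hz : z ≠ 0) (h : z + (‖z‖ / ‖w‖) • w ≠ 0) :
    halfTurn (z + (‖z‖ / ‖w‖) • w) w = (‖w‖ / ‖z‖) • z := by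
  have hw' : ‖w‖ ≠ 0 := norm_ne_zero_iff.2 hw
  have hz' : ‖z‖ ≠ 0 := norm_ne_zero_iff.2 hz
  have hn : ‖z + (‖z‖ / ‖w‖) • w‖ ^ 2 = 2 * (‖z‖ / ‖w‖) * (‖z‖ * ‖w‖ + ⟪z, w⟫) := by
    rw [norm_add_sq_real, inner_smul_right, norm_smul, Real.norm_of_nonneg (by positivity)]
    field_simp
    ring
  have hi : ⟪z + (‖z‖ / ‖w‖) • w, w⟫ = ‖z‖ * ‖w‖ + ⟪z, w⟫ := by
    rw [inner_add_left, inner_smul_left, real_inner_self_eq_norm_sq]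
    simp
    field_simp
    ring
  have h0 : ‖z + (‖z‖ / ‖w‖) • w‖ ^ 2 ≠ 0 := pow_ne_zero _ (norm_ne_zero_iff.2 h)
  have hc : 2 * ⟪z + (‖z‖ / ‖w‖) • w, w⟫ / ‖z + (‖z‖ / ‖w‖) • w‖ ^ 2 = ‖w‖ / ‖z‖ := by
    rw [div_eq_div_iff h0 hz', hi, hn]
    field_simp
  rw [halfTurn, hc, smul_add, smul_smul]
  have : ‖w‖ / ‖z‖ * (‖z‖ / ‖w‖) = 1 := by field_simp
  rw [this, one_smul, add_sub_cancel_right]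

lemma norm_halfTurn_sub_halfTurn_le {u v : E} (hu : 1 ≤ ‖u‖) (hv : 1 ≤ ‖v‖) (x : E) :
    ‖halfTurn u x - halfTurn v x‖ ≤ 8 * ‖u - v‖ * ‖x‖ := by
  have hu0 : 0 < ‖u‖ := by linarith
  have hv0 : 0 < ‖v‖ := by linarith
  set a := ‖u‖⁻¹ • u
  set b := ‖v‖⁻¹ • v
  have ha : ‖a‖ = 1 := by simp [a, norm_smul, hu0.ne']
  have hb : ‖b‖ = 1 := by simp [b, norm_smul, hv0.ne']
  have key : ∀ y : E, halfTurn y x = (2 * ⟪‖y‖⁻¹ • y, x⟫) • (‖y‖⁻¹ • y) - x := by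
    intro y
    rw [halfTurn, inner_smul_left, smul_smul]
    congr 2
    simp
    ring
  have hab : ‖a - b‖ ≤ 2 * ‖u - v‖ := by
    have e : a - b = ‖u‖⁻¹ • (u - v) + (‖u‖⁻¹ * (‖v‖ - ‖u‖)) • b := by
      simp only [a, b, smul_sub, smul_smul]
      rw [mul_assoc, sub_mul, mul_inv_cancel₀ hv0.ne', mul_sub, mul_one, ← mul_assoc,
        inv_mul_cancel₀ hu0.ne', one_mul, sub_smul]
      abel
    rw [e]
    refine (norm_add_le _ _).trans ?_
    rw [norm_smul, norm_smul, hb, norm_mul, norm_inv, norm_norm, Real.norm_eq_abs]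
    have h1 : |‖v‖ - ‖u‖| ≤ ‖u - v‖ := by rw [abs_sub_comm]; exact abs_norm_sub_norm_le u v
    have h2 : ‖u‖⁻¹ ≤ 1 := inv_le_one_of_one_le₀ hu
    have h3 := mul_le_of_le_one_left (norm_nonneg (u - v)) h2
    have h4 := mul_le_of_le_one_left (abs_nonneg (‖v‖ - ‖u‖)) h2
    linarith
  rw [key, key, sub_sub_sub_cancel_right]
  have e : (2 * ⟪a, x⟫) • a - (2 * ⟪b, x⟫) • b = (2 * ⟪a - b, x⟫) • a + (2 * ⟪b, x⟫) • (a - b) := by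
    rw [inner_sub_left, mul_sub, sub_smul, smul_sub]; abel
  change ‖(2 * ⟪a, x⟫) • a - (2 * ⟪b, x⟫) • b‖ ≤ _
  rw [e]
  refine (norm_add_le _ _).trans ?_
  rw [norm_smul _ a, ha, norm_smul _ (a - b), norm_mul, norm_mul, Real.norm_two]
  have h1 := norm_inner_le_norm (𝕜 := ℝ) (a - b) x
  have h2 := norm_inner_le_norm (𝕜 := ℝ) b x
  rw [hb, one_mul] at h2
  have h3 := mul_le_mul_of_nonneg_right hab (norm_nonneg x)
  have h4 := mul_le_mul h2 hab (norm_nonneg _) (norm_nonneg _)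
  nlinarith

/-- The bisector map is expanding on a narrow cone about its axis. -/
lemma norm_sub_le_norm_bisector_sub {e : E} {z z' : E} (hz : ‖z - ‖z‖ • e‖ ≤ ‖z‖ / 4)
    (hz' : ‖z' - ‖z'‖ • e‖ ≤ ‖z'‖ / 4) (he : ‖e‖ = 1) :
    ‖z - z'‖ ≤ 2 * ‖(z + ‖z‖ • e) - (z' + ‖z'‖ • e)‖ := by
  set D := z - z'
  set b := ‖z‖ - ‖z'‖
  have hD : (z + ‖z‖ • e) - (z' + ‖z'‖ • e) = D + b • e := by
    simp only [D, b, sub_smul]; abel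
  have hsq : ‖D + b • e‖ ^ 2 = ‖D‖ ^ 2 + 2 * b * ⟪D, e⟫ + b ^ 2 := by
    rw [norm_add_sq_real, inner_smul_right, norm_smul, he, mul_one, Real.norm_eq_abs, sq_abs]
    ring
  have hη : |b - ⟪D, e⟫| ≤ ‖D‖ / 4 := by
    rcases eq_or_lt_of_le (add_nonneg (norm_nonneg z) (norm_nonneg z')) with h0 | h0
    · have h1 : z = 0 := norm_le_zero_iff.1 (by linarith [norm_nonneg z, norm_nonneg z'])
      have h2 : z' = 0 := norm_le_zero_iff.1 (by linarith [norm_nonneg z, norm_nonneg z'])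
      simp [D, b, h1, h2]
    · have e1 : (b - ⟪D, e⟫) * (‖z‖ + ‖z'‖) = ⟪D, (z - ‖z‖ • e) + (z' - ‖z'‖ • e)⟫ := by
        have : ⟪D, z + z'⟫ = ‖z‖ ^ 2 - ‖z'‖ ^ 2 := by
          rw [inner_add_right, inner_sub_left, inner_sub_left, real_inner_self_eq_norm_sq,
            real_inner_self_eq_norm_sq, real_inner_comm z z']
          ring
        rw [show (z - ‖z‖ • e) + (z' - ‖z'‖ • e) = (z + z') - (‖z‖ + ‖z'‖) • e by
          rw [add_smul]; abel, inner_sub_right, this, inner_smul_right]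
        ring
      have e2 : |b - ⟪D, e⟫| * (‖z‖ + ‖z'‖) ≤ ‖D‖ / 4 * (‖z‖ + ‖z'‖) := by
        rw [← abs_of_pos h0, ← abs_mul, abs_of_pos h0, e1]
        refine (abs_real_inner_le_norm _ _).trans ?_
        have := norm_add_le (z - ‖z‖ • e) (z' - ‖z'‖ • e)
        nlinarith [norm_nonneg D]
      exact le_of_mul_le_mul_right e2 h0
  have hη' := abs_le.1 hη
  rw [hD]
  refine le_of_sq_le_sq ?_ (by positivity)
  have h5 : (b - ⟪D, e⟫) ^ 2 ≤ (‖D‖ / 4) ^ 2 := by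
    rw [← sq_abs (b - ⟪D, e⟫)]
    gcongr
  rw [mul_pow, hsq]
  nlinarith [sq_nonneg (3 * b - (b - ⟪D, e⟫)), sq_nonneg ‖D‖]

end HalfTurn

section Rotation

open Metric Module
open scoped ENNReal NNReal Topology RealInnerProductSpace

variable {E : Type*} [NormedAddCommGroup E] [InnerProductSpace ℝ E] [FiniteDimensional ℝ E]
  [MeasurableSpace E] [BorelSpace E]

lemma volume_inter_preimage_le_of_norm_sub_le {f : E → E} {s : Set E} {K : ℝ≥0}
    (hf : ∀ x ∈ s, ∀ y ∈ s, ‖x - y‖ ≤ K * ‖f x - f y‖) (t : Set E) :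
    volume (s ∩ f ⁻¹' t) ≤ (K : ℝ≥0∞) ^ finrank ℝ E * volume t := by
  have hg : AntilipschitzWith K (fun x : s => f x) := by
    refine AntilipschitzWith.of_le_mul_dist fun x y => ?_
    rw [Subtype.dist_eq, dist_eq_norm, dist_eq_norm]
    exact hf x x.2 y y.2
  have h := hg.hausdorffMeasure_preimage_le (d := finrank ℝ E) (by positivity) t
  rw [← isometry_subtype_coe.hausdorffMeasure_image (.inl (by positivity))] at h
  have e : ((↑) : s → E) '' ((fun x : s => f x) ⁻¹' t) = s ∩ f ⁻¹' t := by
    ext x; simp [and_comm]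
  rw [e, ENNReal.rpow_natCast] at h
  rw [← InnerProductSpace.euclideanHausdorffMeasure_eq_volume,
    Measure.euclideanHausdorffMeasure_def,
    Measure.smul_apply, Measure.smul_apply, mul_smul_comm]
  gcongr

lemma setLIntegral_comp_le_of_norm_sub_le {f : E → E} (mf : Measurable f) {s : Set E}
    {K : ℝ≥0} (hf : ∀ x ∈ s, ∀ y ∈ s, ‖x - y‖ ≤ K * ‖f x - f y‖)
    {G : E → ℝ≥0∞} (hG : Measurable G) :
    ∫⁻ z in s, G (f z) ≤ (K : ℝ≥0∞) ^ finrank ℝ E * ∫⁻ z, G z := by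
  rw [← lintegral_map hG mf, ← smul_eq_mul, ← lintegral_smul_measure]
  refine lintegral_mono' (Measure.le_iff.2 fun t ht => ?_) le_rfl
  rw [Measure.map_apply mf ht, Measure.restrict_apply (mf ht), inter_comm]
  exact volume_inter_preimage_le_of_norm_sub_le hf t

lemma measurable_halfTurn : Measurable fun p : E × E => halfTurn p.1 p.2 := by
  unfold halfTurn; fun_prop

end Rotation

section RotationModulus

open Metric Module
open scoped ENNReal NNReal Topology RealInnerProductSpace

variable {E : Type*} [NormedAddCommGroup E] [InnerProductSpace ℝ E] [FiniteDimensional ℝ E]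
  [MeasurableSpace E] [BorelSpace E]

/-- `ω` dominates the `L¹` modulus of continuity of `Ω` under rotations, integrated over a shell. -/
def IsRotationModulus (Ω : E → ℝ) (ω : ℝ → ℝ≥0∞) : Prop :=
  ∀ (ρ : E ≃ₗᵢ[ℝ] E) (δ : ℝ), LinearMap.det (ρ.toLinearEquiv : E →ₗ[ℝ] E) = 1 →
    (∀ x, ‖x‖ = 1 → ‖ρ x - x‖ ≤ δ) → ∫⁻ w in annulus E 1 2, ‖Ω (ρ w) - Ω w‖ₑ ≤ ω δ

lemma setLIntegral_annulus_comp_linearIsometryEquiv (ρ : E ≃ₗᵢ[ℝ] E) (a b : ℝ) (G : E → ℝ≥0∞) :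
    ∫⁻ w in annulus E a b, G (ρ w) = ∫⁻ w in annulus E a b, G w := by
  have h := ρ.measurePreserving.setLIntegral_comp_preimage_emb
    ρ.toHomeomorph.measurableEmbedding G (annulus E a b)
  rw [← h]
  congr 2
  ext w; simp [annulus]

lemma IsRotationModulus.lintegral_halfTurn_le {Ω : E → ℝ} {ω : ℝ → ℝ≥0∞}
    (hω : IsRotationModulus Ω ω)
    {u v : E} (hu : 1 ≤ ‖u‖) (hv : 1 ≤ ‖v‖) {δ : ℝ} (huv : ‖u - v‖ ≤ δ) :
    ∫⁻ w in annulus E 1 2, ‖Ω (halfTurn u w) - Ω (halfTurn v w)‖ₑ ≤ ω (8 * δ) := by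
  set R : E → E ≃ₗᵢ[ℝ] E := fun u => (ℝ ∙ u).reflection
  have hR : ∀ u w, halfTurn u w = R u w := halfTurn_eq_reflection
  have hRR : ∀ u w, R u (R u w) = w := fun u w => Submodule.reflection_reflection _ _
  have hdet : ∀ u : E, 1 ≤ ‖u‖ → LinearMap.det ((R u).toLinearEquiv : E →ₗ[ℝ] E) =
      (-1) ^ (finrank ℝ E - 1) := by
    intro u hu
    have h0 : u ≠ 0 := norm_ne_zero_iff.1 (by linarith)
    have h1 := (ℝ ∙ u).finrank_add_finrank_orthogonal
    rw [finrank_span_singleton h0] at h1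
    have h2 : finrank ℝ (ℝ ∙ u)ᗮ = finrank ℝ E - 1 := by omega
    rw [← h2]
    exact (ℝ ∙ u).det_reflection
  calc _ = ∫⁻ w in annulus E 1 2, ‖Ω (R u (R v w)) - Ω (R v (R v w))‖ₑ := by
        rw [setLIntegral_annulus_comp_linearIsometryEquiv (R v) 1 2 (fun w => ‖Ω (R u w) - Ω (R v w)‖ₑ)]
        simp_rw [hR]
    _ = ∫⁻ w in annulus E 1 2, ‖Ω (((R v).trans (R u)) w) - Ω w‖ₑ := by
        simp_rw [hRR]; rfl
    _ ≤ _ := by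
        refine hω _ _ ?_ fun x hx => ?_
        · have : (((R v).trans (R u)).toLinearEquiv : E →ₗ[ℝ] E) =
            ((R u).toLinearEquiv : E →ₗ[ℝ] E) ∘ₗ ((R v).toLinearEquiv : E →ₗ[ℝ] E) := rfl
          rw [this, LinearMap.det_comp, hdet u hu, hdet v hv, ← mul_pow]
          simp
        · have e : ((R v).trans (R u)) x - x = R u (R v x - R u x) := by
            rw [map_sub, hRR]; rfl
          rw [e, LinearIsometryEquiv.norm_map, ← hR, ← hR]
          refine (norm_halfTurn_sub_halfTurn_le hv hu x).trans ?_
          rw [hx, mul_one, norm_sub_rev]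
          gcongr

/-- Pairs of points of the shell `{2/3 ≤ ‖z‖ ≤ 3}` at distance at most `δ`. -/
def nearPairs (E : Type*) [NormedAddCommGroup E] (δ : ℝ) : Set (E × E) :=
  {p | 2 / 3 ≤ ‖p.1‖ ∧ ‖p.1‖ ≤ 3 ∧ 2 / 3 ≤ ‖p.2‖ ∧ ‖p.1 - p.2‖ ≤ δ}

lemma measurableSet_nearPairs (δ : ℝ) : MeasurableSet (nearPairs E δ) := by
  have h1 : MeasurableSet {p : E × E | 2 / 3 ≤ ‖p.1‖} :=
      measurableSet_le (by fun_prop) (by fun_prop)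
  have h2 : MeasurableSet {p : E × E | ‖p.1‖ ≤ 3} := measurableSet_le (by fun_prop) (by fun_prop)
  have h3 : MeasurableSet {p : E × E | 2 / 3 ≤ ‖p.2‖} :=
      measurableSet_le (by fun_prop) (by fun_prop)
  have h4 : MeasurableSet {p : E × E | ‖p.1 - p.2‖ ≤ δ} :=
      measurableSet_le (by fun_prop) (by fun_prop)
  exact h1.inter (h2.inter (h3.inter h4))

/-- A narrow cone about the half-line through `w`, away from the origin. -/
def coneAbout (w : E) : Set E := {z | 2 / 3 ≤ ‖z‖ ∧ ‖z - ‖z‖ • ‖w‖⁻¹ • w‖ ≤ ‖z‖ / 4}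

omit [InnerProductSpace ℝ E] [FiniteDimensional ℝ E] [MeasurableSpace E] [BorelSpace E] in
lemma mem_coneAbout_of_mem_ball [NormedSpace ℝ E] {z z' w : E} (hz : 2 / 3 ≤ ‖z‖)
    (hz' : 2 / 3 ≤ ‖z'‖)
    (hzz : ‖z - z'‖ ≤ 1 / 24) (hw : ‖w - (3 / 2 : ℝ) • ‖z‖⁻¹ • z‖ < 1 / 16) :
    (1 < ‖w‖ ∧ ‖w‖ ≤ 2) ∧ ‖z' - ‖z'‖ • ‖w‖⁻¹ • w‖ ≤ ‖z'‖ / 4 := by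
  have hz0 : 0 < ‖z‖ := by linarith
  set c := ‖z‖⁻¹ • z
  have hc : ‖c‖ = 1 := by simp [c, norm_smul, hz0.ne']
  have hc' : ‖(3 / 2 : ℝ) • c‖ = 3 / 2 := by rw [norm_smul, hc]; norm_num
  have h1 : |‖w‖ - 3 / 2| < 1 / 16 := by
    rw [← hc']; exact (abs_norm_sub_norm_le _ _).trans_lt hw
  have h1' := abs_lt.1 h1
  have hw0 : 0 < ‖w‖ := by linarith
  refine ⟨⟨by linarith, by linarith⟩, ?_⟩
  set e := ‖w‖⁻¹ • w
  have he : ‖e‖ = 1 := by simp [e, norm_smul, hw0.ne']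
  have h2 : ‖c - e‖ ≤ 1 / 12 := by
    have e1 : (3 / 2 : ℝ) • (c - e) = -(w - (3 / 2 : ℝ) • c) + (‖w‖ - 3 / 2) • e := by
      rw [sub_smul, smul_sub]
      have : ‖w‖ • e = w := by simp only [e]; rw [smul_inv_smul₀ hw0.ne']
      rw [this]; abel
    have e2 : 3 / 2 * ‖c - e‖ ≤ 1 / 16 + 1 / 16 := by
      have : ‖(3 / 2 : ℝ) • (c - e)‖ = 3 / 2 * ‖c - e‖ := by rw [norm_smul]; norm_num
      rw [← this, e1]
      refine (norm_add_le _ _).trans ?_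
      rw [norm_neg, norm_smul, he, mul_one, Real.norm_eq_abs]
      linarith
    linarith
  have e3 : z' - ‖z'‖ • e = (z' - z) + ‖z‖ • (c - e) + (‖z‖ - ‖z'‖) • e := by
    have : ‖z‖ • c = z := by simp only [c]; rw [smul_inv_smul₀ hz0.ne']
    rw [smul_sub, this, sub_smul]; abel
  have h3 : |‖z‖ - ‖z'‖| ≤ 1 / 24 := (abs_norm_sub_norm_le _ _).trans hzz
  have h3' := abs_le.1 h3
  rw [e3]
  refine (norm_add₃_le).trans ?_
  rw [norm_smul, norm_smul, he, mul_one, norm_norm, Real.norm_eq_abs, norm_sub_rev]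
  have h4 : ‖z‖ * ‖c - e‖ ≤ ‖z‖ * (1 / 12) := by gcongr
  linarith


/-- The mean oscillation of `Ω` over close pairs of points is controlled by its rotation modulus. -/
lemma IsRotationModulus.exists_lintegral_nearPairs_le (E : Type*) [NormedAddCommGroup E]
    [InnerProductSpace ℝ E] [FiniteDimensional ℝ E] [MeasurableSpace E] [BorelSpace E] :
    ∃ c : ℝ≥0∞, c ≠ ∞ ∧ ∀ (Ω : E → ℝ) (ω : ℝ → ℝ≥0∞), Measurable Ω →
      (∀ c : ℝ, 0 < c → ∀ x : E, x ≠ 0 → Ω (c • x) = Ω x) → IsRotationModulus Ω ω →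
      ∀ δ : ℝ, 0 < δ → δ ≤ 1 / 24 →
        ∫⁻ p in nearPairs E δ, ‖Ω p.1 - Ω p.2‖ₑ ∂((volume : Measure E).prod volume) ≤
          c * volume (closedBall (0 : E) δ) * ω (16 * δ) := by
  set d := finrank ℝ E
  set c₀ : ℝ≥0∞ := volume (ball (0 : E) (1 / 16))
  have hc₀ : c₀ ≠ 0 := (measure_ball_pos _ _ (by norm_num)).ne'
  have hc₀' : c₀ ≠ ∞ := measure_ball_lt_top.ne
  set V : ℝ≥0∞ := 2 ^ d * (2 ^ d * (volume (closedBall (0 : E) 6) * 2 ^ d))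
  refine ⟨c₀⁻¹ * V, ?_, fun Ω ω mΩ hh hω δ hδ0 hδ => ?_⟩
  · have : volume (closedBall (0 : E) 6) ≠ ∞ := measure_closedBall_lt_top.ne
    simp only [V]
    finiteness
  set Q : Set (E × E) := {q | 1 ≤ ‖q.1‖ ∧ ‖q.1‖ ≤ 6 ∧ 1 ≤ ‖q.2‖ ∧ ‖q.1 - q.2‖ ≤ 2 * δ}
  have mQ : MeasurableSet Q := by
    have h1 : MeasurableSet {p : E × E | 1 ≤ ‖p.1‖} := measurableSet_le (by fun_prop) (by fun_prop)
    have h2 : MeasurableSet {p : E × E | ‖p.1‖ ≤ 6} := measurableSet_le (by fun_prop) (by fun_prop)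
    have h3 : MeasurableSet {p : E × E | 1 ≤ ‖p.2‖} := measurableSet_le (by fun_prop) (by fun_prop)
    have h4 : MeasurableSet {p : E × E | ‖p.1 - p.2‖ ≤ 2 * δ} :=
      measurableSet_le (by fun_prop) (by fun_prop)
    exact h1.inter (h2.inter (h3.inter h4))
  set F : E → E × E → ℝ≥0∞ :=
      fun w => Q.indicator fun q => ‖Ω (halfTurn q.1 w) - Ω (halfTurn q.2 w)‖ₑ
  have mF : Measurable fun x : E × E × E => F x.1 x.2 := by
    have : (fun x : E × E × E => F x.1 x.2) = (Prod.snd ⁻¹' Q).indicator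
        fun x : E × E × E => ‖Ω (halfTurn x.2.1 x.1) - Ω (halfTurn x.2.2 x.1)‖ₑ := by
      rfl
    rw [this]
    refine Measurable.indicator ?_ (measurable_snd mQ)
    have m1 : Measurable fun x : E × E × E => halfTurn x.2.1 x.1 :=
      measurable_halfTurn.comp (f := fun x : E × E × E => (x.2.1, x.1)) (by fun_prop)
    have m2 : Measurable fun x : E × E × E => halfTurn x.2.2 x.1 :=
      measurable_halfTurn.comp (f := fun x : E × E × E => (x.2.2, x.1)) (by fun_prop)
    exact ((mΩ.comp m1).sub (mΩ.comp m2)).enorm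
  set ψ : E → E → E := fun w z => z + ‖z‖ • ‖w‖⁻¹ • w
  have mψ : Measurable fun x : E × E => ψ x.1 x.2 := by simp only [ψ]; fun_prop
  have mcone : MeasurableSet {x : E × E | x.2 ∈ coneAbout x.1} := by
    have h1 : MeasurableSet {x : E × E | 2 / 3 ≤ ‖x.2‖} :=
        measurableSet_le (by fun_prop) (by fun_prop)
    have h2 : MeasurableSet {x : E × E | ‖x.2 - ‖x.2‖ • ‖x.1‖⁻¹ • x.1‖ ≤ ‖x.2‖ / 4} :=
      measurableSet_le (by fun_prop) (by fun_prop)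
    exact h1.inter h2
  set S : E → Set (E × E) := fun w => {p | p.1 ∈ coneAbout w ∧ p.2 ∈ coneAbout w}
  set H : E → E × E → ℝ≥0∞ := fun w => (S w).indicator fun p => F w (ψ w p.1, ψ w p.2)
  have mH : Measurable fun x : E × E × E => H x.1 x.2 := by
    have : (fun x : E × E × E => H x.1 x.2) = {x : E × E × E | x.2 ∈ S x.1}.indicator
        fun x : E × E × E => F x.1 (ψ x.1 x.2.1, ψ x.1 x.2.2) := by
      rfl
    rw [this]
    refine Measurable.indicator ?_ ?_
    · exact mF.comp (f := fun x : E × E × E => (x.1, ψ x.1 x.2.1, ψ x.1 x.2.2))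
        (by simp only [ψ]; fun_prop)
    · have m1 : Measurable fun x : E × E × E => (x.1, x.2.1) := by fun_prop
      have m2 : Measurable fun x : E × E × E => (x.1, x.2.2) := by fun_prop
      exact (m1 mcone).inter (m2 mcone)
  have hpt : ∀ p ∈ nearPairs E δ, ∀ w ∈ ball ((3 / 2 : ℝ) • ‖p.1‖⁻¹ • p.1) (1 / 16),
      w ∈ annulus E 1 2 ∧ ‖Ω p.1 - Ω p.2‖ₑ ≤ H w p := by
    rintro ⟨z, z'⟩ ⟨hz, hz3, hz', hzz⟩ w hw
    rw [mem_ball_iff_norm] at hw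
    dsimp only at hz hz3 hz' hzz hw ⊢
    have hzz' := hzz.trans hδ
    obtain ⟨hwa, hcz⟩ := mem_coneAbout_of_mem_ball hz hz (by simp) hw
    have hcz' := (mem_coneAbout_of_mem_ball hz hz' hzz' hw).2
    refine ⟨hwa, ?_⟩
    have hw0 : w ≠ 0 := norm_ne_zero_iff.1 (by linarith [hwa.1])
    have he : ‖‖w‖⁻¹ • w‖ = 1 := by simp [norm_smul, hw0]
    have hnorm : ∀ y : E, 2 / 3 ≤ ‖y‖ → ‖y - ‖y‖ • ‖w‖⁻¹ • w‖ ≤ ‖y‖ / 4 → 1 ≤ ‖ψ w y‖ := by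
      intro y hy hcy
      have e1 : (2 : ℝ) • y = ψ w y + (y - ‖y‖ • ‖w‖⁻¹ • w) := by
        simp only [ψ, two_smul]; abel
      have e2 := norm_add_le (ψ w y) (y - ‖y‖ • ‖w‖⁻¹ • w)
      rw [← e1, norm_smul, Real.norm_two] at e2
      linarith
    have hturn : ∀ y : E, 2 / 3 ≤ ‖y‖ → ‖y - ‖y‖ • ‖w‖⁻¹ • w‖ ≤ ‖y‖ / 4 →
        Ω (halfTurn (ψ w y) w) = Ω y := by
      intro y hy hcy
      have hy0 : y ≠ 0 := norm_ne_zero_iff.1 (by linarith)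
      have e1 : ψ w y = y + (‖y‖ / ‖w‖) • w := by simp only [ψ, smul_smul, div_eq_mul_inv]
      have e2 : ψ w y ≠ 0 := norm_ne_zero_iff.1 (by linarith [hnorm y hy hcy])
      rw [e1] at e2 ⊢
      rw [halfTurn_bisector hw0 hy0 e2]
      exact hh _ (by positivity) _ hy0
    have hS : (z, z') ∈ S w := ⟨⟨hz, hcz⟩, ⟨hz', hcz'⟩⟩
    have hψ : ∀ y : E, ‖ψ w y‖ ≤ 2 * ‖y‖ := by
      intro y
      refine (norm_add_le _ _).trans ?_
      rw [norm_smul, he, norm_norm]; linarith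
    have hQ : (ψ w z, ψ w z') ∈ Q := by
      refine ⟨hnorm z hz hcz, (hψ z).trans (by linarith), hnorm z' hz' hcz', ?_⟩
      have e1 : ψ w z - ψ w z' = (z - z') + (‖z‖ - ‖z'‖) • ‖w‖⁻¹ • w := by
        simp only [ψ, sub_smul]; abel
      dsimp only
      rw [e1]
      refine (norm_add_le _ _).trans ?_
      rw [norm_smul, he, mul_one, Real.norm_eq_abs]
      have := abs_norm_sub_norm_le z z'
      linarith
    simp only [H, F]
    rw [indicator_of_mem hS, indicator_of_mem hQ, hturn z hz hcz, hturn z' hz' hcz']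
  have h_fubini : c₀ * ∫⁻ p in nearPairs E δ, ‖Ω p.1 - Ω p.2‖ₑ ∂((volume : Measure E).prod volume) ≤
      ∫⁻ w in annulus E 1 2, ∫⁻ p, H w p ∂((volume : Measure E).prod volume) := by
    rw [lintegral_lintegral_swap mH.aemeasurable, ← lintegral_const_mul' _ _ hc₀',
      ← lintegral_indicator (measurableSet_nearPairs δ)]
    refine lintegral_mono fun p => ?_
    by_cases hp : p ∈ nearPairs E δ
    · rw [indicator_of_mem hp]
      calc _ = ∫⁻ w in ball ((3 / 2 : ℝ) • ‖p.1‖⁻¹ • p.1) (1 / 16), ‖Ω p.1 - Ω p.2‖ₑ := by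
            rw [setLIntegral_const, mul_comm, Measure.addHaar_ball_center]
        _ ≤ ∫⁻ w in ball ((3 / 2 : ℝ) • ‖p.1‖⁻¹ • p.1) (1 / 16), H w p :=
            setLIntegral_mono' measurableSet_ball fun w hw => (hpt p hp w hw).2
        _ ≤ _ := lintegral_mono_set fun w hw => (hpt p hp w hw).1
    · rw [indicator_of_notMem hp]; exact zero_le
  have h_fibre : ∀ w ∈ annulus E 1 2, ∫⁻ p, H w p ∂((volume : Measure E).prod volume) ≤
      2 ^ d * (2 ^ d * ∫⁻ q, F w q ∂((volume : Measure E).prod volume)) := by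
    intro w hw
    have hw0 : w ≠ 0 := norm_ne_zero_iff.1 (by linarith [hw.1])
    have he : ‖‖w‖⁻¹ • w‖ = 1 := by simp [norm_smul, hw0]
    have mFw : Measurable (F w) := mF.comp (f := fun q => (w, q)) (by fun_prop)
    have mψw : Measurable (ψ w) := mψ.comp (f := fun z => (w, z)) (by fun_prop)
    have mC : MeasurableSet (coneAbout w) := by
      have : Measurable fun z : E => (w, z) := by fun_prop
      exact this mcone
    have hexp : ∀ x ∈ coneAbout w, ∀ y ∈ coneAbout w, ‖x - y‖ ≤ (2 : ℝ≥0) * ‖ψ w x - ψ w y‖ :=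
      fun x hx y hy => norm_sub_le_norm_bisector_sub hx.2 hy.2 he
    have mHw : Measurable (H w) := mH.comp (f := fun q => (w, q)) (by fun_prop)
    rw [lintegral_prod _ mHw.aemeasurable, lintegral_prod _ mFw.aemeasurable]
    calc ∫⁻ z, ∫⁻ z', H w (z, z')
        = ∫⁻ z in coneAbout w, ∫⁻ z' in coneAbout w, F w (ψ w z, ψ w z') := by
          rw [← lintegral_indicator mC]
          refine lintegral_congr fun z => ?_
          by_cases hz : z ∈ coneAbout w
          · rw [indicator_of_mem hz, ← lintegral_indicator mC]
            refine lintegral_congr fun z' => ?_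
            by_cases hz' : z' ∈ coneAbout w
            · rw [indicator_of_mem hz']
              exact indicator_of_mem (show (z, z') ∈ S w from ⟨hz, hz'⟩) _
            · rw [indicator_of_notMem hz']
              exact indicator_of_notMem (show (z, z') ∉ S w from fun h => hz' h.2) _
          · rw [indicator_of_notMem hz]
            refine (lintegral_congr fun z' => ?_).trans lintegral_zero
            exact indicator_of_notMem (show (z, z') ∉ S w from fun h => hz h.1) _
      _ ≤ ∫⁻ z in coneAbout w, 2 ^ d * ∫⁻ v, F w (ψ w z, v) :=
          lintegral_mono fun z => by
            exact_mod_cast setLIntegral_comp_le_of_norm_sub_le mψw hexp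
              (mFw.comp (f := fun v => (ψ w z, v)) (by fun_prop))
      _ = 2 ^ d * ∫⁻ z in coneAbout w, ∫⁻ v, F w (ψ w z, v) :=
          lintegral_const_mul' _ _ (by finiteness)
      _ ≤ _ := by
          gcongr
          exact_mod_cast setLIntegral_comp_le_of_norm_sub_le mψw hexp
            (G := fun u => ∫⁻ v, F w (u, v)) mFw.lintegral_prod_right'
  have h_halfTurn : ∫⁻ w in annulus E 1 2, ∫⁻ q, F w q ∂((volume : Measure E).prod volume) ≤
      volume (closedBall (0 : E) 6) * 2 ^ d * volume (closedBall (0 : E) δ) * ω (16 * δ) := by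
    rw [lintegral_lintegral_swap mF.aemeasurable]
    calc ∫⁻ q : E × E, (∫⁻ w in annulus E 1 2,
        F w q ∂(volume : Measure E)) ∂((volume : Measure E).prod volume)
        ≤ ∫⁻ q, Q.indicator (fun _ => ω (16 * δ)) q ∂((volume : Measure E).prod volume) := by
          refine lintegral_mono fun q => ?_
          by_cases hq : q ∈ Q
          · simp only [F]
            simp_rw [indicator_of_mem hq]
            have := hω.lintegral_halfTurn_le hq.1 hq.2.2.1 hq.2.2.2
            rwa [show 8 * (2 * δ) = 16 * δ by ring] at this
          · simp only [F]
            simp_rw [indicator_of_notMem hq, lintegral_zero]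
            exact le_rfl
      _ = ω (16 * δ) * ((volume : Measure E).prod volume) Q := lintegral_indicator_const mQ _
      _ ≤ ω (16 * δ) * (volume (closedBall (0 : E) 6) * (2 ^ d * volume (closedBall (0 : E) δ))) := by
          gcongr
          rw [Measure.prod_apply mQ]
          calc _ ≤ ∫⁻ u, (closedBall (0 : E) 6).indicator (fun _ => 2 ^ d * volume (closedBall (0 : E) δ)) u := by
                refine lintegral_mono fun u => ?_
                by_cases hu : u ∈ closedBall (0 : E) 6
                · rw [indicator_of_mem hu]
                  calc volume (Prod.mk u ⁻¹' Q) ≤ volume (closedBall u (2 * δ)) := by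
                        refine measure_mono fun v hv => ?_
                        rw [mem_closedBall_iff_norm, norm_sub_rev]
                        exact hv.2.2.2
                    _ = _ := by
                        rw [Measure.addHaar_closedBall_center,
                          Measure.addHaar_closedBall_mul _ _ (by norm_num) hδ0.le,
                          ENNReal.ofReal_pow (by norm_num)]
                        simp [d]
                · rw [indicator_of_notMem hu]
                  refine le_of_eq (measure_mono_null (t := ∅) (fun v hv => hu ?_) measure_empty)
                  rw [mem_closedBall_zero_iff]
                  exact hv.2.1
            _ = _ := by rw [lintegral_indicator_const measurableSet_closedBall, mul_comm]
      _ = _ := by ring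
  have fin : c₀ * ∫⁻ p in nearPairs E δ, ‖Ω p.1 - Ω p.2‖ₑ ∂((volume : Measure E).prod volume) ≤
      V * volume (closedBall (0 : E) δ) * ω (16 * δ) := by
    refine h_fubini.trans ((setLIntegral_mono' (measurableSet_annulus _ _) h_fibre).trans ?_)
    rw [lintegral_const_mul' _ _ (by finiteness), lintegral_const_mul' _ _ (by finiteness)]
    refine (mul_le_mul_right (mul_le_mul_right h_halfTurn _) _).trans (le_of_eq ?_)
    simp only [V]; ring
  rw [mul_assoc, mul_assoc, ← mul_assoc V]
  rw [← ENNReal.mul_le_iff_le_inv hc₀ hc₀']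
  exact fin

end RotationModulus

section HomogeneousDifference

open scoped ENNReal

lemma abs_one_div_pow_sub_one_div_pow_le {a b : ℝ} (ha : 1 / 2 ≤ a) (hb : 1 / 2 ≤ b) (d : ℕ) :
    |1 / a ^ d - 1 / b ^ d| ≤ 4 * d * 2 ^ (d - 1) * |a - b| := by
  have ha0 : 0 < a := by linarith
  have hb0 : 0 < b := by linarith
  have h1 : 1 / a ≤ 2 := by rw [div_le_iff₀ ha0]; linarith
  have h2 : 1 / b ≤ 2 := by rw [div_le_iff₀ hb0]; linarith
  have h3 : |1 / a - 1 / b| ≤ 4 * |a - b| := by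
    have e : 1 / a - 1 / b = -(a - b) * ((1 / a) * (1 / b)) := by field_simp; ring
    rw [e, abs_mul, abs_neg, abs_of_pos (by positivity : 0 < (1 / a) * (1 / b)), mul_comm]
    gcongr
    calc _ ≤ (2 : ℝ) * 2 := by gcongr
      _ = 4 := by norm_num
  have := abs_pow_sub_pow_le (1 / a) (1 / b) d
  rw [div_pow, div_pow, one_pow] at this
  refine this.trans ?_
  have h4 : max |1 / a| |1 / b| ≤ 2 := by
    rw [abs_of_pos (by positivity), abs_of_pos (by positivity)]
    exact max_le h1 h2
  calc _ ≤ 4 * |a - b| * d * 2 ^ (d - 1) := by gcongr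
    _ = _ := by ring

lemma enorm_homogeneous_div_sub_le {E : Type*} [NormedAddCommGroup E] (Ω : E → ℝ) {z η : E}
    (hz : 1 ≤ ‖z‖) (hη : ‖η‖ ≤ 1 / 2) (d : ℕ) :
    ‖Ω (z + η) / ‖z + η‖ ^ d - Ω z / ‖z‖ ^ d‖ₑ ≤ 2 ^ d * ‖Ω (z + η) - Ω z‖ₑ +
      ENNReal.ofReal (4 * d * 2 ^ (d - 1)) * ENNReal.ofReal ‖η‖ * ‖Ω z‖ₑ := by
  have e1 := norm_sub_le (z + η) η
  rw [add_sub_cancel_right] at e1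
  have h1 : 1 / 2 ≤ ‖z + η‖ := by linarith
  have h2 := abs_one_div_pow_sub_one_div_pow_le h1 (by linarith : 1 / 2 ≤ ‖z‖) d
  have h3 : |‖z + η‖ - ‖z‖| ≤ ‖η‖ := by
    simpa using abs_norm_sub_norm_le (z + η) z
  have h4 : 1 / ‖z + η‖ ^ d ≤ 2 ^ d := by
    rw [← one_div_pow]
    gcongr
    rw [div_le_iff₀ (by linarith)]; linarith
  have key : ‖Ω (z + η) / ‖z + η‖ ^ d - Ω z / ‖z‖ ^ d‖ ≤ 2 ^ d * ‖Ω (z + η) - Ω z‖ +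
      (4 * d * 2 ^ (d - 1)) * ‖η‖ * ‖Ω z‖ := by
    have e : Ω (z + η) / ‖z + η‖ ^ d - Ω z / ‖z‖ ^ d = 1 / ‖z + η‖ ^ d * (Ω (z + η) - Ω z) +
        (1 / ‖z + η‖ ^ d - 1 / ‖z‖ ^ d) * Ω z := by ring
    rw [e]
    refine (norm_add_le _ _).trans ?_
    rw [norm_mul, norm_mul, Real.norm_of_nonneg (by positivity : 0 ≤ 1 / ‖z + η‖ ^ d),
      Real.norm_eq_abs (1 / ‖z + η‖ ^ d - 1 / ‖z‖ ^ d)]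
    gcongr
    exact h2.trans (by gcongr)
  rw [← ofReal_norm, ← ofReal_norm, ← ofReal_norm]
  refine (ENNReal.ofReal_le_ofReal key).trans ?_
  rw [ENNReal.ofReal_add (by positivity) (by positivity), ENNReal.ofReal_mul (by positivity),
    ENNReal.ofReal_mul (by positivity), ENNReal.ofReal_mul (by positivity),
    ENNReal.ofReal_pow (by norm_num), ENNReal.ofReal_ofNat]

end HomogeneousDifference

section HomogeneousKernel

open Metric Module
open scoped ENNReal NNReal Topology RealInnerProductSpace

variable {E : Type*} [NormedAddCommGroup E] [InnerProductSpace ℝ E] [FiniteDimensional ℝ E]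
  [MeasurableSpace E] [BorelSpace E]

/-- The oscillation of `Ω` under small translations is controlled by its rotation modulus. -/
lemma IsRotationModulus.exists_lintegral_translation_le (E : Type*) [NormedAddCommGroup E]
    [InnerProductSpace ℝ E] [FiniteDimensional ℝ E] [MeasurableSpace E] [BorelSpace E] :
    ∃ c : ℝ≥0∞, c ≠ ∞ ∧ ∀ (Ω : E → ℝ) (ω : ℝ → ℝ≥0∞), Measurable Ω →
      (∀ c : ℝ, 0 < c → ∀ x : E, x ≠ 0 → Ω (c • x) = Ω x) → IsRotationModulus Ω ω →
      ∀ h : E, h ≠ 0 → ‖h‖ ≤ 1 / 48 →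
        ∫⁻ z in annulus E 1 2, ‖Ω (z + h) - Ω z‖ₑ ≤ c * ω (32 * ‖h‖) := by
  obtain ⟨c, hc, H⟩ := IsRotationModulus.exists_lintegral_nearPairs_le E
  refine ⟨2 * c * 2 ^ finrank ℝ E, by finiteness, fun Ω ω mΩ hh hω h h0 hle => ?_⟩
  set r := ‖h‖
  have hr : 0 < r := norm_pos_iff.2 h0
  set B := volume (closedBall (0 : E) r)
  have hB0 : B ≠ 0 := (measure_closedBall_pos _ _ hr).ne'
  have hB : B ≠ ∞ := measure_closedBall_lt_top.ne
  set P := ∫⁻ p in nearPairs E (2 * r), ‖Ω p.1 - Ω p.2‖ₑ ∂((volume : Measure E).prod volume)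
  have hP : P ≤ c * (2 ^ finrank ℝ E * B) * ω (32 * r) := by
    have := H Ω ω mΩ hh hω (2 * r) (by positivity) (by linarith)
    rwa [Measure.addHaar_closedBall_mul _ _ (by norm_num) hr.le, ENNReal.ofReal_pow (by norm_num),
      ENNReal.ofReal_ofNat, show 16 * (2 * r) = 32 * r by ring] at this
  set G : E × E → ℝ≥0∞ := (nearPairs E (2 * r)).indicator fun p => ‖Ω p.1 - Ω p.2‖ₑ
  have mG : Measurable G := Measurable.indicator (by fun_prop) (measurableSet_nearPairs _)
  have hPG : P = ∫⁻ z, ∫⁻ y, G (z, y) := by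
    rw [← lintegral_prod _ mG.aemeasurable, lintegral_indicator (measurableSet_nearPairs _)]
  have shift : ∀ a : E, ‖a‖ ≤ r →
      ∫⁻ z in annulus E 1 2, ∫⁻ y in closedBall (0 : E) r, ‖Ω (z + a) - Ω (z + y)‖ₑ ≤ P := by
    intro a ha
    calc _ ≤ ∫⁻ z in annulus E 1 2, ∫⁻ y in closedBall (0 : E) r, G (z + a, z + y) := by
          refine setLIntegral_mono' (measurableSet_annulus _ _) fun z hz =>
            setLIntegral_mono' measurableSet_closedBall fun y hy => ?_
          rw [mem_closedBall_zero_iff] at hy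
          have h1 := hz.1
          have h2 := hz.2
          have e1 := norm_sub_le (z + a) a
          have e2 := norm_sub_le (z + y) y
          have e3 := norm_add_le z a
          rw [add_sub_cancel_right] at e1 e2
          simp only [G]
          rw [indicator_of_mem]
          refine ⟨?_, ?_, ?_, ?_⟩ <;> dsimp only
          · linarith
          · linarith
          · linarith
          · rw [add_sub_add_left_eq_sub]
            exact (norm_sub_le _ _).trans (by linarith)
      _ ≤ ∫⁻ z, ∫⁻ y, G (z + a, z + y) :=
          (setLIntegral_le_lintegral _ _).trans (lintegral_mono fun z => setLIntegral_le_lintegral _ _)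
      _ = ∫⁻ z, ∫⁻ y, G (z + a, y) :=
          lintegral_congr fun z => lintegral_add_left_eq_self (fun y => G (z + a, y)) z
      _ = P := by
          rw [hPG]
          exact lintegral_add_right_eq_self (fun z => ∫⁻ y, G (z, y)) a
  have key : (∫⁻ z in annulus E 1 2, ‖Ω (z + h) - Ω z‖ₑ) * B ≤ 2 * P := by
    calc _ = ∫⁻ z in annulus E 1 2, ∫⁻ y in closedBall (0 : E) r, ‖Ω (z + h) - Ω z‖ₑ := by
          rw [← lintegral_mul_const' _ _ hB]
          simp_rw [setLIntegral_const]
          rfl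
      _ ≤ ∫⁻ z in annulus E 1 2, ((∫⁻ y in closedBall (0 : E) r, ‖Ω (z + h) - Ω (z + y)‖ₑ) +
            ∫⁻ y in closedBall (0 : E) r, ‖Ω (z + 0) - Ω (z + y)‖ₑ) := by
          refine lintegral_mono fun z => ?_
          rw [← lintegral_add_left (by fun_prop)]
          refine lintegral_mono fun y => ?_
          rw [← sub_sub_sub_cancel_right (Ω (z + h)) (Ω z) (Ω (z + y)), add_zero]
          exact enorm_sub_le
      _ ≤ P + P := by
          rw [lintegral_add_left]
          · exact add_le_add (shift h le_rfl) (shift 0 (by simpa using hr.le))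
          · exact Measurable.lintegral_prod_right' (f := fun p : E × E => ‖Ω (p.1 + h) - Ω (p.1 + p.2)‖ₑ)
              (by fun_prop)
      _ = _ := (two_mul _).symm
  rw [← ENNReal.mul_le_mul_iff_left hB0 hB]
  refine key.trans ((mul_le_mul_right hP _).trans (le_of_eq ?_))
  ring

lemma lintegral_annulus_eq_smul {R : ℝ} (hR : 0 < R) {G : E → ℝ≥0∞} (hG : Measurable G) :
    ∫⁻ x in annulus E R (2 * R), G x =
      ENNReal.ofReal (R ^ finrank ℝ E) * ∫⁻ z in annulus E 1 2, G (R • z) := by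
  have h := Measure.map_addHaar_smul (volume : Measure E) hR.ne'
  have e : ∫⁻ z in annulus E 1 2, G (R • z) = ∫⁻ z, (annulus E R (2 * R)).indicator G (R • z) := by
    rw [← lintegral_indicator (measurableSet_annulus _ _)]
    refine lintegral_congr fun z => ?_
    have : R • z ∈ annulus E R (2 * R) ↔ z ∈ annulus E 1 2 := by
      simp only [annulus, mem_ofPred_eq, norm_smul, Real.norm_of_nonneg hR.le,
        lt_mul_iff_one_lt_right hR,
        mul_comm 2 R, mul_le_mul_iff_right₀ hR]
    by_cases hz : z ∈ annulus E 1 2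
    · rw [indicator_of_mem hz, indicator_of_mem (this.2 hz)]
    · rw [indicator_of_notMem hz, indicator_of_notMem (fun h => hz (this.1 h))]
  rw [e, ← lintegral_map (hG.indicator (measurableSet_annulus _ _)) (by fun_prop), h,
    lintegral_smul_measure,
    lintegral_indicator (measurableSet_annulus _ _), smul_eq_mul, ← mul_assoc,
        ← ENNReal.ofReal_mul (by positivity),
    abs_of_pos (by positivity), mul_inv_cancel₀ (by positivity), ENNReal.ofReal_one, one_mul]

/-- A homogeneous kernel whose angular part is Dini continuous under rotations satisfies Hörmander's
condition. -/
lemma IsRotationModulus.exists_hormander [Nontrivial E] {Ω : E → ℝ} {ω : ℝ → ℝ≥0∞}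
    (mΩ : Measurable Ω)
    (hh : ∀ c : ℝ, 0 < c → ∀ x : E, x ≠ 0 → Ω (c • x) = Ω x) (hω : IsRotationModulus Ω ω)
    (hI : ∫⁻ θ : sphere (0 : E) 1, ‖Ω θ‖ₑ ∂(volume : Measure E).toSphere ≠ ∞)
    (hsum : ∑' i : ℕ, ω ((1 / 2) ^ (i + 1)) ≠ ∞) :
    ∃ A : ℝ≥0∞, A ≠ ∞ ∧ ∀ h : E, ∫⁻ x in {x : E | 2 * ‖h‖ < ‖x‖},
      ‖Ω (x - h) / ‖x - h‖ ^ finrank ℝ E - Ω x / ‖x‖ ^ finrank ℝ E‖ₑ ≤ A := by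
  set d := finrank ℝ E
  obtain ⟨c, hc, H⟩ := IsRotationModulus.exists_lintegral_translation_le E
  have shell : ∀ a b : ℝ, 0 < a → a < b → ∫⁻ x in annulus E a b, ‖Ω x‖ₑ ≠ ∞ := by
    intro a b ha hab
    obtain ⟨q, hq, -, h⟩ := exists_lintegral_annulus_homogeneous (E := E) ha hab
    rw [h (fun x => ‖Ω x‖ₑ) mΩ.enorm fun c hc x hx => by rw [hh c hc x hx]]
    finiteness
  set I := ∫⁻ x in annulus E (1 / 2) 3, ‖Ω x‖ₑ
  have hI' : I ≠ ∞ := shell _ _ (by norm_num) (by norm_num)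
  have crude : ∀ h : E, ‖h‖ ≤ 1 / 2 → ∫⁻ z in annulus E 1 2, ‖Ω (z + h)‖ₑ ≤ I := by
    intro h hle
    calc _ ≤ ∫⁻ z, (annulus E (1 / 2) 3).indicator (fun x => ‖Ω x‖ₑ) (z + h) := by
          rw [← lintegral_indicator (measurableSet_annulus _ _)]
          refine lintegral_mono fun z => ?_
          by_cases hz : z ∈ annulus E 1 2
          · have e1 := norm_sub_le (z + h) h
            have e2 := norm_add_le z h
            rw [add_sub_cancel_right] at e1
            have : z + h ∈ annulus E (1 / 2) 3 := ⟨by linarith [hz.1], by linarith [hz.2]⟩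
            rw [indicator_of_mem hz, indicator_of_mem this]
          · rw [indicator_of_notMem hz]; exact zero_le
      _ = I := by
          rw [lintegral_add_right_eq_self ((annulus E (1 / 2) 3).indicator fun x => ‖Ω x‖ₑ) h,
            lintegral_indicator (measurableSet_annulus _ _)]
  have crude0 : ∫⁻ z in annulus E 1 2, ‖Ω z‖ₑ ≤ I := by
    simpa using crude 0 (by simp)
  set T : ℕ → ℝ≥0∞ := fun j => if j < 5 then 2 * I else c * ω ((1 / 2) ^ (j - 5 + 1))
  have hT : ∀ (j : ℕ) (η : E), ‖η‖ = (1 / 2) ^ (j + 1) →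
      ∫⁻ z in annulus E 1 2, ‖Ω (z + η) - Ω z‖ₑ ≤ T j := by
    intro j η hη
    have hle : ‖η‖ ≤ 1 / 2 := by
      rw [hη]; exact pow_le_of_le_one (by norm_num) (by norm_num) (by omega)
    by_cases hj : j < 5
    · simp only [T, hj, if_true]
      calc _ ≤ ∫⁻ z in annulus E 1 2, (‖Ω (z + η)‖ₑ + ‖Ω z‖ₑ) :=
          lintegral_mono fun z => enorm_sub_le
        _ ≤ I + I := by
            rw [lintegral_add_left (by fun_prop)]
            exact add_le_add (crude η hle) crude0
        _ = _ := (two_mul _).symm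
    · simp only [T, hj, if_false]
      obtain ⟨i, rfl⟩ : ∃ i, j = i + 5 := ⟨j - 5, by omega⟩
      have h1 : ‖η‖ ≤ 1 / 64 := by
        rw [hη, show i + 5 + 1 = i + 6 by rfl, pow_add]
        have : (1 / 2 : ℝ) ^ i ≤ 1 := pow_le_one₀ (by norm_num) (by norm_num)
        nlinarith
      have h0 : η ≠ 0 := norm_pos_iff.1 (by rw [hη]; positivity)
      have := H Ω ω mΩ hh hω η h0 (by linarith)
      rwa [hη, show 32 * (1 / 2 : ℝ) ^ (i + 5 + 1) = (1 / 2) ^ (i + 5 - 5 + 1) by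
        rw [Nat.add_sub_cancel]; ring] at this
  have hTsum : ∑' j, T j ≠ ∞ := by
    rw [← Summable.sum_add_tsum_nat_add' (k := 5) ENNReal.summable]
    refine ENNReal.add_ne_top.2 ⟨ENNReal.sum_ne_top.2 fun j hj => ?_, ?_⟩
    · simp only [T, Finset.mem_range.1 hj, if_true]; finiteness
    · have : ∀ i, T (i + 5) = c * ω ((1 / 2) ^ (i + 1)) := by intro i; simp [T]
      simp_rw [this, ENNReal.tsum_mul_left]
      finiteness
  set C₁ := ENNReal.ofReal (4 * d * 2 ^ (d - 1))
  have hgeo : ∑' j : ℕ, ENNReal.ofReal ((1 / 2) ^ (j + 1)) ≠ ∞ := by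
    rw [← ENNReal.ofReal_tsum_of_nonneg (fun _ => by positivity)
      ((summable_nat_add_iff 1).2 summable_geometric_two)]
    exact ENNReal.ofReal_ne_top
  refine ⟨∑' j, (2 ^ d * T j + C₁ * ENNReal.ofReal ((1 / 2) ^ (j + 1)) * I), ?_, fun h => ?_⟩
  · rw [ENNReal.tsum_add, ENNReal.tsum_mul_left, ENNReal.tsum_mul_right, ENNReal.tsum_mul_left]
    have : C₁ ≠ ∞ := ENNReal.ofReal_ne_top
    finiteness
  rcases eq_or_ne h 0 with rfl | h0
  · simp
  have ht : 0 < ‖h‖ := norm_pos_iff.2 h0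
  set t := ‖h‖
  have cover : {x : E | 2 * t < ‖x‖} ⊆ ⋃ j : ℕ,
      annulus E (2 ^ (j + 1) * t) (2 * (2 ^ (j + 1) * t)) := by
    intro x hx
    have hx' : 2 * t < ‖x‖ := hx
    have hex : ∃ n : ℕ, ‖x‖ ≤ 2 * (2 ^ (n + 1) * t) := by
      obtain ⟨n, hn⟩ := pow_unbounded_of_one_lt (‖x‖ / t) (one_lt_two : (1 : ℝ) < 2)
      rw [div_lt_iff₀ ht] at hn
      have : (0 : ℝ) < 2 ^ n := by positivity
      exact ⟨n, by rw [pow_succ]; nlinarith⟩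
    refine mem_iUnion.2 ⟨Nat.find hex, ?_, Nat.find_spec hex⟩
    cases hm : Nat.find hex with
    | zero => simpa using hx'
    | succ m =>
      have := not_le.1 (Nat.find_min hex (m := m) (by omega))
      rwa [pow_succ 2 (m + 1), mul_comm _ (2 : ℝ), mul_assoc]
  refine (lintegral_mono_set cover).trans ((lintegral_iUnion_le _ _).trans ?_)
  refine ENNReal.tsum_le_tsum fun j => ?_
  set R : ℝ := 2 ^ (j + 1) * t
  have hR : 0 < R := by positivity
  set η : E := R⁻¹ • (-h)
  have hη : ‖η‖ = (1 / 2) ^ (j + 1) := by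
    simp only [η, norm_smul, norm_neg, norm_inv, Real.norm_of_nonneg hR.le, R]
    rw [one_div_pow]
    field_simp
    rfl
  have hη2 : ‖η‖ ≤ 1 / 2 := by
    rw [hη]; exact pow_le_of_le_one (by norm_num) (by norm_num) (by omega)
  rw [lintegral_annulus_eq_smul hR (by fun_prop), ← lintegral_const_mul' _ _ ENNReal.ofReal_ne_top]
  calc _ = ∫⁻ z in annulus E 1 2, ‖Ω (z + η) / ‖z + η‖ ^ d - Ω z / ‖z‖ ^ d‖ₑ := by
        refine setLIntegral_congr_fun (measurableSet_annulus _ _) fun z hz => ?_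
        have e1 : R • z - h = R • (z + η) := by
          simp only [η]; rw [smul_add, smul_inv_smul₀ hR.ne', sub_eq_add_neg]
        have hz0 : z ≠ 0 := norm_ne_zero_iff.1 (by linarith [hz.1])
        have hzη0 : z + η ≠ 0 := by
          have := norm_sub_le (z + η) η
          rw [add_sub_cancel_right] at this
          exact norm_ne_zero_iff.1 (by linarith [hz.1])
        rw [e1, hh R hR _ hz0, hh R hR _ hzη0, norm_smul, norm_smul, Real.norm_of_nonneg hR.le,
          ← ofReal_norm, ← ofReal_norm, ← ENNReal.ofReal_mul (by positivity),
          ← Real.norm_of_nonneg (by positivity : 0 ≤ R ^ finrank ℝ E), ← norm_mul]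
        congr 2
        rw [mul_pow R ‖z + η‖, mul_pow R ‖z‖, mul_sub,
          ← mul_div_assoc, ← mul_div_assoc]
        congr 1 <;> exact mul_div_mul_left _ _ (by positivity)
    _ ≤ ∫⁻ z in annulus E 1 2, (2 ^ d * ‖Ω (z + η) - Ω z‖ₑ + C₁ * ENNReal.ofReal ‖η‖ * ‖Ω z‖ₑ) :=
        setLIntegral_mono' (measurableSet_annulus _ _) fun z hz =>
          enorm_homogeneous_div_sub_le Ω hz.1.le hη2 d
    _ ≤ _ := by
        rw [lintegral_add_left (by fun_prop), lintegral_const_mul' _ _ (by finiteness),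
          lintegral_const_mul' _ _ (by finiteness), hη]
        gcongr
        exact hT j η hη

end HomogeneousKernel

section RoughKernel

open Metric Module
open scoped ENNReal NNReal Topology

variable {E : Type*} [NormedAddCommGroup E] [InnerProductSpace ℝ E] [FiniteDimensional ℝ E]
  [MeasurableSpace E] [BorelSpace E]

lemma setIntegral_annulus_homogeneous_div_eq_zero [Nontrivial E] {Ω : E → ℝ} (mΩ : Measurable Ω)
    (hh : ∀ c : ℝ, 0 < c → ∀ x : E, x ≠ 0 → Ω (c • x) = Ω x)
    (hmean : ∫ θ : sphere (0 : E) 1, Ω θ ∂(volume : Measure E).toSphere = 0)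
    (hI : ∫⁻ θ : sphere (0 : E) 1, ‖Ω θ‖ₑ ∂(volume : Measure E).toSphere ≠ ∞) (a b : ℝ) :
    ∫ x in annulus E a b, Ω x / ‖x‖ ^ finrank ℝ E = 0 := by
  by_cases h_int : IntegrableOn (fun x : E => Ω x / ‖x‖ ^ finrank ℝ E) (annulus E a b)
  swap
  · exact integral_undef h_int
  have hΩ : Integrable (fun θ : sphere (0 : E) 1 => Ω θ) (volume : Measure E).toSphere :=
    ⟨(mΩ.comp measurable_subtype_coe).aestronglyMeasurable, hI.lt_top⟩
  have polar : ∀ Ω' : E → ℝ, Measurable Ω' → (∀ c : ℝ, 0 < c → ∀ x : E, x ≠ 0 → Ω' (c • x) = Ω' x) →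
      ∫⁻ x in annulus E a b, ENNReal.ofReal (Ω' x / ‖x‖ ^ finrank ℝ E) =
      (∫⁻ θ : sphere (0 : E) 1, ENNReal.ofReal (Ω' θ) ∂(volume : Measure E).toSphere) *
        ∫⁻ r : Ioi (0 : ℝ), (Ioc a b).indicator (fun r => ENNReal.ofReal (1 / r ^ finrank ℝ E)) r
          ∂(Measure.volumeIoiPow (finrank ℝ E - 1)) := by
    intro Ω' mΩ' hh'
    rw [← lintegral_annulus_homogeneous_div a b (G := fun x => ENNReal.ofReal (Ω' x)) (by fun_prop)
      fun c hc x hx => by rw [hh' c hc x hx]]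
    refine lintegral_congr fun x => ?_
    rw [← ENNReal.ofReal_mul' (by positivity), mul_one_div]
  rw [integral_eq_lintegral_pos_part_sub_lintegral_neg_part hΩ, sub_eq_zero] at hmean
  rw [integral_eq_lintegral_pos_part_sub_lintegral_neg_part h_int, sub_eq_zero, polar Ω mΩ hh]
  simp_rw [← neg_div]
  rw [polar (fun x => -Ω x) mΩ.neg fun c hc x hx => by rw [hh c hc x hx], ENNReal.toReal_mul,
    ENNReal.toReal_mul, hmean]

lemma setLIntegral_annulus_homogeneous_div_le [Nontrivial E] {Ω : E → ℝ} (mΩ : Measurable Ω)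
    (hh : ∀ c : ℝ, 0 < c → ∀ x : E, x ≠ 0 → Ω (c • x) = Ω x) {R : ℝ} (hR : 0 < R) :
    ∫⁻ x in annulus E R (2 * R), ‖Ω x / ‖x‖ ^ finrank ℝ E‖ₑ ≤
      (∫⁻ θ : sphere (0 : E) 1, ‖Ω θ‖ₑ ∂(volume : Measure E).toSphere) *
        ENNReal.ofReal (4 ^ finrank ℝ E) := by
  calc _ = ∫⁻ x in annulus E R (2 * R), ‖Ω x‖ₑ * ENNReal.ofReal (1 / ‖x‖ ^ finrank ℝ E) := by
        refine lintegral_congr fun x => ?_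
        rw [← ofReal_norm, ← ofReal_norm, ← ENNReal.ofReal_mul (norm_nonneg _), mul_one_div,
          norm_div,
          norm_pow, norm_norm]
    _ ≤ _ := by
        rw [lintegral_annulus_homogeneous_div _ _ (G := fun x => ‖Ω x‖ₑ) mΩ.enorm
          fun c hc x hx => by rw [hh c hc x hx]]
        gcongr
        refine (lintegral_indicator_div_volumeIoiPow_le hR (by linarith) _ finrank_pos).trans ?_
        rw [show 2 * (2 * R) / R = 4 by field_simp; norm_num]

lemma IsRotationModulus.exists_isCZKernel [Nontrivial E] {Ω : E → ℝ} {ω : ℝ → ℝ≥0∞}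
    (mΩ : Measurable Ω)
    (hh : ∀ c : ℝ, 0 < c → ∀ x : E, x ≠ 0 → Ω (c • x) = Ω x) (hω : IsRotationModulus Ω ω)
    (hmean : ∫ θ : sphere (0 : E) 1, Ω θ ∂(volume : Measure E).toSphere = 0)
    (hI : ∫⁻ θ : sphere (0 : E) 1, ‖Ω θ‖ₑ ∂(volume : Measure E).toSphere ≠ ∞)
    (hsum : ∑' i : ℕ, ω ((1 / 2) ^ (i + 1)) ≠ ∞) :
    ∃ A : ℝ≥0, IsCZKernel (fun x => Ω x / ‖x‖ ^ finrank ℝ E) A := by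
  obtain ⟨A, hA, H⟩ := hω.exists_hormander mΩ hh hI hsum
  set B := (∫⁻ θ : sphere (0 : E) 1, ‖Ω θ‖ₑ ∂(volume : Measure E).toSphere) *
        ENNReal.ofReal (4 ^ finrank ℝ E)
  have hB : B ≠ ∞ := ENNReal.mul_ne_top hI ENNReal.ofReal_ne_top
  have e : ((A + B).toNNReal : ℝ≥0∞) = A + B := ENNReal.coe_toNNReal (by finiteness)
  refine ⟨(A + B).toNNReal, by fun_prop, fun R hR => ?_, fun a _ b => ?_, fun h => ?_⟩
  · rw [e]
    exact (setLIntegral_annulus_homogeneous_div_le mΩ hh hR).trans le_add_self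
  · exact setIntegral_annulus_homogeneous_div_eq_zero mΩ hh hmean hI a b
  · rw [e]
    exact (H h).trans le_self_add

end RoughKernel

section DyadicSum

open scoped ENNReal

/-- A Dini integral dominates the corresponding dyadic sum. -/
lemma tsum_ofReal_dyadic_le {ω : ℝ → ℝ} (hmono : MonotoneOn ω (Ioi 0)) (h0 : ∀ δ, 0 < δ → 0 ≤ ω δ) :
    ∑' i : ℕ, ENNReal.ofReal (ω ((1 / 2) ^ (i + 1))) ≤
      2 * ∫⁻ δ in Ioo (0 : ℝ) 1, ENNReal.ofReal (ω δ / δ) := by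
  have hanti : Antitone fun i : ℕ => ((1 : ℝ) / 2) ^ i :=
    pow_right_anti₀ (by norm_num) (by norm_num)
  calc _ ≤ ∑' i : ℕ, 2 * ∫⁻ δ in Ioo (((1 : ℝ) / 2) ^ (i + 1)) ((1 / 2) ^ i),
      ENNReal.ofReal (ω δ / δ) := by
        refine ENNReal.tsum_le_tsum fun i => ?_
        have hp : (0 : ℝ) < (1 / 2) ^ (i + 1) := by positivity
        have hω := h0 _ hp
        have : ENNReal.ofReal (ω ((1 / 2) ^ (i + 1)) / (1 / 2) ^ i) *
            volume (Ioo (((1 : ℝ) / 2) ^ (i + 1)) ((1 / 2) ^ i)) ≤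
            ∫⁻ δ in Ioo (((1 : ℝ) / 2) ^ (i + 1)) ((1 / 2) ^ i), ENNReal.ofReal (ω δ / δ) := by
          rw [← setLIntegral_const]
          refine setLIntegral_mono' measurableSet_Ioo fun δ hδ => ?_
          have hδ0 := hp.trans hδ.1
          have h1 := hmono hp hδ0 hδ.1.le
          have h2 := h0 _ hδ0
          have h3 := hδ.2.le
          exact ENNReal.ofReal_le_ofReal (by gcongr)
        refine le_trans (le_of_eq ?_) (mul_le_mul_right this 2)
        rw [Real.volume_Ioo, ← ENNReal.ofReal_mul (by positivity),
          show (2 : ℝ≥0∞) = ENNReal.ofReal 2 by simp, ← ENNReal.ofReal_mul (by norm_num)]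
        congr 1
        rw [pow_succ]
        field_simp
        norm_num
    _ = 2 * ∫⁻ δ in ⋃ i : ℕ, Ioo (((1 : ℝ) / 2) ^ (i + 1)) ((1 / 2) ^ i),
        ENNReal.ofReal (ω δ / δ) := by
        rw [ENNReal.tsum_mul_left]
        exact congrArg (2 * ·) (lintegral_iUnion (fun _ => measurableSet_Ioo)
          hanti.pairwise_disjoint_on_Ioo_succ _).symm
    _ ≤ _ := by
        refine mul_le_mul_right (lintegral_mono_set (iUnion_subset fun i => ?_)) 2
        exact Ioo_subset_Ioo (by positivity) (pow_le_one₀ (by norm_num) (by norm_num))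

end DyadicSum

section Sphere

open Metric Module
open scoped ENNReal NNReal Topology Pointwise

variable {E : Type*} [NormedAddCommGroup E] [InnerProductSpace ℝ E] [FiniteDimensional ℝ E]
  [MeasurableSpace E] [BorelSpace E]

lemma LinearIsometryEquiv.measurePreserving_sphere (ρ : E ≃ₗᵢ[ℝ] E) :
    MeasurePreserving (fun θ : sphere (0 : E) 1 => (⟨ρ θ, by simp⟩ : sphere (0 : E) 1))
      (volume : Measure E).toSphere (volume : Measure E).toSphere := by
  have hm : Measurable (fun θ : sphere (0 : E) 1 => (⟨ρ θ, by simp⟩ : sphere (0 : E) 1)) :=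
    (ρ.continuous.measurable.comp measurable_subtype_coe).subtype_mk
  refine ⟨hm, Measure.ext fun s hs => ?_⟩
  rw [Measure.map_apply hm hs, Measure.toSphere_apply' _ hs, Measure.toSphere_apply' _ (hm hs),
    ← ρ.measurePreserving.measure_preimage_emb ρ.toHomeomorph.measurableEmbedding
      (Ioo (0 : ℝ) 1 • (Subtype.val '' s))]
  congr 2
  ext x
  simp only [mem_preimage, Set.mem_smul, mem_image]
  constructor
  · rintro ⟨r, hr, _, ⟨θ, hθ, rfl⟩, rfl⟩
    exact ⟨r, hr, _, ⟨_, hθ, rfl⟩, by simp⟩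
  · rintro ⟨r, hr, _, ⟨θ, hθ, rfl⟩, h⟩
    refine ⟨r, hr, _, ⟨⟨ρ.symm θ, by simp⟩, ?_, rfl⟩, ρ.injective ?_⟩
    · simpa using hθ
    · simpa using h

lemma ae_eq_of_ae_eq_sphere {β : Type*} {F G : E → β}
    (hF : ∀ c : ℝ, 0 < c → ∀ x : E, x ≠ 0 → F (c • x) = F x)
    (hG : ∀ c : ℝ, 0 < c → ∀ x : E, x ≠ 0 → G (c • x) = G x)
    (h : ∀ᵐ θ ∂(volume : Measure E).toSphere, F (θ : sphere (0 : E) 1) = G θ) [Nontrivial E] :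
    F =ᵐ[volume] G := by
  have h1 := (volume : Measure E).measurePreserving_homeomorphUnitSphereProd.quasiMeasurePreserving.ae
    (Measure.quasiMeasurePreserving_fst.ae h)
  have h2 : ∀ᵐ x ∂(volume : Measure E), x ∈ ({0}ᶜ : Set E) := by
    rw [ae_iff]; simp
  replace h1 : ∀ᵐ x : ({0}ᶜ : Set E) ∂(volume : Measure E).comap Subtype.val,
      F (‖x.1‖⁻¹ • x.1) = G (‖x.1‖⁻¹ • x.1) := by simpa using h1
  rw [← ae_restrict_iff_subtype (p := fun x => F (‖x‖⁻¹ • x) = G (‖x‖⁻¹ • x))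
    (measurableSet_singleton (0 : E)).compl,
        ae_restrict_iff' (measurableSet_singleton _).compl] at h1
  filter_upwards [h1, h2] with x hx hx0
  have hx0' : x ≠ 0 := hx0
  have := hx hx0
  rwa [hF _ (by positivity) x hx0, hG _ (by positivity) x hx0] at this

lemma exists_measurable_homogeneous_ae_eq {Ω : E → ℝ}
    (hΩ : AEStronglyMeasurable (fun θ : sphere (0 : E) 1 => Ω θ) (volume : Measure E).toSphere) :
    ∃ Ω' : E → ℝ, Measurable Ω' ∧ (∀ c : ℝ, 0 < c → ∀ x : E, x ≠ 0 → Ω' (c • x) = Ω' x) ∧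
      ∀ᵐ θ ∂(volume : Measure E).toSphere, Ω (θ : sphere (0 : E) 1) = Ω' θ := by
  obtain ⟨g, hg, he⟩ := (MeasurableEmbedding.subtype_coe
    (isClosed_sphere (x := (0 : E)) (ε := 1)).measurableSet).exists_measurable_extend
    hΩ.stronglyMeasurable_mk.measurable (fun _ => ⟨(0 : ℝ)⟩)
  refine ⟨fun x => g (‖x‖⁻¹ • x), by fun_prop, fun c hc x hx => ?_, ?_⟩
  · have : ‖c • x‖⁻¹ • c • x = ‖x‖⁻¹ • x := by
      rw [norm_smul, Real.norm_of_nonneg hc.le, smul_smul, mul_inv, mul_right_comm,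
        inv_mul_cancel₀ hc.ne', one_mul]
    simp only [this]
  · filter_upwards [hΩ.ae_eq_mk] with θ hθ
    have h1 : ‖θ.1‖ = 1 := by simp
    rw [hθ, ← he]
    simp [h1]

end Sphere

section DiniKernel

open Metric Module
open scoped ENNReal NNReal Topology

variable {n : ℕ} {Ω : EuclideanSpace ℝ (Fin n) → ℝ}

lemma measurePreserving_sphereMeasure
    (ρ : EuclideanSpace ℝ (Fin n) ≃ₗᵢ[ℝ] EuclideanSpace ℝ (Fin n)) :
    MeasurePreserving (fun θ : unitSphere n => (⟨ρ θ, by simp⟩ : unitSphere n))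
      (sphereMeasure n) (sphereMeasure n) :=
  LinearIsometryEquiv.measurePreserving_sphere ρ

lemma Integrable.sphere_comp_linearIsometryEquiv
    (hΩ : Integrable (fun θ : unitSphere n => Ω θ) (sphereMeasure n))
    (ρ : EuclideanSpace ℝ (Fin n) ≃ₗᵢ[ℝ] EuclideanSpace ℝ (Fin n)) :
    Integrable (fun θ : unitSphere n => Ω (ρ θ)) (sphereMeasure n) :=
  (measurePreserving_sphereMeasure ρ).integrable_comp_of_integrable hΩ

lemma integral_abs_comp_sub_le
    (hΩ : Integrable (fun θ : unitSphere n => Ω θ) (sphereMeasure n))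
    (ρ : EuclideanSpace ℝ (Fin n) ≃ₗᵢ[ℝ] EuclideanSpace ℝ (Fin n)) :
    ∫ θ : unitSphere n, |Ω (ρ θ) - Ω θ| ∂(sphereMeasure n) ≤
      2 * ∫ θ : unitSphere n, |Ω θ| ∂(sphereMeasure n) := by
  have hρ := measurePreserving_sphereMeasure ρ
  have h1 := Integrable.sphere_comp_linearIsometryEquiv hΩ ρ
  have h2 : ∫ θ : unitSphere n, |Ω (ρ θ)| ∂(sphereMeasure n) =
      ∫ θ : unitSphere n, |Ω θ| ∂(sphereMeasure n) := by
    have hm := hΩ.abs.aestronglyMeasurable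
    rw [← hρ.map_eq] at hm
    have := integral_map hρ.measurable.aemeasurable hm
    rw [hρ.map_eq] at this
    exact this.symm
  calc _ ≤ ∫ θ : unitSphere n, (|Ω (ρ θ)| + |Ω θ|) ∂(sphereMeasure n) :=
        integral_mono (h1.sub hΩ).abs (h1.abs.add hΩ.abs) fun θ => abs_sub _ _
    _ = _ := by rw [integral_add h1.abs hΩ.abs, h2, two_mul]

lemma integral_abs_comp_sub_le_omegaRot
    (hΩ : Integrable (fun θ : unitSphere n => Ω θ) (sphereMeasure n))
    {ρ : EuclideanSpace ℝ (Fin n) ≃ₗᵢ[ℝ] EuclideanSpace ℝ (Fin n)} {δ : ℝ}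
    (hdet : LinearMap.det (ρ.toLinearEquiv : EuclideanSpace ℝ (Fin n) →ₗ[ℝ] EuclideanSpace ℝ (Fin n)) = 1)
    (hδ : ∀ x, ‖x‖ = 1 → ‖ρ x - x‖ ≤ δ) :
    ∫ θ : unitSphere n, |Ω (ρ θ) - Ω θ| ∂(sphereMeasure n) ≤ omegaRot n Ω δ :=
  le_csSup ⟨_, by rintro _ ⟨σ, -, -, rfl⟩; exact integral_abs_comp_sub_le hΩ σ⟩ ⟨ρ, hdet, hδ, rfl⟩

lemma omegaRot_nonneg (δ : ℝ) : 0 ≤ omegaRot n Ω δ :=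
  Real.sSup_nonneg (by rintro _ ⟨σ, -, -, rfl⟩; exact integral_nonneg fun _ => abs_nonneg _)

lemma omegaRot_monotoneOn (hΩ : Integrable (fun θ : unitSphere n => Ω θ) (sphereMeasure n)) :
    MonotoneOn (omegaRot n Ω) (Ioi 0) := by
  intro δ hδ δ' _ hle
  refine csSup_le ⟨_, LinearIsometryEquiv.refl ℝ _, ?_, ?_, rfl⟩ ?_
  · exact LinearMap.det_id
  · intro x _; simpa using le_of_lt hδ
  · rintro _ ⟨σ, hσ, hσδ, rfl⟩
    exact integral_abs_comp_sub_le_omegaRot hΩ hσ fun x hx => (hσδ x hx).trans hle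

lemma lintegral_enorm_comp_sub_congr {Ω' : EuclideanSpace ℝ (Fin n) → ℝ}
    (he : ∀ᵐ θ ∂(sphereMeasure n), Ω (θ : unitSphere n) = Ω' θ)
    (ρ : EuclideanSpace ℝ (Fin n) ≃ₗᵢ[ℝ] EuclideanSpace ℝ (Fin n)) :
    ∫⁻ θ : unitSphere n, ‖Ω' (ρ θ) - Ω' θ‖ₑ ∂(sphereMeasure n) =
      ∫⁻ θ : unitSphere n, ‖Ω (ρ θ) - Ω θ‖ₑ ∂(sphereMeasure n) := by
  refine lintegral_congr_ae ?_
  filter_upwards [he, (measurePreserving_sphereMeasure ρ).quasiMeasurePreserving.ae he] with θ h1 h2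
  rw [h1, h2]

lemma isRotationModulus_omegaRot (hΩ : Integrable (fun θ : unitSphere n => Ω θ) (sphereMeasure n))
    {Ω' : EuclideanSpace ℝ (Fin n) → ℝ} (mΩ' : Measurable Ω')
    (hh' : ∀ c : ℝ, 0 < c → ∀ x, x ≠ 0 → Ω' (c • x) = Ω' x)
    (he : ∀ᵐ θ ∂(sphereMeasure n), Ω (θ : unitSphere n) = Ω' θ) {c : ℝ≥0∞}
    (hc : ∀ G : EuclideanSpace ℝ (Fin n) → ℝ≥0∞, Measurable G →
      (∀ c : ℝ, 0 < c → ∀ x, x ≠ 0 → G (c • x) = G x) →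
      ∫⁻ x in annulus (EuclideanSpace ℝ (Fin n)) 1 2, G x =
          c * ∫⁻ θ : unitSphere n, G θ ∂(sphereMeasure n)) :
    IsRotationModulus Ω' fun δ => c * ENNReal.ofReal (omegaRot n Ω δ) := by
  intro ρ δ hdet hδ
  have mρ : Measurable ρ := ρ.continuous.measurable
  rw [hc (fun w => ‖Ω' (ρ w) - Ω' w‖ₑ) (by fun_prop), lintegral_enorm_comp_sub_congr he]
  · have h1 := (Integrable.sphere_comp_linearIsometryEquiv hΩ ρ).sub hΩ
    refine mul_le_mul_right ((ofReal_integral_norm_eq_lintegral_enorm h1).symm.le.trans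
      (ENNReal.ofReal_le_ofReal ?_)) c
    exact integral_abs_comp_sub_le_omegaRot hΩ hdet hδ
  · intro r hr x hx
    rw [map_smul, hh' r hr x hx, hh' r hr _ (by simpa using hx)]

lemma L1Dini.exists_isCZKernel (hn : 0 < n)
    (hmean : ∫ θ : unitSphere n, Ω θ ∂(sphereMeasure n) = 0) (hdini : L1Dini n Ω) :
    ∃ Ω' : EuclideanSpace ℝ (Fin n) → ℝ, Measurable Ω' ∧
      (∀ c : ℝ, 0 < c → ∀ x, x ≠ 0 → Ω' (c • x) = Ω' x) ∧
      (∀ᵐ θ ∂(sphereMeasure n), Ω (θ : unitSphere n) = Ω' θ) ∧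
      ∃ A : ℝ≥0, IsCZKernel (fun x => Ω' x / ‖x‖ ^ n) A := by
  have : Nonempty (Fin n) := ⟨⟨0, hn⟩⟩
  obtain ⟨hΩ, h_int⟩ := hdini
  obtain ⟨Ω', mΩ', hh', he⟩ := exists_measurable_homogeneous_ae_eq hΩ.aestronglyMeasurable
  obtain ⟨c, hc, -, H⟩ := exists_lintegral_annulus_homogeneous
    (E := EuclideanSpace ℝ (Fin n)) (a := 1) (b := 2) (by norm_num) (by norm_num)
  have hsum : ∑' i : ℕ, c * ENNReal.ofReal (omegaRot n Ω ((1 / 2) ^ (i + 1))) ≠ ∞ := by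
    rw [ENNReal.tsum_mul_left]
    refine ENNReal.mul_ne_top hc (ne_top_of_le_ne_top ?_
      (tsum_ofReal_dyadic_le (omegaRot_monotoneOn hΩ) fun δ _ => omegaRot_nonneg δ))
    exact ENNReal.mul_ne_top (by simp) h_int.ne
  have hfr : finrank ℝ (EuclideanSpace ℝ (Fin n)) = n := by simp
  obtain ⟨A, hA⟩ := (isRotationModulus_omegaRot hΩ mΩ' hh' he H).exists_isCZKernel mΩ' hh'
    ((integral_congr_ae he).symm.trans hmean)
    (hΩ.congr he).2.ne hsum
  rw [hfr] at hA
  exact ⟨Ω', mΩ', hh', he, A, hA⟩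

end DiniKernel

section DensityTransform

open Metric Module
open scoped ENNReal NNReal Topology Pointwise

lemma toJordanDecomposition_withDensityᵥ {α : Type*} [MeasurableSpace α] {ν : Measure α} {f : α → ℝ}
    (mf : Measurable f) (hf : Integrable f ν) :
    (SignedMeasure.toJordanDecomposition (ν.withDensityᵥ f)).posPart =
        ν.withDensity (fun x => ENNReal.ofReal (f x)) ∧
    (SignedMeasure.toJordanDecomposition (ν.withDensityᵥ f)).negPart =
      ν.withDensity (fun x => ENNReal.ofReal (-f x)) := by
  have h := SignedMeasure.toJordanDecomposition_eq_of_eq_add_withDensity (s := ν.withDensityᵥ f) (t := 0)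
    mf hf (VectorMeasure.MutuallySingular.zero_left) (zero_add _).symm
  rw [h]
  simp [SignedMeasure.toJordanDecomposition_zero]

lemma setIntegral_jordan_withDensityᵥ {α : Type*} [MeasurableSpace α] {ν : Measure α} {f k : α → ℝ}
    (mf : Measurable f) (hf : Integrable f ν) {s : Set α} (hs : MeasurableSet s)
    (hk : AEStronglyMeasurable k ν) (hkf : IntegrableOn (fun y => k y * f y) s ν) :
    (∫ y in s, k y ∂(SignedMeasure.toJordanDecomposition (ν.withDensityᵥ f)).posPart) -
      (∫ y in s, k y ∂(SignedMeasure.toJordanDecomposition (ν.withDensityᵥ f)).negPart) =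
          ∫ y in s, k y * f y ∂ν := by
  have hm : ∀ g : α → ℝ, Measurable g →
      AEStronglyMeasurable (fun y => (ENNReal.ofReal (g y)).toReal • k y) (ν.restrict s) :=
    fun g mg => mg.ennreal_ofReal.ennreal_toReal.aestronglyMeasurable.smul hk.restrict
  rw [(toJordanDecomposition_withDensityᵥ mf hf).1, (toJordanDecomposition_withDensityᵥ mf hf).2,
    setIntegral_withDensity_eq_setIntegral_toReal_smul (by fun_prop) (by simp) _ hs,
    setIntegral_withDensity_eq_setIntegral_toReal_smul (by fun_prop) (by simp) _ hs, ← integral_sub]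
  · refine integral_congr_ae (.of_forall fun y => ?_)
    simp only [smul_eq_mul, ENNReal.toReal_ofReal']
    rw [← sub_mul, max_zero_sub_max_neg_zero_eq_self, mul_comm]
  all_goals
    refine Integrable.mono (μ := ν.restrict s) hkf
      (hm _ (by fun_prop)) (.of_forall fun y => ?_)
    rw [smul_eq_mul, norm_mul, norm_mul, mul_comm]
    gcongr
    rw [ENNReal.toReal_ofReal', Real.norm_of_nonneg (by positivity)]
    first
    | exact max_le (Real.le_norm_self _) (norm_nonneg _)
    | exact max_le (by rw [← norm_neg]; exact Real.le_norm_self _) (norm_nonneg _)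

variable {E : Type*} [NormedAddCommGroup E] [InnerProductSpace ℝ E] [FiniteDimensional ℝ E]
  [MeasurableSpace E] [BorelSpace E]

/-- The density of the dilate of a measure with density `f`. -/
def dilateDensity (t : ℝ) (f : E → ℝ) (x : E) : ℝ := (t ^ finrank ℝ E)⁻¹ * f (t⁻¹ • x)

omit [FiniteDimensional ℝ E] in
lemma measurable_dilateDensity (t : ℝ) {f : E → ℝ} (mf : Measurable f) :
    Measurable (dilateDensity t f) := by
  unfold dilateDensity; fun_prop

lemma integrable_dilateDensity {t : ℝ} (ht : 0 < t) {f : E → ℝ} (hf : Integrable f) :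
    Integrable (dilateDensity t f) :=
  (hf.comp_smul (inv_pos.2 ht).ne').const_mul _

lemma map_smul_withDensityᵥ {t : ℝ} (ht : 0 < t) {f : E → ℝ} (hf : Integrable f) :
    ((volume : Measure E).withDensityᵥ f).map (fun y => t • y) =
      (volume : Measure E).withDensityᵥ (dilateDensity t f) := by
  ext s hs
  have ms : Measurable (fun y : E => t • y) := by fun_prop
  rw [VectorMeasure.map_apply _ ms hs, withDensityᵥ_apply hf (ms hs),
    withDensityᵥ_apply (integrable_dilateDensity ht hf) hs]
  unfold dilateDensity
  rw [integral_const_mul, Measure.setIntegral_comp_smul_of_pos _ _ _ (inv_pos.2 ht), inv_pow,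
    inv_inv,
    smul_eq_mul, inv_mul_cancel_left₀ (by positivity), preimage_smul₀ ht.ne']

lemma truncConv_dilateDensity {K : E → ℝ} {t : ℝ} (ht : 0 < t)
    (hK : ∀ x : E, K (t • x) = (t ^ finrank ℝ E)⁻¹ * K x) (ε : ℝ) (f : E → ℝ) (x : E) :
    truncConv K ε (dilateDensity t f) x =
      (t ^ finrank ℝ E)⁻¹ * truncConv K (ε / t) f (t⁻¹ • x) := by
  have hset : t⁻¹ • {y : E | ε < ‖x - y‖} = {y : E | ε / t < ‖t⁻¹ • x - y‖} := by
    ext y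
    rw [mem_inv_smul_set_iff₀ ht.ne', mem_ofPred_eq, mem_ofPred_eq, div_lt_iff₀' ht,
      ← Real.norm_of_nonneg ht.le, ← norm_smul, smul_sub, Real.norm_of_nonneg ht.le,
          smul_inv_smul₀ ht.ne']
  unfold truncConv dilateDensity
  rw [← hset]
  have := Measure.setIntegral_comp_smul_of_pos (volume : Measure E)
    (fun z => K (t⁻¹ • x - z) * f z) {y : E | ε < ‖x - y‖} (inv_pos.2 ht)
  rw [inv_pow, inv_inv, smul_eq_mul, ← inv_mul_eq_iff_eq_mul₀ (by positivity)] at this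
  rw [← this, ← integral_const_mul, ← integral_const_mul]
  refine integral_congr_ae (.of_forall fun y => ?_)
  have : K (x - y) = (t ^ finrank ℝ E)⁻¹ * K (t⁻¹ • x - t⁻¹ • y) := by
    rw [← hK, ← smul_sub, smul_inv_smul₀ ht.ne']
  simp only [this]
  ring

lemma IsCZKernel.ae_tendsto_truncConv_dilateDensity [Nontrivial E] {K : E → ℝ} {A : ℝ≥0}
    (hK : IsCZKernel K A) {t : ℝ}
    (ht : 0 < t) (hKt : ∀ x : E,
        K (t • x) = (t ^ finrank ℝ E)⁻¹ * K x) {f : E → ℝ} (hf : Integrable f) :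
    ∀ᵐ x, Tendsto (fun ε => truncConv K ε (dilateDensity t f) x) (𝓝[>] 0)
      (𝓝 ((t ^ finrank ℝ E)⁻¹ * pvConv K f (t⁻¹ • x))) := by
  have h := (Measure.quasiMeasurePreserving_smul (volume : Measure E) (inv_pos.2 ht).ne').ae
    (hK.tendsto_pvConv hf)
  filter_upwards [h] with x hx
  simp_rw [truncConv_dilateDensity ht hKt]
  refine (hx.comp ?_).const_mul _
  refine tendsto_nhdsWithin_iff.2 ⟨?_, ?_⟩
  · have : Tendsto (fun ε : ℝ => ε / t) (𝓝 0) (𝓝 (0 / t)) := (continuous_id.div_const t).tendsto 0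
    rw [zero_div] at this
    exact this.mono_left nhdsWithin_le_nhds
  · filter_upwards [self_mem_nhdsWithin] with ε hε
    exact div_pos hε ht

/-- The distribution function of the principal value transform of a dilated density. -/
lemma IsCZKernel.tendsto_mul_volume_dilate [Nontrivial E] {K : E → ℝ} {A : ℝ≥0}
    (hK : IsCZKernel K A)
    {W : ℝ≥0∞} (hW : W ≠ ∞) (hKW : ∀ a : ℝ, 0 < a → volume {x | a < |K x|} = W / ENNReal.ofReal a)
    {f : E → ℝ} (hf : Integrable f) {lam : ℝ} (hlam : 0 < lam) :
    Tendsto (fun t : ℝ => ENNReal.ofReal lam *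
      volume {x : E | lam < |(t ^ finrank ℝ E)⁻¹ * pvConv K f (t⁻¹ • x)|}) (𝓝[>] 0)
      (𝓝 (W * ENNReal.ofReal |∫ x, f x|)) := by
  have hs : Tendsto (fun t : ℝ => lam * t ^ finrank ℝ E) (𝓝[>] 0) (𝓝[>] 0) := by
    refine tendsto_nhdsWithin_iff.2 ⟨?_, ?_⟩
    · have : Tendsto (fun t : ℝ => lam * t ^ finrank ℝ E) (𝓝 0) (𝓝 (lam * 0 ^ finrank ℝ E)) :=
        ((continuous_pow _).const_mul lam).tendsto 0
      rw [zero_pow finrank_pos.ne', mul_zero] at this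
      exact this.mono_left nhdsWithin_le_nhds
    · filter_upwards [self_mem_nhdsWithin] with t ht
      exact mul_pos hlam (pow_pos ht _)
  refine ((hK.tendsto_mul_volume_pvConv_gt hW hKW hf).comp hs).congr' ?_
  filter_upwards [self_mem_nhdsWithin] with t ht
  have ht' : 0 < t := ht
  have htd : 0 < t ^ finrank ℝ E := pow_pos ht' _
  have e : {x : E | lam < |(t ^ finrank ℝ E)⁻¹ * pvConv K f (t⁻¹ • x)|} =
      (t⁻¹ • ·) ⁻¹' {x : E | lam * t ^ finrank ℝ E < |pvConv K f x|} := by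
    ext x
    rw [mem_preimage, mem_ofPred_eq, mem_ofPred_eq, abs_mul, abs_of_pos (inv_pos.2 htd),
      inv_mul_eq_div, lt_div_iff₀ htd]
  rw [e, Measure.addHaar_preimage_smul _ (inv_pos.2 ht').ne', inv_pow, inv_inv, abs_of_pos htd,
    ← mul_assoc,
    ← ENNReal.ofReal_mul hlam.le]
  rfl

end DensityTransform

section Assembly

open Metric Module
open scoped ENNReal NNReal Topology

variable {n : ℕ} {Ω Ω' : EuclideanSpace ℝ (Fin n) → ℝ}

lemma truncT_withDensityᵥ (he : Ω =ᵐ[volume] Ω') (mΩ' : Measurable Ω')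
    {f : EuclideanSpace ℝ (Fin n) → ℝ} (mf : Measurable f) (hf : Integrable f)
    {x : EuclideanSpace ℝ (Fin n)} {ε : ℝ}
    (hx : IntegrableOn (fun y => Ω' (x - y) / ‖x - y‖ ^ n * f y) {y | ε < ‖x - y‖}) :
    truncT n Ω (volume.withDensityᵥ f) x ε = truncConv (fun z => Ω' z / ‖z‖ ^ n) ε f x := by
  have he' : ∀ᵐ y, Ω (x - y) = Ω' (x - y) :=
    (quasiMeasurePreserving_sub_left_of_right_invariant volume x).ae he
  have hk : (fun y => Ω' (x - y) / ‖x - y‖ ^ n) =ᵐ[volume] fun y => Ω (x - y) / ‖x - y‖ ^ n := by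
    filter_upwards [he'] with y hy
    rw [hy]
  have hs := measurableSet_lt_norm_sub ε x
  have hkf : (fun y => Ω' (x - y) / ‖x - y‖ ^ n * f y) =ᵐ[volume]
      fun y => Ω (x - y) / ‖x - y‖ ^ n * f y := hk.mul .rfl
  rw [truncT, setIntegral_jordan_withDensityᵥ mf hf hs
    ((Measurable.aestronglyMeasurable (by fun_prop)).congr hk)
    (hx.congr (ae_restrict_of_ae hkf)), truncConv]
  exact (integral_congr_ae (ae_restrict_of_ae hkf)).symm

/-- Identification of the principal value integral of a dilated absolutely continuous measure. -/
lemma ae_TOmega_map_smul [NeZero n] (he : Ω =ᵐ[volume] Ω') (mΩ' : Measurable Ω')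
    (hh' : ∀ c : ℝ, 0 < c → ∀ x, x ≠ 0 → Ω' (c • x) = Ω' x) {A : ℝ≥0}
    (hK : IsCZKernel (fun z => Ω' z / ‖z‖ ^ n) A)
    {f : EuclideanSpace ℝ (Fin n) → ℝ} (mf : Measurable f) (hf : Integrable f) {t : ℝ} (ht : 0 < t) :
    ∀ᵐ x, TOmega n Ω ((volume.withDensityᵥ f).map (fun y => t • y)) x =
      (t ^ n)⁻¹ * pvConv (fun z => Ω' z / ‖z‖ ^ n) f (t⁻¹ • x) := by
  have hKt : ∀ x : EuclideanSpace ℝ (Fin n), Ω' (t • x) / ‖t • x‖ ^ n =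
      (t ^ finrank ℝ (EuclideanSpace ℝ (Fin n)))⁻¹ * (Ω' x / ‖x‖ ^ n) := by
    intro x
    rw [finrank_euclideanSpace_fin]
    rcases eq_or_ne x 0 with rfl | hx
    · simp [NeZero.ne n]
    · rw [hh' t ht x hx, norm_smul, Real.norm_of_nonneg ht.le, mul_pow]
      field_simp
  have h1 := hK.ae_tendsto_truncConv_dilateDensity ht hKt hf
  have h2 := hK.ae_integrableOn_truncation (integrable_dilateDensity ht hf)
  filter_upwards [h1, h2] with x hx hxi
  rw [finrank_euclideanSpace_fin] at hx
  rw [TOmega, map_smul_withDensityᵥ ht hf]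
  refine Tendsto.limUnder_eq (hx.congr' ?_)
  filter_upwards [self_mem_nhdsWithin] with ε hε
  exact (truncT_withDensityᵥ he mΩ' (measurable_dilateDensity t mf) (integrable_dilateDensity ht hf)
    (hxi ε hε)).symm

end Assembly

/-- Under the hypotheses of the main theorem, for every fixed `λ > 0`
the dilated measures `μ_t(E) = μ(E/t)` satisfy
`lim_{t→0⁺} λ · m({x : |T_Ω μ_t(x)| > λ}) = (1/n) ‖Ω‖_{L¹(S^{n-1})} |μ(ℝⁿ)|`. -/
theorem limiting_behavior_dilated_measures
    {n : ℕ} (hn : 0 < n) (Ω : EuclideanSpace ℝ (Fin n) → ℝ)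
    (hhom : HomogeneousZero Ω)
    (hmean : ∫ θ : unitSphere n, Ω (θ : EuclideanSpace ℝ (Fin n)) ∂(sphereMeasure n) = 0)
    (hdini : L1Dini n Ω)
    (μ : SignedMeasure (EuclideanSpace ℝ (Fin n)))
    (hac : μ ≪ᵥ (volume : Measure (EuclideanSpace ℝ (Fin n))).toENNRealVectorMeasure)
    (hfin : μ.totalVariation Set.univ < ⊤)
    (lam : ℝ) (hlam : 0 < lam) :
    Tendsto (fun t : ℝ =>
        ENNReal.ofReal lam *
          volume {x : EuclideanSpace ℝ (Fin n) | lam < |TOmega n Ω (μ.map (fun y => t • y)) x|})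
      (nhdsWithin 0 (Ioi 0))
      (nhds (ENNReal.ofReal ((1 / n) *
        (∫ θ : unitSphere n, |Ω (θ : EuclideanSpace ℝ (Fin n))| ∂(sphereMeasure n)) *
        |μ Set.univ|))) := by
  have : NeZero n := ⟨hn.ne'⟩
  have hΩ := hdini.1
  obtain ⟨Ω', mΩ', hh', he, A, hK⟩ := hdini.exists_isCZKernel hn hmean
  have hev : Ω =ᵐ[volume] Ω' := ae_eq_of_ae_eq_sphere hhom hh' he
  set f := μ.rnDeriv volume
  have mf : Measurable f := SignedMeasure.measurable_rnDeriv μ volume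
  have hf : Integrable f := SignedMeasure.integrable_rnDeriv μ volume
  have hμ : volume.withDensityᵥ f = μ :=
    (SignedMeasure.absolutelyContinuous_iff_withDensityᵥ_rnDeriv_eq μ volume).1 hac
  have hsphere : ∫⁻ θ : unitSphere n, ‖Ω' θ‖ₑ ∂(sphereMeasure n) =
      ENNReal.ofReal (∫ θ : unitSphere n, |Ω θ| ∂(sphereMeasure n)) :=
    (lintegral_congr_ae (he.mono fun θ h => by simp only [h])).trans
      (ofReal_integral_norm_eq_lintegral_enorm hΩ).symm
  have hn0 : (n : ENNReal) ≠ 0 := by exact_mod_cast hn.ne'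
  have key := hK.tendsto_mul_volume_dilate
    (W := (∫⁻ θ : unitSphere n, ‖Ω' θ‖ₑ ∂(sphereMeasure n)) / n)
    (ENNReal.div_ne_top (by rw [hsphere]; exact ENNReal.ofReal_ne_top) hn0)
    (fun a ha => by
      have h := volume_lt_abs_homogeneous_div mΩ' hh' ha
      rwa [finrank_euclideanSpace_fin] at h) hf hlam
  have hlimit : (∫⁻ θ : unitSphere n, ‖Ω' θ‖ₑ ∂(sphereMeasure n)) / n * ENNReal.ofReal |∫ x, f x| =
      ENNReal.ofReal ((1 / n) *
        (∫ θ : unitSphere n, |Ω (θ : EuclideanSpace ℝ (Fin n))| ∂(sphereMeasure n)) *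
        |μ Set.univ|) := by
    have hu : μ Set.univ = ∫ x, f x := by
      rw [← hμ, withDensityᵥ_apply hf MeasurableSet.univ, setIntegral_univ]
    rw [hsphere, hu, one_div_mul_eq_div, ENNReal.ofReal_mul' (abs_nonneg _),
      ENNReal.ofReal_div_of_pos (by exact_mod_cast hn), ENNReal.ofReal_natCast]
  rw [← hlimit]
  refine key.congr' ?_
  filter_upwards [self_mem_nhdsWithin] with t ht
  rw [finrank_euclideanSpace_fin]
  congr 1
  refine measure_congr (eventuallyEq_set.2 ?_)
  filter_upwards [ae_TOmega_map_smul hev mΩ' hh' hK mf hf ht] with x hx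
  rw [hμ] at hx
  rw [hx]
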